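/- Let a homeomorphism φ: Ω → Ω̃ between domains Ω, Ω̃ ⊂ ℝⁿ, n ≥ 3, satisfy the Luzin N-property and generate a bounded composition operator φ*: L¹ₙ(Ω̃) → L¹_{n−1}(Ω). Then φ is a Q-homeomorphism with Q(x) = K^I(x,φ) and K^I(·,φ) ∈ L₁(Ω). -/

import Mathlib

open MeasureTheory ENNReal Set Filter
open scoped RealInnerProductSpace

noncomputable section

attribute [local instance] Classical.propDecidable

/-- Euclidean space `ℝⁿ`. -/
abbrev Euc (n : ℕ) := EuclideanSpace ℝ (Fin n)

/-- A (parametrized) curve in `ℝⁿ`: a function considered on a compact interval `[a,b]`. -/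
structure Curve (n : ℕ) where
  a : ℝ
  b : ℝ
  hab : a ≤ b
  toFun : ℝ → Euc n

namespace Curve

variable {n : ℕ}

/-- The curve lies in the set `Ω`. -/
def In (γ : Curve n) (Ω : Set (Euc n)) : Prop :=
  ∀ t ∈ Icc γ.a γ.b, γ.toFun t ∈ Ω

/-- The curve is a (continuous) path. -/
def IsPath (γ : Curve n) : Prop := ContinuousOn γ.toFun (Icc γ.a γ.b)

/-- The curve is rectifiable: it has finite length (total variation). -/
def Rectifiable (γ : Curve n) : Prop := eVariationOn γ.toFun (Icc γ.a γ.b) < ⊤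

/-- `c : [0,l] → ℝⁿ` is a unit-speed (arclength) reparametrization of the curve `γ`. -/
def IsArclengthParam (γ : Curve n) (l : ℝ) (c : ℝ → Euc n) : Prop :=
  0 ≤ l ∧ (∀ t ∈ Icc (0:ℝ) l, eVariationOn c (Icc 0 t) = ENNReal.ofReal t) ∧
  ∃ σ : ℝ → ℝ, MonotoneOn σ (Icc γ.a γ.b) ∧ σ γ.a = 0 ∧ σ γ.b = l ∧
    (∀ t ∈ Icc γ.a γ.b, σ t ∈ Icc 0 l) ∧ ∀ t ∈ Icc γ.a γ.b, γ.toFun t = c (σ t)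

/-- The line integral `∫_γ ρ ds`, computed through an arclength parametrization of `γ`
(equal to `∞` if no arclength parametrization exists, e.g. for non-rectifiable curves). -/
def lineIntegral (γ : Curve n) (ρ : Euc n → ℝ≥0∞) : ℝ≥0∞ :=
  ⨅ (l : ℝ) (c : ℝ → Euc n) (_ : γ.IsArclengthParam l c),
    ∫⁻ t in Icc (0:ℝ) l, ρ (c t)

/-- The image curve `φ ∘ γ`. -/
def map (γ : Curve n) (φ : Euc n → Euc n) : Curve n :=
  ⟨γ.a, γ.b, γ.hab, φ ∘ γ.toFun⟩

end Curve

/-- `ρ` is an admissible (non-negative Borel) function for the curve family `Γ`: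
`∫_γ ρ ds ≥ 1` for every (locally) rectifiable `γ ∈ Γ`. -/
def IsAdmissible {n : ℕ} (Γ : Set (Curve n)) (ρ : Euc n → ℝ≥0∞) : Prop :=
  Measurable ρ ∧ ∀ γ ∈ Γ, γ.Rectifiable → 1 ≤ γ.lineIntegral ρ

/-- The conformal modulus `M(Γ)` of a family of curves in `ℝⁿ`. -/
def modulus {n : ℕ} (Γ : Set (Curve n)) : ℝ≥0∞ :=
  ⨅ (ρ : Euc n → ℝ≥0∞) (_ : IsAdmissible Γ ρ), ∫⁻ x, ρ x ^ (n : ℝ)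

/-- `φ` is a homeomorphism of `Ω` onto `Ω'`. -/
def IsHomeoOn {n : ℕ} (φ : Euc n → Euc n) (Ω Ω' : Set (Euc n)) : Prop :=
  Set.BijOn φ Ω Ω' ∧ ContinuousOn φ Ω ∧ ContinuousOn (Function.invFunOn φ Ω) Ω'

/-- `φ : Ω → Ω'` is a `Q`-homeomorphism: `M(φΓ) ≤ ∫_Ω Q ρⁿ` for every family `Γ` of
rectifiable paths in `Ω` and every admissible function `ρ` for `Γ`. -/
def IsQHomeo {n : ℕ} (φ : Euc n → Euc n) (Ω Ω' : Set (Euc n)) (Q : Euc n → ℝ≥0∞) : Prop :=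
  IsHomeoOn φ Ω Ω' ∧ Measurable Q ∧
  ∀ Γ : Set (Curve n), (∀ γ ∈ Γ, γ.In Ω ∧ γ.IsPath ∧ γ.Rectifiable) →
    ∀ ρ : Euc n → ℝ≥0∞, IsAdmissible Γ ρ →
      modulus ((fun γ => γ.map φ) '' Γ) ≤ ∫⁻ x in Ω, Q x * ρ x ^ (n : ℝ)

/-- `g` is a weak gradient of the scalar function `f` on `Ω` (integration by parts against
smooth compactly supported test functions). -/
def HasWeakGradientOn {n : ℕ} (f : Euc n → ℝ) (g : Euc n → Euc n) (Ω : Set (Euc n)) : Prop :=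
  LocallyIntegrableOn f Ω ∧ LocallyIntegrableOn g Ω ∧
  ∀ η : Euc n → ℝ, ContDiff ℝ (⊤ : ℕ∞) η → HasCompactSupport η → tsupport η ⊆ Ω →
    ∀ v : Euc n, ∫ x in Ω, f x * fderiv ℝ η x v = - ∫ x in Ω, ⟪g x, v⟫ * η x

/-- `D` is a weak differential of the mapping `φ : Ω → ℝⁿ`. -/
def HasWeakDerivOn {n : ℕ} (φ : Euc n → Euc n) (D : Euc n → Euc n →L[ℝ] Euc n)
    (Ω : Set (Euc n)) : Prop :=
  LocallyIntegrableOn φ Ω ∧ LocallyIntegrableOn D Ω ∧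
  ∀ η : Euc n → ℝ, ContDiff ℝ (⊤ : ℕ∞) η → HasCompactSupport η → tsupport η ⊆ Ω →
    ∀ v : Euc n, ∫ x in Ω, fderiv ℝ η x v • φ x = - ∫ x in Ω, η x • D x v

/-- The Jacobian `J(x,φ) = det Dφ(x)`. -/
def jacobian {n : ℕ} (D : Euc n → Euc n →L[ℝ] Euc n) (x : Euc n) : ℝ :=
  LinearMap.det (D x : Euc n →ₗ[ℝ] Euc n)

/-- `φ` (with weak differential `D`) has finite distortion on `Ω`:
`Dφ(x) = 0` a.e. on the zero set of the Jacobian. -/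
def FiniteDistortionOn {n : ℕ} (D : Euc n → Euc n →L[ℝ] Euc n) (Ω : Set (Euc n)) : Prop :=
  ∀ᵐ x ∂(volume.restrict Ω), jacobian D x = 0 → D x = 0

/-- The `L_p`-norm (`p ∈ (0,∞]`) of an `ℝ≥0∞`-valued function. -/
def lpNormE {n : ℕ} (f : Euc n → ℝ≥0∞) (p : ℝ≥0∞) (μ : Measure (Euc n)) : ℝ≥0∞ :=
  if p = ∞ then essSup f μ else (∫⁻ x, f x ^ p.toReal ∂μ) ^ (1 / p.toReal)

/-- `ψ : Ω → Ω'` generates, by the composition rule `f ↦ f ∘ ψ`, a bounded composition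
operator `L¹_p(Ω') → L¹_q(Ω)` with constant `K`. -/
def IsCompOpBddWith {n : ℕ} (Ω Ω' : Set (Euc n)) (ψ : Euc n → Euc n) (p q K : ℝ≥0∞) : Prop :=
  ∀ (f : Euc n → ℝ) (gf : Euc n → Euc n), HasWeakGradientOn f gf Ω' →
    lpNormE (fun x => (‖gf x‖₊ : ℝ≥0∞)) p (volume.restrict Ω') ≠ ∞ →
    ∃ g : Euc n → Euc n, HasWeakGradientOn (f ∘ ψ) g Ω ∧
      lpNormE (fun x => (‖g x‖₊ : ℝ≥0∞)) q (volume.restrict Ω) ≤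
        K * lpNormE (fun x => (‖gf x‖₊ : ℝ≥0∞)) p (volume.restrict Ω')

/-- `ψ : Ω → Ω'` generates a bounded composition operator `L¹_p(Ω') → L¹_q(Ω)`. -/
def IsCompOpBdd {n : ℕ} (Ω Ω' : Set (Euc n)) (ψ : Euc n → Euc n) (p q : ℝ≥0∞) : Prop :=
  ∃ K : ℝ≥0∞, K ≠ ∞ ∧ IsCompOpBddWith Ω Ω' ψ p q K

/-- The volume derivative `J_{φ⁻¹}(y) = lim_{r→0} |φ⁻¹(B(y,r))| / |B(y,r)|`
(as a limsup, so that it is everywhere defined). -/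
def volDerivInv {n : ℕ} (φ : Euc n → Euc n) (Ω : Set (Euc n)) (y : Euc n) : ℝ≥0∞ :=
  limsup (fun r : ℝ => volume (Ω ∩ φ ⁻¹' Metric.ball y r) / volume (Metric.ball y r))
    (nhdsWithin 0 (Ioi 0))

/-- The distortion function `H_q(y) = (|Dφ(x)|^q/|J(x,φ)|)^{1/q}` at `x = φ⁻¹(y)` outside
the singular set `S` and the zero set of the Jacobian, and `0` otherwise. -/
def distortionH {n : ℕ} (D : Euc n → Euc n →L[ℝ] Euc n) (φ : Euc n → Euc n)
    (Ω S : Set (Euc n)) (q : ℝ) (y : Euc n) : ℝ≥0∞ :=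
  if Function.invFunOn φ Ω y ∈ Ω \ (S ∪ {x | jacobian D x = 0}) then
    ((‖D (Function.invFunOn φ Ω y)‖₊ : ℝ≥0∞) ^ q /
      ENNReal.ofReal |jacobian D (Function.invFunOn φ Ω y)|) ^ (1 / q)
  else 0

/-- The `p`-dilatation `K_p(x) = inf {k : |Dφ(x)| ≤ k |J(x,φ)|^{1/p}}`. -/
def dilK {n : ℕ} (p : ℝ≥0∞) (D : Euc n → Euc n →L[ℝ] Euc n) (x : Euc n) : ℝ≥0∞ :=
  (‖D x‖₊ : ℝ≥0∞) / (ENNReal.ofReal |jacobian D x|) ^ (1/p).toReal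

/-- Local `L_q`-integrability of the weak differential on `Ω`
(the differential part of `φ ∈ W¹_{q,loc}(Ω)`). -/
def MemWlocOn {n : ℕ} (D : Euc n → Euc n →L[ℝ] Euc n) (q : ℝ≥0∞) (Ω : Set (Euc n)) : Prop :=
  ∀ K : Set (Euc n), K ⊆ Ω → IsCompact K →
    lpNormE (fun x => (‖D x‖₊ : ℝ≥0∞)) q (volume.restrict K) ≠ ∞

/-- Minimal stretch `l(T) = min {|T h| : |h| = 1}`. -/
def minStretch {n : ℕ} (T : Euc n →L[ℝ] Euc n) : ℝ :=
  ⨅ h : {h : Euc n // ‖h‖ = 1}, ‖T h.1‖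

/-- The inner conformal dilatation `K^I(x,φ) = |J(x,φ)| / l(Dφ(x))ⁿ` (and `0` when
`J(x,φ) = 0`). -/
def innerDil {n : ℕ} (D : Euc n → Euc n →L[ℝ] Euc n) (x : Euc n) : ℝ≥0∞ :=
  if jacobian D x = 0 then 0
  else ENNReal.ofReal (|jacobian D x| / minStretch (D x) ^ n)

/-- `Ω` is an `(s,q)`-Sobolev–Poincaré domain with constant `B`. -/
def IsSobolevPoincare {n : ℕ} (Ω : Set (Euc n)) (s q : ℝ) (B : ℝ≥0∞) : Prop :=
  ∀ (g : Euc n → ℝ) (gg : Euc n → Euc n), HasWeakGradientOn g gg Ω →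
    ⨅ c : ℝ, (∫⁻ x in Ω, (‖g x - c‖₊ : ℝ≥0∞) ^ s) ^ (1/s) ≤
      B * (∫⁻ x in Ω, (‖gg x‖₊ : ℝ≥0∞) ^ q) ^ (1/q)

/-- `Ω` is a domain: an open connected set. -/
def IsDomainIn {n : ℕ} (Ω : Set (Euc n)) : Prop := IsOpen Ω ∧ IsConnected Ω

/-- The mapping satisfies the Luzin `N`-property on `Ω`. -/
def LuzinN {n : ℕ} (φ : Euc n → Euc n) (Ω : Set (Euc n)) : Prop :=
  ∀ A ⊆ Ω, volume A = 0 → volume (φ '' A) = 0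

section

variable {n : ℕ} {F : Type*} [NormedAddCommGroup F] [NormedSpace ℝ F]

/-- The standard sequence of mollifiers. -/
def mollifier (n k : ℕ) : ContDiffBump (0 : Euc n) where
  rIn := 1 / (k + 1) / 2
  rOut := 1 / (k + 1)
  rIn_pos := by positivity
  rIn_lt_rOut := half_lt_self (by positivity)

/-- The normalized kernel of the standard mollifier. -/
def mollKernel (n k : ℕ) : Euc n → ℝ := (mollifier n k).normed volume

lemma mollKernel_nonneg (k : ℕ) (x : Euc n) : 0 ≤ mollKernel n k x :=
  (mollifier n k).nonneg_normed x

lemma integral_mollKernel (k : ℕ) : ∫ x, mollKernel n k x = 1 :=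
  (mollifier n k).integral_normed

lemma contDiff_mollKernel (k : ℕ) : ContDiff ℝ (⊤ : ℕ∞) (mollKernel n k) :=
  (mollifier n k).contDiff_normed

lemma hasCompactSupport_mollKernel (k : ℕ) : HasCompactSupport (mollKernel n k) :=
  (mollifier n k).hasCompactSupport_normed

lemma tsupport_mollKernel (k : ℕ) :
    tsupport (mollKernel n k) = Metric.closedBall 0 (1 / (k + 1)) :=
  (mollifier n k).tsupport_normed_eq

lemma mollKernel_eq_zero {k : ℕ} {x : Euc n} (h : 1 / ((k : ℝ) + 1) < ‖x‖) :
    mollKernel n k x = 0 := by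
  apply image_eq_zero_of_notMem_tsupport
  rw [tsupport_mollKernel]
  simpa using h

lemma integrable_mollKernel (k : ℕ) : Integrable (mollKernel n k) :=
  (mollifier n k).integrable_normed

lemma lintegral_mollKernel (k : ℕ) : ∫⁻ x, ENNReal.ofReal (mollKernel n k x) = 1 := by
  rw [← ofReal_integral_eq_lintegral_ofReal (integrable_mollKernel k)
    (Eventually.of_forall (mollKernel_nonneg k)), integral_mollKernel, ENNReal.ofReal_one]

lemma tendsto_one_div_nat_add_one :
    Tendsto (fun k : ℕ => 1 / ((k : ℝ) + 1)) atTop (nhds 0) :=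
  tendsto_one_div_add_atTop_nhds_zero_nat

/-- Mollification of a function. -/
def mollify (k : ℕ) (u : Euc n → F) (x : Euc n) : F := ∫ t, mollKernel n k t • u (x - t)

lemma mollify_eq_convolution (k : ℕ) (u : Euc n → F) :
    mollify k u = convolution (mollKernel n k) u (ContinuousLinearMap.lsmul ℝ ℝ) volume := rfl

lemma contDiff_mollify [CompleteSpace F] (k : ℕ) {u : Euc n → F} (hu : LocallyIntegrable u) :
    ContDiff ℝ (⊤ : ℕ∞) (mollify k u) := by
  rw [mollify_eq_convolution]
  exact (hasCompactSupport_mollKernel k).contDiff_convolution_left _ (contDiff_mollKernel k) hu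

lemma exists_nat_one_div_lt' {δ : ℝ} (hδ : 0 < δ) :
    ∀ᶠ k : ℕ in atTop, 1 / ((k : ℝ) + 1) < δ :=
  tendsto_one_div_nat_add_one.eventually_lt_const hδ

/-- Translations are continuous in `L^p`. -/
lemma tendsto_eLpNorm_translate_sub {f : Euc n → F} {p : ℝ≥0∞} (hp1 : 1 ≤ p) (hp : p ≠ ∞)
    (hf : MemLp f p) :
    Tendsto (fun t : Euc n => eLpNorm (fun x => f (x - t) - f x) p volume) (nhds 0) (nhds 0) := by
  have : Fact (1 ≤ p) := ⟨hp1⟩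
  have : Fact (p ≠ ∞) := ⟨hp⟩
  have hc : Continuous (fun t : Euc n => DomAddAct.mk (-t) +ᵥ hf.toLp f) := by
    have : Continuous (fun t : Euc n => DomAddAct.mk (-t)) :=
      DomAddAct.continuous_mk.comp continuous_neg
    exact this.vadd continuous_const
  have h0 := hc.tendsto 0
  rw [EMetric.tendsto_nhds] at h0
  rw [ENNReal.tendsto_nhds_zero]
  intro ε hε
  filter_upwards [h0 ε hε] with t ht
  rw [DomAddAct.mk_vadd_toLp, DomAddAct.mk_vadd_toLp, Lp.edist_toLp_toLp] at ht
  refine le_trans (le_of_eq ?_) ht.le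
  congr 1
  ext x
  simp [sub_eq_neg_add]

lemma enorm_integral_mollKernel_smul_rpow_le (k : ℕ) {p : ℝ} (hp : 1 ≤ p) {g : Euc n → F}
    (hg : AEStronglyMeasurable g) :
    ‖∫ t, mollKernel n k t • g t‖ₑ ^ p ≤ ∫⁻ t, ENNReal.ofReal (mollKernel n k t) * ‖g t‖ₑ ^ p := by
  set μ : Measure (Euc n) := volume.withDensity fun t => ENNReal.ofReal (mollKernel n k t) with hμ
  have hmeas : Measurable fun t => ENNReal.ofReal (mollKernel n k t) :=
    (contDiff_mollKernel k).continuous.measurable.ennreal_ofReal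
  have hprob : IsProbabilityMeasure μ := ⟨by simp [hμ, lintegral_mollKernel]⟩
  have hgμ : AEStronglyMeasurable g μ := hg.mono_ac (withDensity_absolutelyContinuous _ _)
  have h1 := eLpNorm_le_eLpNorm_of_exponent_le (μ := μ) (f := g) (p := 1) (q := ENNReal.ofReal p)
    (by simpa using hp) hgμ
  have hp0 : 0 < p := by linarith
  rw [eLpNorm_one_eq_lintegral_enorm, eLpNorm_eq_lintegral_rpow_enorm_toReal (by simpa using hp0)
    ENNReal.ofReal_ne_top, ENNReal.toReal_ofReal hp0.le,
    one_div, ENNReal.le_rpow_inv_iff hp0] at h1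
  have h2 : ‖∫ t, mollKernel n k t • g t‖ₑ ≤ ∫⁻ t, ‖g t‖ₑ ∂μ := by
    refine (enorm_integral_le_lintegral_enorm _).trans (le_of_eq ?_)
    rw [hμ, lintegral_withDensity_eq_lintegral_mul₀ hmeas.aemeasurable hg.enorm]
    refine lintegral_congr fun t => ?_
    simp [enorm_smul, Real.enorm_of_nonneg (mollKernel_nonneg k t)]
  calc _ ≤ (∫⁻ t, ‖g t‖ₑ ∂μ) ^ p := by gcongr
    _ ≤ _ := h1
    _ = _ := by
      rw [hμ, lintegral_withDensity_eq_lintegral_mul₀ hmeas.aemeasurable (hg.enorm.pow_const _)]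
      rfl

lemma mollify_sub_self [CompleteSpace F] (k : ℕ) {u : Euc n → F} (hu : LocallyIntegrable u) (x : Euc n) (a : F) :
    mollify k u x - a = ∫ t, mollKernel n k t • (u (x - t) - a) := by
  have hi : Integrable fun t => mollKernel n k t • u (x - t) :=
    (hasCompactSupport_mollKernel k).convolutionExists_left (ContinuousLinearMap.lsmul ℝ ℝ)
      (contDiff_mollKernel k).continuous hu x
  simp only [smul_sub]
  rw [integral_sub hi ((integrable_mollKernel k).smul_const a), integral_smul_const,
    integral_mollKernel, one_smul]
  rfl

lemma tendsto_lintegral_mollify_sub [CompleteSpace F] {f : Euc n → F} {p : ℝ} (hp : 1 ≤ p)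
    (hf : MemLp f (ENNReal.ofReal p)) :
    Tendsto (fun k => ∫⁻ x, ‖mollify k f x - f x‖ₑ ^ p) atTop (nhds 0) := by
  have hp0 : 0 < p := by linarith
  have hp1 : 1 ≤ ENNReal.ofReal p := by simpa using hp
  have hloc : LocallyIntegrable f := hf.locallyIntegrable hp1
  have h0 := tendsto_eLpNorm_translate_sub hp1 ENNReal.ofReal_ne_top hf
  have hm : AEStronglyMeasurable (fun z : Euc n × Euc n => f (z.1 - z.2) - f z.1)
      (volume.prod volume) :=
    (hf.1.comp_quasiMeasurePreserving (quasiMeasurePreserving_sub volume volume)).sub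
      hf.1.comp_fst
  rw [ENNReal.tendsto_nhds_zero] at h0 ⊢
  intro ε hε
  have hε' : (0 : ℝ≥0∞) < ε ^ (1 / p) := by
    exact ENNReal.rpow_pos_of_nonneg hε (by positivity)
  obtain ⟨δ, hδ, hb⟩ := Metric.eventually_nhds_iff.1 (h0 _ hε')
  filter_upwards [exists_nat_one_div_lt' hδ] with k hk
  have hm2 : AEMeasurable (fun z : Euc n × Euc n =>
      ENNReal.ofReal (mollKernel n k z.2) * ‖f (z.1 - z.2) - f z.1‖ₑ ^ p)
      (volume.prod volume) := by
    refine AEMeasurable.mul ?_ (hm.enorm.pow_const _)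
    exact ((contDiff_mollKernel k).continuous.measurable.ennreal_ofReal.comp
      measurable_snd).aemeasurable
  calc ∫⁻ x, ‖mollify k f x - f x‖ₑ ^ p
      ≤ ∫⁻ x, ∫⁻ t, ENNReal.ofReal (mollKernel n k t) * ‖f (x - t) - f x‖ₑ ^ p := by
        refine lintegral_mono fun x => ?_
        rw [mollify_sub_self k hloc]
        refine enorm_integral_mollKernel_smul_rpow_le k hp ?_
        exact (hf.1.comp_quasiMeasurePreserving
          (quasiMeasurePreserving_sub_left volume x)).sub aestronglyMeasurable_const
    _ = ∫⁻ t, ∫⁻ x, ENNReal.ofReal (mollKernel n k t) * ‖f (x - t) - f x‖ₑ ^ p :=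
        lintegral_lintegral_swap hm2
    _ ≤ ∫⁻ t, ENNReal.ofReal (mollKernel n k t) * ε := by
        refine lintegral_mono fun t => ?_
        simp only
        rw [lintegral_const_mul' _ _ ENNReal.ofReal_ne_top]
        by_cases ht : 1 / ((k : ℝ) + 1) < ‖t‖
        · simp [mollKernel_eq_zero ht]
        · gcongr
          have := hb (y := t) (by rw [dist_zero_right]; linarith)
          rw [eLpNorm_eq_lintegral_rpow_enorm_toReal (by simpa using hp0)
            ENNReal.ofReal_ne_top, ENNReal.toReal_ofReal hp0.le] at this
          exact (ENNReal.rpow_le_rpow_iff (by positivity)).1 this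
    _ = ε := by
        rw [lintegral_mul_const _ (contDiff_mollKernel k).continuous.measurable.ennreal_ofReal, lintegral_mollKernel, one_mul]

/-- `D` is a weak differential of `u` on `U`. -/
def WeakDeriv (u : Euc n → F) (D : Euc n → Euc n →L[ℝ] F) (U : Set (Euc n)) : Prop :=
  LocallyIntegrableOn u U ∧ LocallyIntegrableOn D U ∧
  ∀ η : Euc n → ℝ, ContDiff ℝ (⊤ : ℕ∞) η → HasCompactSupport η → tsupport η ⊆ U →
    ∀ v : Euc n, ∫ x in U, fderiv ℝ η x v • u x = - ∫ x in U, η x • D x v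

lemma setIntegral_smul_eq_of_tsupport_subset {η : Euc n → ℝ} {U : Set (Euc n)}
    (hη : tsupport η ⊆ U) (g : Euc n → F) :
    ∫ x in U, η x • g x = ∫ x, η x • g x := by
  apply setIntegral_eq_integral_of_forall_compl_eq_zero
  intro x hx
  rw [image_eq_zero_of_notMem_tsupport fun h => hx (hη h), zero_smul]

lemma setIntegral_fderiv_smul_eq_of_tsupport_subset {η : Euc n → ℝ} {U : Set (Euc n)}
    (hη : tsupport η ⊆ U) (v : Euc n) (g : Euc n → F) :
    ∫ x in U, fderiv ℝ η x v • g x = ∫ x, fderiv ℝ η x v • g x := by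
  apply setIntegral_eq_integral_of_forall_compl_eq_zero
  intro x hx
  rw [image_eq_zero_of_notMem_tsupport fun h => hx (hη (tsupport_fderiv_subset ℝ h))]
  simp

lemma WeakDeriv.integral_eq {u : Euc n → F} {D : Euc n → Euc n →L[ℝ] F} {U : Set (Euc n)}
    (h : WeakDeriv u D U) {η : Euc n → ℝ} (h1 : ContDiff ℝ (⊤ : ℕ∞) η) (h2 : HasCompactSupport η)
    (h3 : tsupport η ⊆ U) (v : Euc n) :
    ∫ x, fderiv ℝ η x v • u x = - ∫ x, η x • D x v := by
  rw [← setIntegral_fderiv_smul_eq_of_tsupport_subset h3,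
    ← setIntegral_smul_eq_of_tsupport_subset h3]
  exact h.2.2 η h1 h2 h3 v

lemma weakDeriv_iff {u : Euc n → F} {D : Euc n → Euc n →L[ℝ] F} {U : Set (Euc n)} :
    WeakDeriv u D U ↔ LocallyIntegrableOn u U ∧ LocallyIntegrableOn D U ∧
      ∀ η : Euc n → ℝ, ContDiff ℝ (⊤ : ℕ∞) η → HasCompactSupport η → tsupport η ⊆ U →
      ∀ v : Euc n, ∫ x, fderiv ℝ η x v • u x = - ∫ x, η x • D x v := by
  refine ⟨fun h => ⟨h.1, h.2.1, fun η h1 h2 h3 v => h.integral_eq h1 h2 h3 v⟩,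
    fun h => ⟨h.1, h.2.1, fun η h1 h2 h3 v => ?_⟩⟩
  rw [setIntegral_fderiv_smul_eq_of_tsupport_subset h3,
    setIntegral_smul_eq_of_tsupport_subset h3]
  exact h.2.2 η h1 h2 h3 v

lemma WeakDeriv.mono {u : Euc n → F} {D : Euc n → Euc n →L[ℝ] F} {U V : Set (Euc n)}
    (h : WeakDeriv u D U) (hVU : V ⊆ U) : WeakDeriv u D V :=
  weakDeriv_iff.2 ⟨h.1.mono_set hVU, h.2.1.mono_set hVU,
    fun _ h1 h2 h3 v => h.integral_eq h1 h2 (h3.trans hVU) v⟩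

lemma WeakDeriv.congr {u u' : Euc n → F} {D D' : Euc n → Euc n →L[ℝ] F} {U : Set (Euc n)}
    (h : WeakDeriv u D U) (hu : u =ᵐ[volume.restrict U] u')
    (hD : D =ᵐ[volume.restrict U] D') : WeakDeriv u' D' U := by
  have aux : ∀ {G : Type _} [NormedAddCommGroup G] (f g : Euc n → G),
      f =ᵐ[volume.restrict U] g → LocallyIntegrableOn f U → LocallyIntegrableOn g U := by
    intro G _ f g hfg hf x hx
    obtain ⟨s, hs, hsi⟩ := hf x hx
    refine ⟨U ∩ s, inter_mem self_mem_nhdsWithin hs, ?_⟩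
    have h1 : IntegrableOn f (U ∩ s) := hsi.mono_set inter_subset_right
    exact h1.congr_fun_ae (ae_restrict_of_ae_restrict_of_subset inter_subset_left hfg)
  refine ⟨aux _ _ hu h.1, aux _ _ hD h.2.1, fun η h1 h2 h3 v => ?_⟩
  have e1 : ∫ x in U, fderiv ℝ η x v • u' x = ∫ x in U, fderiv ℝ η x v • u x :=
    integral_congr_ae (by filter_upwards [hu] with x hx; rw [hx])
  have e2 : ∫ x in U, η x • D' x v = ∫ x in U, η x • D x v :=
    integral_congr_ae (by filter_upwards [hD] with x hx; rw [hx])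
  rw [e1, e2]
  exact h.2.2 η h1 h2 h3 v

lemma MeasureTheory.LocallyIntegrableOn.integrable_smul {η : Euc n → ℝ} {U : Set (Euc n)} {g : Euc n → F}
    (hg : LocallyIntegrableOn g U) (hη : Continuous η) (hc : HasCompactSupport η)
    (hs : tsupport η ⊆ U) : Integrable fun x => η x • g x := by
  have h1 : IntegrableOn g (tsupport η) := hg.integrableOn_compact_subset hs hc
  obtain ⟨C, hC⟩ := hη.bounded_above_of_compact_support hc
  have h2 : IntegrableOn (fun x => η x • g x) (tsupport η) :=
    h1.bdd_smul C hη.aestronglyMeasurable (Eventually.of_forall hC)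
  refine (integrableOn_iff_integrable_of_support_subset ?_).1 h2
  exact (Function.support_smul_subset_left _ _).trans (subset_tsupport _)

lemma locallyIntegrable_indicator {G : Type*} [NormedAddCommGroup G] {f : Euc n → G}
    {K : Set (Euc n)} (hK : MeasurableSet K) (h : IntegrableOn f K) :
    LocallyIntegrable (K.indicator f) :=
  (h.integrable_indicator hK).locallyIntegrable

lemma fderiv_mollify_indicator [CompleteSpace F] {u : Euc n → F} {D : Euc n → Euc n →L[ℝ] F}
    {U K : Set (Euc n)} (h : WeakDeriv u D U) {δ : ℝ} (hK : MeasurableSet K)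
    (hui : IntegrableOn u K) (hDi : IntegrableOn D K) (hKU : K ⊆ U)
    {x : Euc n} (hx : Metric.closedBall x δ ⊆ K) {k : ℕ} (hk : 1 / ((k : ℝ) + 1) ≤ δ) :
    fderiv ℝ (mollify k (K.indicator u)) x = mollify k (K.indicator D) x := by
  have hu' : LocallyIntegrable (K.indicator u) := locallyIntegrable_indicator hK hui
  have hD' : LocallyIntegrable (K.indicator D) := locallyIntegrable_indicator hK hDi
  have hf := ((hasCompactSupport_mollKernel (n := n) k).hasFDerivAt_convolution_left
    (ContinuousLinearMap.lsmul ℝ ℝ) ((contDiff_mollKernel k).of_le (by simp)) hu' x).fderiv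
  rw [mollify_eq_convolution, hf]
  ext v
  set η : Euc n → ℝ := fun z => mollKernel n k (x - z) with hη
  have hη1 : ContDiff ℝ (⊤ : ℕ∞) η := (contDiff_mollKernel k).comp (contDiff_const.sub contDiff_id)
  have hsupp : ∀ z, z ∉ Metric.closedBall x δ → η z = 0 := by
    intro z hz
    apply mollKernel_eq_zero
    rw [Metric.mem_closedBall, dist_comm, dist_eq_norm] at hz
    linarith
  have hts : tsupport η ⊆ Metric.closedBall x δ :=
    closure_minimal (fun z hz => by_contra fun h' => hz (hsupp z h')) Metric.isClosed_closedBall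
  have hη2 : HasCompactSupport η := HasCompactSupport.of_support_subset_isCompact
    (isCompact_closedBall x δ) ((subset_tsupport _).trans hts)
  have hder : ∀ z v, fderiv ℝ η z v = - fderiv ℝ (mollKernel n k) (x - z) v := by
    intro z v
    have h1 : HasFDerivAt η _ z :=
      (((contDiff_mollKernel (n := n) k).differentiable (by simp)) (x - z)).hasFDerivAt.comp z
        ((hasFDerivAt_id z).const_sub x)
    rw [h1.fderiv]; simp
  have key := h.integral_eq hη1 hη2 (hts.trans (hx.trans hKU)) v
  have hitg : Integrable fun t => mollKernel n k (x - t) • (K.indicator D) t := by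
    exact LocallyIntegrableOn.integrable_smul (hD'.locallyIntegrableOn univ) hη1.continuous hη2 (subset_univ _)
  have e2 : mollify k (K.indicator D) x v = ∫ z, η z • D z v := by
    have : mollify k (K.indicator D) x = ∫ t, mollKernel n k (x - t) • (K.indicator D) t := by
      rw [← integral_sub_left_eq_self _ volume x]
      simp [mollify]
    rw [this, ContinuousLinearMap.integral_apply hitg]
    refine integral_congr_ae (Eventually.of_forall fun z => ?_)
    simp only [smul_apply]
    by_cases hz : z ∈ K
    · rw [indicator_of_mem hz]
    · have : η z = 0 := hsupp z fun h' => hz (hx h')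
      rw [this, show mollKernel n k (x - z) = 0 from this, zero_smul, zero_smul]
  have hitg2 := (((hasCompactSupport_mollKernel (n := n) k).fderiv ℝ).convolutionExists_left
    ((ContinuousLinearMap.lsmul ℝ ℝ : ℝ →L[ℝ] F →L[ℝ] F).precompL (Euc n))
    ((contDiff_mollKernel k).continuous_fderiv (by simp)) hu' x)
  rw [e2, convolution_def, ContinuousLinearMap.integral_apply hitg2, ← neg_eq_iff_eq_neg.2 key,
    ← integral_neg, ← integral_sub_left_eq_self _ volume x]
  refine integral_congr_ae (Eventually.of_forall fun z => ?_)
  simp only [ContinuousLinearMap.precompL_apply, ContinuousLinearMap.lsmul_apply, _root_.sub_sub_cancel,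
    hder, neg_smul, neg_neg]
  by_cases hz : z ∈ K
  · rw [indicator_of_mem hz]
  · have h1 : fderiv ℝ η z v = 0 := by
      rw [image_eq_zero_of_notMem_tsupport fun h' =>
        hz (hx (hts (tsupport_fderiv_subset ℝ h')))]
      rfl
    rw [hder, neg_eq_zero] at h1
    rw [h1, zero_smul, zero_smul]

lemma tendstoUniformlyOn_mollify_indicator [CompleteSpace F] {u : Euc n → F} {K K' : Set (Euc n)}
    {δ : ℝ} (hδ : 0 < δ) (hK' : IsCompact K') (hKK' : ∀ x ∈ K, Metric.closedBall x δ ⊆ K')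
    (hu : ContinuousOn u K') :
    TendstoUniformlyOn (fun k => mollify k (K'.indicator u)) u atTop K := by
  have hloc : LocallyIntegrable (K'.indicator u) :=
    locallyIntegrable_indicator hK'.measurableSet (hu.integrableOn_compact hK')
  have huc := hK'.uniformContinuousOn_of_continuous hu
  rw [Metric.tendstoUniformlyOn_iff]
  intro ε hε
  obtain ⟨r, hr, hru⟩ := Metric.uniformContinuousOn_iff.1 huc (ε / 2) (half_pos hε)
  filter_upwards [exists_nat_one_div_lt' (lt_min hδ hr)] with k hk x hx
  rw [dist_comm, dist_eq_norm, mollify_sub_self k hloc]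
  have hk1 := hk.trans_le (min_le_left _ _)
  have hk2 := hk.trans_le (min_le_right _ _)
  have hxK : x ∈ K' := hKK' x hx (Metric.mem_closedBall_self hδ.le)
  have hb : ∀ t, ‖mollKernel n k t • (K'.indicator u (x - t) - u x)‖
      ≤ mollKernel n k t * (ε / 2) := by
    intro t
    rw [norm_smul, Real.norm_of_nonneg (mollKernel_nonneg k t)]
    by_cases ht : 1 / ((k : ℝ) + 1) < ‖t‖
    · simp [mollKernel_eq_zero ht]
    · push Not at ht
      have hmem : x - t ∈ K' := hKK' x hx (by
        rw [Metric.mem_closedBall, dist_eq_norm]; simpa using ht.trans hk1.le)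
      rw [indicator_of_mem hmem, ← dist_eq_norm]
      refine mul_le_mul_of_nonneg_left ?_ (mollKernel_nonneg k t)
      refine (hru _ hmem _ hxK ?_).le
      rw [dist_eq_norm]; simpa using ht.trans_lt hk2
  calc _ ≤ ∫ t, mollKernel n k t * (ε / 2) :=
        norm_integral_le_of_norm_le ((integrable_mollKernel k).mul_const _)
          (Eventually.of_forall hb)
    _ = ε / 2 := by rw [integral_mul_const, integral_mollKernel, one_mul]
    _ < ε := half_lt_self hε

lemma exists_closedBall_subset_compact {U K : Set (Euc n)} (hU : IsOpen U) (hK : IsCompact K)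
    (hKU : K ⊆ U) : ∃ K' : Set (Euc n), IsCompact K' ∧ K ⊆ interior K' ∧ K' ⊆ U ∧ ∃ δ > 0,
      ∀ x ∈ K, Metric.closedBall x δ ⊆ K' := by
  obtain ⟨δ, hδ, h⟩ := hK.exists_cthickening_subset_open hU hKU
  refine ⟨Metric.cthickening δ K, hK.cthickening, ?_, h, δ, hδ,
    fun x hx => Metric.closedBall_subset_cthickening hx δ⟩
  exact (Metric.self_subset_thickening hδ K).trans
    (interior_maximal (Metric.thickening_subset_cthickening δ K) Metric.isOpen_thickening)

lemma memLp_indicator {G : Type*} [NormedAddCommGroup G] {f : Euc n → G} {p : ℝ≥0∞}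
    {K : Set (Euc n)} (hK : MeasurableSet K) (h : MemLp f p (volume.restrict K)) :
    MemLp (K.indicator f) p :=
  (memLp_indicator_iff_restrict hK).2 h

/-- Smooth approximation of continuous Sobolev functions near a compact set. -/
lemma WeakDeriv.exists_smooth_approx [CompleteSpace F] {u : Euc n → F} {D : Euc n → Euc n →L[ℝ] F}
    {U K : Set (Euc n)} (hU : IsOpen U) (h : WeakDeriv u D U) (hu : ContinuousOn u U)
    (hK : IsCompact K) (hKU : K ⊆ U) {p : ℝ} (hp : 1 ≤ p)
    (hD : ∀ K ⊆ U, IsCompact K → MemLp D (ENNReal.ofReal p) (volume.restrict K)) :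
    ∃ v : ℕ → Euc n → F, (∀ k, ContDiff ℝ (⊤ : ℕ∞) (v k)) ∧ TendstoUniformlyOn v u atTop K ∧
      Tendsto (fun k => ∫⁻ x in K, ‖fderiv ℝ (v k) x - D x‖ₑ ^ p) atTop (nhds 0) := by
  obtain ⟨K', hK', -, hK'U, δ, hδ, hKK'⟩ := exists_closedBall_subset_compact hU hK hKU
  have hui : IntegrableOn u K' := (hu.mono hK'U).integrableOn_compact hK'
  have hDi : IntegrableOn D K' := h.2.1.integrableOn_compact_subset hK'U hK'
  refine ⟨fun k => mollify k (K'.indicator u),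
    fun k => contDiff_mollify k (locallyIntegrable_indicator hK'.measurableSet hui),
    tendstoUniformlyOn_mollify_indicator hδ hK' hKK' (hu.mono hK'U), ?_⟩
  have hDp : MemLp (K'.indicator D) (ENNReal.ofReal p) :=
    memLp_indicator hK'.measurableSet (hD K' hK'U hK')
  refine tendsto_of_tendsto_of_tendsto_of_le_of_le' tendsto_const_nhds
    (tendsto_lintegral_mollify_sub hp hDp) (Eventually.of_forall fun _ => bot_le) ?_
  filter_upwards [exists_nat_one_div_lt' hδ] with k hk
  refine le_trans (setLIntegral_mono' hK.measurableSet fun x hx => le_of_eq ?_)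
    (setLIntegral_le_lintegral K _)
  rw [fderiv_mollify_indicator h hK'.measurableSet hui hDi hK'U (hKK' x hx) hk.le,
    indicator_of_mem (hKK' x hx (Metric.mem_closedBall_self hδ.le))]

lemma ContDiff.integral_fderiv_smul_eq [CompleteSpace F] {η : Euc n → ℝ} {u : Euc n → F}
    (hη : ContDiff ℝ 1 η) (hc : HasCompactSupport η) (hu : ContDiff ℝ 1 u) (v : Euc n) :
    ∫ x, fderiv ℝ η x v • u x = - ∫ x, η x • fderiv ℝ u x v := by
  have h1 : Integrable fun x => fderiv ℝ η x v • u x := by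
    refine Continuous.integrable_of_hasCompactSupport ?_ ?_
    · exact ((hη.continuous_fderiv (by simp)).clm_apply continuous_const).smul hu.continuous
    · exact (hc.fderiv_apply ℝ v).smul_right
  have h2 : Integrable fun x => η x • fderiv ℝ u x v := by
    refine Continuous.integrable_of_hasCompactSupport ?_ hc.smul_right
    exact hη.continuous.smul ((hu.continuous_fderiv (by simp)).clm_apply continuous_const)
  have h3 : Integrable fun x => η x • u x :=
    Continuous.integrable_of_hasCompactSupport (hη.continuous.smul hu.continuous) hc.smul_right
  rw [integral_smul_fderiv_eq_neg_fderiv_smul_of_integrable h1 h2 h3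
    (fun x _ => hη.differentiable (by simp) x) (fun x _ => hu.differentiable (by simp) x), neg_neg]

lemma WeakDeriv.ae_eq [CompleteSpace F] {u : Euc n → F} {D D' : Euc n → Euc n →L[ℝ] F}
    {U : Set (Euc n)} (hU : IsOpen U) (h : WeakDeriv u D U) (h' : WeakDeriv u D' U) :
    ∀ᵐ x ∂volume.restrict U, D x = D' x := by
  have key : ∀ v : Euc n, ∀ᵐ x ∂volume.restrict U, D x v - D' x v = 0 := by
    intro v
    have hl : ∀ {D : Euc n → Euc n →L[ℝ] F}, LocallyIntegrableOn D U →
        LocallyIntegrableOn (fun x => D x v) U := by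
      intro D hD x hx
      obtain ⟨s, hs, hi⟩ := hD x hx
      exact ⟨s, hs, hi.apply_continuousLinearMap v⟩
    rw [ae_restrict_iff' hU.measurableSet]
    refine hU.ae_eq_zero_of_integral_contDiff_smul_eq_zero
      ((hl h.2.1).sub (hl h'.2.1)) fun η h1 h2 h3 => ?_
    have i1 := (hl h.2.1).integrable_smul h1.continuous h2 h3
    have i2 := (hl h'.2.1).integrable_smul h1.continuous h2 h3
    simp only [smul_sub]
    rw [integral_sub i1 i2, sub_eq_zero, ← neg_inj, ← h.integral_eq h1 h2 h3 v,
      ← h'.integral_eq h1 h2 h3 v]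
  have b := (EuclideanSpace.basisFun (Fin n) ℝ).toBasis
  have hall : ∀ᵐ x ∂volume.restrict U, ∀ i, D x (b i) - D' x (b i) = 0 :=
    ae_all_iff.2 fun i => key _
  filter_upwards [hall] with x hx
  refine ContinuousLinearMap.coe_injective (b.ext fun i => ?_)
  exact sub_eq_zero.1 (hx i)

lemma WeakDeriv.comp_left [CompleteSpace F] {G : Type*} [NormedAddCommGroup G] [NormedSpace ℝ G]
    [CompleteSpace G] {u : Euc n → F} {D : Euc n → Euc n →L[ℝ] F}
    {U : Set (Euc n)} (hU : IsOpen U) (h : WeakDeriv u D U) (hu : ContinuousOn u U)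
    {f : F → G} (hf : ContDiff ℝ 1 f) {C : ℝ} (hfC : ∀ y, ‖f y‖ ≤ C)
    (hfC' : ∀ y, ‖fderiv ℝ f y‖ ≤ C) :
    WeakDeriv (f ∘ u) (fun x => (fderiv ℝ f (u x)).comp (D x)) U := by
  have hC0 : 0 ≤ C := (norm_nonneg _).trans (hfC 0)
  have hf' : Continuous (fderiv ℝ f) := hf.continuous_fderiv (by simp)
  have hcompK : ∀ K ⊆ U, IsCompact K →
      IntegrableOn (fun x => (fderiv ℝ f (u x)).comp (D x)) K := by
    intro K hKU hK
    have hDK := h.2.1.integrableOn_compact_subset hKU hK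
    refine Integrable.mono' (hDK.norm.const_mul C) ?_ (Eventually.of_forall fun x => ?_)
    · have h1 : AEStronglyMeasurable (fun x => fderiv ℝ f (u x)) (volume.restrict K) :=
        (hf'.comp_continuousOn (hu.mono hKU)).aestronglyMeasurable_of_isCompact hK hK.measurableSet
      exact (isBoundedBilinearMap_comp (𝕜 := ℝ) (E := Euc n) (F := F)
        (G := G)).continuous.comp_aestronglyMeasurable (h1.prodMk hDK.1)
    · exact (ContinuousLinearMap.opNorm_comp_le _ _).trans
        (mul_le_mul_of_nonneg_right (hfC' _) (norm_nonneg _))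
  refine weakDeriv_iff.2 ⟨(hf.continuous.comp_continuousOn hu).locallyIntegrableOn hU.measurableSet,
    (locallyIntegrableOn_iff hU.isLocallyClosed).2 hcompK, fun η h1 h2 h3 v => ?_⟩
  obtain ⟨w, hw1, hw2, hw3⟩ := h.exists_smooth_approx hU hu h2 h3 (p := 1) le_rfl
    (fun K hKU hK => by
      rw [ENNReal.ofReal_one]
      exact memLp_one_iff_integrable.2 (h.2.1.integrableOn_compact_subset hKU hK))
  simp only [ENNReal.rpow_one] at hw3
  set K := tsupport η with hKdef
  have hK : IsCompact K := h2
  have hDK := h.2.1.integrableOn_compact_subset h3 hK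
  obtain ⟨M, hM⟩ := h1.continuous.bounded_above_of_compact_support h2
  have hM0 : 0 ≤ M := (norm_nonneg _).trans (hM 0)
  have hη'c : Continuous fun x => fderiv ℝ η x v :=
    (h1.continuous_fderiv (by simp)).clm_apply continuous_const
  have hη's : HasCompactSupport fun x => fderiv ℝ η x v := h2.fderiv_apply ℝ v
  have hptw : ∀ x ∈ K, Tendsto (fun k => w k x) atTop (nhds (u x)) :=
    fun x hx => hw2.tendsto_at hx
  have hsm : ∀ k, ∫ x in K, fderiv ℝ η x v • f (w k x) =
      - ∫ x in K, η x • fderiv ℝ f (w k x) (fderiv ℝ (w k) x v) := by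
    intro k
    have := ContDiff.integral_fderiv_smul_eq (h1.of_le (by simp)) h2
      (hf.comp ((hw1 k).of_le (by simp))) v
    rw [setIntegral_fderiv_smul_eq_of_tsupport_subset (U := K) le_rfl v (fun x => f (w k x)),
      setIntegral_smul_eq_of_tsupport_subset (U := K) le_rfl]
    rw [Function.comp_def] at this
    rw [this]
    congr 1
    refine integral_congr_ae (Eventually.of_forall fun x => ?_)
    simp only
    rw [fderiv_fun_comp _ (hf.differentiable (by simp) _) ((hw1 k).differentiable (by simp) _)]
    rfl
  have hwD : ∀ k, IntegrableOn (fderiv ℝ (w k)) K := fun k =>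
    ((hw1 k).continuous_fderiv (by simp)).continuousOn.integrableOn_compact hK
  have hlhs : Tendsto (fun k => ∫ x in K, fderiv ℝ η x v • f (w k x)) atTop
      (nhds (∫ x in K, fderiv ℝ η x v • f (u x))) := by
    refine tendsto_integral_of_dominated_convergence (fun x => ‖fderiv ℝ η x v‖ * C)
      (fun k => ?_) ?_ (fun k => Eventually.of_forall fun x => ?_) ?_
    · exact (hη'c.smul (hf.continuous.comp (hw1 k).continuous)).aestronglyMeasurable
    · exact ((hη'c.integrable_of_hasCompactSupport hη's).norm.mul_const C).integrableOn
    · rw [norm_smul]; gcongr; exact hfC _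
    · filter_upwards [ae_restrict_mem hK.measurableSet] with x hx
      exact ((hf.continuous.tendsto _).comp (hptw x hx)).const_smul _
  have hmeasD : AEStronglyMeasurable (fun x => D x v) (volume.restrict K) :=
    (hDK.apply_continuousLinearMap v).1
  have hmeasf : ∀ k, AEStronglyMeasurable (fun x => fderiv ℝ f (w k x)) (volume.restrict K) :=
    fun k => (hf'.comp (hw1 k).continuous).aestronglyMeasurable
  have hap : Continuous fun p : (F →L[ℝ] G) × F => p.1 p.2 :=
    isBoundedBilinearMap_apply.continuous
  have hgen : ∀ k x (T : Euc n →L[ℝ] F),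
      ‖η x • fderiv ℝ f (w k x) (T v)‖ ≤ M * (C * ‖v‖) * ‖T‖ := by
    intro k x T
    rw [norm_smul]
    calc _ ≤ M * (C * (‖T‖ * ‖v‖)) := by
          gcongr
          · exact hM x
          · refine (ContinuousLinearMap.le_opNorm _ _).trans ?_
            gcongr
            · exact hfC' _
            · exact ContinuousLinearMap.le_opNorm _ _
      _ = _ := by ring
  have hbd : ∀ k x, ‖η x • fderiv ℝ f (w k x) (D x v)‖ ≤ M * (C * ‖v‖) * ‖D x‖ :=
    fun k x => hgen k x (D x)
  have hitg1 : ∀ k, IntegrableOn (fun x => η x • fderiv ℝ f (w k x) (D x v)) K := by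
    intro k
    refine Integrable.mono' (hDK.norm.const_mul (M * (C * ‖v‖))) ?_
      (Eventually.of_forall fun x => ?_)
    · exact h1.continuous.aestronglyMeasurable.smul (hap.comp_aestronglyMeasurable ((hmeasf k).prodMk hmeasD))
    · exact hbd k x
  have hrhs1 : Tendsto (fun k => ∫ x in K, η x • fderiv ℝ f (w k x) (D x v)) atTop
      (nhds (∫ x in K, η x • fderiv ℝ f (u x) (D x v))) := by
    refine tendsto_integral_of_dominated_convergence (fun x => M * (C * ‖v‖) * ‖D x‖)
      (fun k => (hitg1 k).1) (hDK.norm.const_mul _)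
      (fun k => Eventually.of_forall fun x => hbd k x) ?_
    filter_upwards [ae_restrict_mem hK.measurableSet] with x hx
    have := (hf'.tendsto _).comp (hptw x hx)
    exact (((ContinuousLinearMap.apply ℝ G (D x v)).continuous.tendsto _).comp this).const_smul _
  have hitg2 : ∀ k, IntegrableOn (fun x => η x • fderiv ℝ f (w k x) (fderiv ℝ (w k) x v)) K := by
    intro k
    refine ContinuousOn.integrableOn_compact hK (Continuous.continuousOn ?_)
    exact h1.continuous.smul ((hf'.comp (hw1 k).continuous).clm_apply
      (((hw1 k).continuous_fderiv (by simp)).clm_apply continuous_const))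
  have hrhs2 : Tendsto (fun k => (∫ x in K, η x • fderiv ℝ f (w k x) (fderiv ℝ (w k) x v)) -
      ∫ x in K, η x • fderiv ℝ f (w k x) (D x v)) atTop (nhds 0) := by
    rw [tendsto_zero_iff_enorm_tendsto_zero]
    refine tendsto_of_tendsto_of_tendsto_of_le_of_le tendsto_const_nhds
      (b := atTop) (h := fun k => ENNReal.ofReal (M * (C * ‖v‖)) *
        ∫⁻ x in K, ‖fderiv ℝ (w k) x - D x‖ₑ) ?_ (fun _ => bot_le) fun k => ?_
    · simpa using ENNReal.Tendsto.const_mul hw3 (Or.inr ENNReal.ofReal_ne_top)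
    · simp only
      rw [← integral_sub (hitg2 k) (hitg1 k), ← lintegral_const_mul' _ _ ENNReal.ofReal_ne_top]
      refine (enorm_integral_le_lintegral_enorm _).trans (lintegral_mono fun x => ?_)
      simp only
      rw [← smul_sub, ← map_sub, ← sub_apply, ← ofReal_norm, ← ofReal_norm,
        ← ENNReal.ofReal_mul (by positivity)]
      refine ENNReal.ofReal_le_ofReal ?_
      exact hgen k x (fderiv ℝ (w k) x - D x)
  have hrhs := (hrhs2.add hrhs1).neg
  simp only [sub_add_cancel, zero_add] at hrhs
  have heq := tendsto_nhds_unique hlhs (hrhs.congr fun k => (hsm k).symm)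
  rw [← setIntegral_fderiv_smul_eq_of_tsupport_subset (U := K) le_rfl v (fun x => (f ∘ u) x),
    ← setIntegral_smul_eq_of_tsupport_subset (U := K) le_rfl]
  exact heq

lemma WeakDeriv.of_locally {u : Euc n → F} {D : Euc n → Euc n →L[ℝ] F} {U : Set (Euc n)}
    (h : ∀ x ∈ U, ∃ V : Set (Euc n), IsOpen V ∧ x ∈ V ∧ WeakDeriv u D V) :
    WeakDeriv u D U := by
  have hl1 : LocallyIntegrableOn u U := fun x hx => by
    obtain ⟨V, hV, hxV, hw⟩ := h x hx
    have := hw.1 x hxV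
    rw [hV.nhdsWithin_eq hxV] at this
    exact this.filter_mono nhdsWithin_le_nhds
  have hl2 : LocallyIntegrableOn D U := fun x hx => by
    obtain ⟨V, hV, hxV, hw⟩ := h x hx
    have := hw.2.1 x hxV
    rw [hV.nhdsWithin_eq hxV] at this
    exact this.filter_mono nhdsWithin_le_nhds
  refine weakDeriv_iff.2 ⟨hl1, hl2, fun η h1 h2 h3 v => ?_⟩
  choose! V hVo hxV hw using h
  obtain ⟨t, ht⟩ := IsCompact.elim_finite_subcover (s := tsupport η) h2
    (fun x : tsupport η => V x) (fun x => hVo x (h3 x.2))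
    (fun x hx => mem_iUnion.2 ⟨⟨x, hx⟩, hxV x (h3 hx)⟩)
  obtain ⟨f, hf⟩ := SmoothPartitionOfUnity.exists_isSubordinate (modelWithCornersSelf ℝ (Euc n))
    (isClosed_tsupport η) (fun x : t => V x.1) (fun x => hVo _ (h3 x.1.2))
    (by intro x hx
        obtain ⟨y, hy, hxy⟩ := mem_iUnion₂.1 (ht hx)
        exact mem_iUnion.2 ⟨⟨y, hy⟩, hxy⟩)
  have hfs : ∀ i, ContDiff ℝ (⊤ : ℕ∞) (f i) := fun i => (f i).contMDiff.contDiff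
  have hsum : ∀ x, η x = ∑ i, f i x * η x := by
    intro x
    by_cases hx : x ∈ tsupport η
    · rw [← Finset.sum_mul, ← finsum_eq_sum_of_fintype, f.sum_eq_one hx, one_mul]
    · simp [image_eq_zero_of_notMem_tsupport hx]
  have c1 : ∀ i, ContDiff ℝ (⊤ : ℕ∞) fun x => f i x * η x := fun i => (hfs i).mul h1
  have c2 : ∀ i, HasCompactSupport fun x => f i x * η x := fun i => h2.mul_left
  have c3 : ∀ i, tsupport (fun x => f i x * η x) ⊆ V i.1 := fun i =>
    (tsupport_mul_subset_left).trans (hf i)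
  have c4 : ∀ i, tsupport (fun x => f i x * η x) ⊆ U := fun i =>
    (tsupport_mul_subset_right).trans h3
  have key : ∀ i, ∫ x, fderiv ℝ (fun x => f i x * η x) x v • u x =
      - ∫ x, (f i x * η x) • D x v := fun i =>
    (hw i.1 (h3 i.1.2)).integral_eq (c1 i) (c2 i) (c3 i) v
  have hD : LocallyIntegrableOn (fun x => D x v) U := fun x hx => by
    obtain ⟨s, hs, hi⟩ := hl2 x hx
    exact ⟨s, hs, hi.apply_continuousLinearMap v⟩
  have e1 : ∫ x, fderiv ℝ η x v • u x =
      ∑ i, ∫ x, fderiv ℝ (fun x => f i x * η x) x v • u x := by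
    rw [← integral_finsetSum]
    · refine integral_congr_ae (Eventually.of_forall fun x => ?_)
      simp only
      rw [← Finset.sum_smul]
      congr 1
      have : η = fun x => ∑ i, f i x * η x := funext hsum
      conv_lhs => rw [this]
      rw [fderiv_fun_sum fun i _ => (c1 i).differentiable (by simp) x]
      simp
    · intro i _
      refine hl1.integrable_smul (((c1 i).continuous_fderiv (by simp)).clm_apply continuous_const)
        ((c2 i).fderiv_apply ℝ v) ?_
      exact (closure_mono fun x hx => by
        by_contra h'
        exact hx (by simp only; rw [Function.notMem_support.1 h']; rfl)).trans
          ((tsupport_fderiv_subset ℝ).trans (c4 i))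
  have e2 : ∫ x, η x • D x v = ∑ i, ∫ x, (f i x * η x) • D x v := by
    rw [← integral_finsetSum]
    · refine integral_congr_ae (Eventually.of_forall fun x => ?_)
      simp only
      rw [← Finset.sum_smul, ← hsum]
    · intro i _
      exact hD.integrable_smul (c1 i).continuous (c2 i) (c4 i)
  rw [e1, e2, ← Finset.sum_neg_distrib]
  exact Finset.sum_congr rfl fun i _ => key i

lemma lintegral_comp_homothety (x : Euc n) {t : ℝ} (ht : 0 < t) {g : Euc n → ℝ≥0∞}
    (hg : Measurable g) :
    ∫⁻ z, g (x + t • (z - x)) = ENNReal.ofReal ((t ^ n)⁻¹) * ∫⁻ z, g z := by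
  rw [lintegral_sub_right_eq_self (fun z => g (x + t • z)) x]
  have h1 : Measurable fun z => g (x + z) := hg.comp (measurable_const_add x)
  rw [← lintegral_map (f := fun z => g (x + z)) (g := fun z : Euc n => t • z) h1
    (measurable_const_smul t), Measure.map_addHaar_smul _ ht.ne', lintegral_smul_measure,
    lintegral_add_left_eq_self g x, finrank_euclideanSpace_fin,
    abs_of_pos (inv_pos.2 (pow_pos ht n))]
  rfl

lemma setLIntegral_comp_homothety (x : Euc n) {t : ℝ} (ht : 0 < t) (R : ℝ) {g : Euc n → ℝ≥0∞}
    (hg : Measurable g) :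
    ∫⁻ z in Metric.closedBall x R, g (x + t • (z - x)) =
      ENNReal.ofReal ((t ^ n)⁻¹) * ∫⁻ z in Metric.closedBall x (t * R), g z := by
  rw [← lintegral_indicator Metric.isClosed_closedBall.measurableSet,
    ← lintegral_indicator Metric.isClosed_closedBall.measurableSet,
    ← lintegral_comp_homothety x ht (hg.indicator Metric.isClosed_closedBall.measurableSet)]
  refine lintegral_congr fun z => ?_
  have : x + t • (z - x) ∈ Metric.closedBall x (t * R) ↔ z ∈ Metric.closedBall x R := by
    rw [Metric.mem_closedBall, Metric.mem_closedBall, dist_eq_norm, dist_eq_norm,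
      add_sub_cancel_left, norm_smul, Real.norm_of_nonneg ht.le, mul_le_mul_iff_right₀ ht]
  by_cases hz : z ∈ Metric.closedBall x R
  · rw [indicator_of_mem hz, indicator_of_mem (this.2 hz)]
  · rw [indicator_of_notMem hz, indicator_of_notMem (this.not.2 hz)]

lemma lintegral_sub_homothety_le [CompleteSpace F] {v : Euc n → F} (hv : ContDiff ℝ 1 v)
    (x : Euc n) {R τ : ℝ} (hτ : 0 < τ) (hτ1 : τ ≤ 1) :
    ∫⁻ z in Metric.closedBall x R, ‖v z - v (x + τ • (z - x))‖ₑ ≤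
      ENNReal.ofReal R * ∫⁻ t in Ioc τ 1, ENNReal.ofReal ((t ^ n)⁻¹) *
        ∫⁻ z in Metric.closedBall x (t * R), ‖fderiv ℝ v z‖ₑ := by
  have hv' : Continuous (fderiv ℝ v) := hv.continuous_fderiv (by simp)
  have hpt : ∀ z ∈ Metric.closedBall x R, ‖v z - v (x + τ • (z - x))‖ₑ ≤
      ∫⁻ t in Ioc τ 1, ENNReal.ofReal R * ‖fderiv ℝ v (x + t • (z - x))‖ₑ := by
    intro z hz
    have hd : ∀ t : ℝ, HasDerivAt (fun t : ℝ => v (x + t • (z - x)))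
        (fderiv ℝ v (x + t • (z - x)) (z - x)) t := by
      intro t
      have h1 : HasDerivAt (fun t : ℝ => x + t • (z - x)) (z - x) t := by
        simpa using ((hasDerivAt_id t).smul_const (z - x)).const_add x
      exact ((hv.differentiable (by simp) _).hasFDerivAt).comp_hasDerivAt t h1
    have hc : Continuous fun t : ℝ => fderiv ℝ v (x + t • (z - x)) (z - x) :=
      (hv'.comp (by fun_prop)).clm_apply continuous_const
    have h2 := intervalIntegral.integral_eq_sub_of_hasDerivAt (a := τ) (b := 1)
      (fun t _ => hd t) (hc.intervalIntegrable _ _)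
    rw [one_smul, add_sub_cancel] at h2
    rw [← h2, intervalIntegral.integral_of_le hτ1]
    refine (enorm_integral_le_lintegral_enorm _).trans (lintegral_mono fun t => ?_)
    rw [mul_comm, ← ofReal_norm, ← ofReal_norm, ← ENNReal.ofReal_mul (norm_nonneg _)]
    refine ENNReal.ofReal_le_ofReal ((ContinuousLinearMap.le_opNorm _ _).trans ?_)
    gcongr
    rwa [← dist_eq_norm]
  calc _ ≤ ∫⁻ z in Metric.closedBall x R, ∫⁻ t in Ioc τ 1,
        ENNReal.ofReal R * ‖fderiv ℝ v (x + t • (z - x))‖ₑ :=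
        setLIntegral_mono' Metric.isClosed_closedBall.measurableSet hpt
    _ = ∫⁻ t in Ioc τ 1, ∫⁻ z in Metric.closedBall x R,
        ENNReal.ofReal R * ‖fderiv ℝ v (x + t • (z - x))‖ₑ := by
        refine lintegral_lintegral_swap (Measurable.aemeasurable ?_)
        refine Measurable.const_mul ?_ _
        exact (hv'.comp (by fun_prop : Continuous fun p : Euc n × ℝ =>
          x + p.2 • (p.1 - x))).enorm.measurable
    _ = ∫⁻ t in Ioc τ 1, ENNReal.ofReal R * (ENNReal.ofReal ((t ^ n)⁻¹) *
        ∫⁻ z in Metric.closedBall x (t * R), ‖fderiv ℝ v z‖ₑ) := by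
        refine setLIntegral_congr_fun measurableSet_Ioc fun t ht => ?_
        rw [lintegral_const_mul' _ _ ENNReal.ofReal_ne_top,
          setLIntegral_comp_homothety x (hτ.trans ht.1) R
            (g := fun z => ‖fderiv ℝ v z‖ₑ) hv'.enorm.measurable]
    _ = _ := lintegral_const_mul' _ _ ENNReal.ofReal_ne_top

lemma volume_closedBall_mul (x : Euc n) {t : ℝ} (ht : 0 < t) (R : ℝ) :
    volume (Metric.closedBall x (t * R)) =
      ENNReal.ofReal (t ^ n) * volume (Metric.closedBall x R) := by
  rw [Measure.addHaar_closedBall_mul_of_pos _ _ ht, finrank_euclideanSpace_fin,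
    Measure.addHaar_closedBall_center _ x]

lemma lintegral_le_of_tendsto {α : Type*} [MeasurableSpace α] {μ : Measure α}
    {f : ℕ → α → ℝ≥0∞} {g : α → ℝ≥0∞} {b : ℕ → ℝ≥0∞} {c : ℝ≥0∞}
    (hf : ∀ k, AEMeasurable (f k) μ) (hfg : ∀ᵐ x ∂μ, Tendsto (fun k => f k x) atTop (nhds (g x)))
    (hb : ∀ᶠ k in atTop, ∫⁻ x, f k x ∂μ ≤ b k) (hc : Tendsto b atTop (nhds c)) :
    ∫⁻ x, g x ∂μ ≤ c :=
  calc ∫⁻ x, g x ∂μ = ∫⁻ x, liminf (fun k => f k x) atTop ∂μ :=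
        lintegral_congr_ae (by filter_upwards [hfg] with x hx; exact hx.liminf_eq.symm)
    _ ≤ liminf (fun k => ∫⁻ x, f k x ∂μ) atTop := lintegral_liminf_le' hf
    _ ≤ liminf b atTop := liminf_le_liminf hb
    _ = c := hc.liminf_eq

lemma WeakDeriv.lintegral_sub_affine_le [CompleteSpace F] {u : Euc n → F}
    {D : Euc n → Euc n →L[ℝ] F} {U : Set (Euc n)} (hU : IsOpen U) (h : WeakDeriv u D U)
    (hu : ContinuousOn u U) {x : Euc n} {R : ℝ} (hR : 0 < R) (hball : Metric.closedBall x R ⊆ U)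
    (a : Euc n →L[ℝ] F) (M : ℝ≥0∞)
    (hM : ∀ ρ ∈ Ioc 0 R, ∫⁻ z in Metric.closedBall x ρ, ‖D z - a‖ₑ ≤
      M * volume (Metric.closedBall x ρ)) :
    ∫⁻ z in Metric.closedBall x R, ‖u z - u x - a (z - x)‖ₑ ≤
      ENNReal.ofReal R * (M * volume (Metric.closedBall x R)) := by
  set K := Metric.closedBall x R with hKdef
  have hK : IsCompact K := isCompact_closedBall x R
  have hKm : MeasurableSet K := hK.measurableSet
  obtain ⟨v, hv1, hv2, hv3⟩ := h.exists_smooth_approx hU hu hK hball (p := 1) le_rfl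
    (fun K hKU hK => by
      rw [ENNReal.ofReal_one]
      exact memLp_one_iff_integrable.2 (h.2.1.integrableOn_compact_subset hKU hK))
  simp only [ENNReal.rpow_one] at hv3
  have hDK : AEStronglyMeasurable D (volume.restrict K) :=
    (h.2.1.integrableOn_compact_subset hball hK).1
  have hxK : x ∈ K := Metric.mem_closedBall_self hR.le
  have hmem : ∀ z ∈ K, ∀ τ ∈ Ioc (0 : ℝ) 1, x + τ • (z - x) ∈ K := by
    intro z hz τ hτ
    rw [hKdef, Metric.mem_closedBall, dist_eq_norm] at hz ⊢
    rw [add_sub_cancel_left, norm_smul, Real.norm_of_nonneg hτ.1.le]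
    nlinarith [hτ.1, hτ.2, norm_nonneg (z - x)]
  have hw : ∀ k, ContDiff ℝ 1 fun z => v k z - a z := fun k =>
    ((hv1 k).of_le (by simp)).sub a.contDiff
  have hwd : ∀ k z, fderiv ℝ (fun z => v k z - a z) z = fderiv ℝ (v k) z - a := by
    intro k z
    rw [fderiv_fun_sub ((hv1 k).differentiable (by simp) _) a.differentiableAt, a.fderiv]
  have hcont : ∀ τ ∈ Ioc (0 : ℝ) 1, ∀ k,
      ∫⁻ z in K, ‖(v k z - a z) - (v k (x + τ • (z - x)) - a (x + τ • (z - x)))‖ₑ ≤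
      ENNReal.ofReal R * (M * volume K +
        ENNReal.ofReal ((τ ^ n)⁻¹) * ∫⁻ z in K, ‖fderiv ℝ (v k) z - D z‖ₑ) := by
    intro τ hτ k
    refine (lintegral_sub_homothety_le (hw k) x hτ.1 hτ.2).trans ?_
    gcongr
    have hc : ∀ t ∈ Ioc τ 1, ENNReal.ofReal ((t ^ n)⁻¹) *
        ∫⁻ z in Metric.closedBall x (t * R), ‖fderiv ℝ (fun z => v k z - a z) z‖ₑ ≤
        M * volume K +
        ENNReal.ofReal ((τ ^ n)⁻¹) * ∫⁻ z in K, ‖fderiv ℝ (v k) z - D z‖ₑ := by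
      intro t ht
      have ht0 : 0 < t := hτ.1.trans ht.1
      have hsub : Metric.closedBall x (t * R) ⊆ K :=
        Metric.closedBall_subset_closedBall (by nlinarith [ht.2])
      have e1 : ∫⁻ z in Metric.closedBall x (t * R), ‖fderiv ℝ (fun z => v k z - a z) z‖ₑ ≤
          (∫⁻ z in K, ‖fderiv ℝ (v k) z - D z‖ₑ) +
          M * volume (Metric.closedBall x (t * R)) := by
        calc _ ≤ ∫⁻ z in Metric.closedBall x (t * R),
              (‖fderiv ℝ (v k) z - D z‖ₑ + ‖D z - a‖ₑ) := by
              refine lintegral_mono fun z => ?_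
              rw [hwd, ← sub_add_sub_cancel _ (D z) a]
              exact enorm_add_le (fderiv ℝ (v k) z - D z) (D z - a)
          _ = (∫⁻ z in Metric.closedBall x (t * R), ‖fderiv ℝ (v k) z - D z‖ₑ) +
              ∫⁻ z in Metric.closedBall x (t * R), ‖D z - a‖ₑ := by
              have hm : AEStronglyMeasurable (fun z => fderiv ℝ (v k) z - D z)
                  (volume.restrict (Metric.closedBall x (t * R))) :=
                (((hv1 k).continuous_fderiv (by simp)).aestronglyMeasurable).sub
                  (hDK.mono_measure (Measure.restrict_mono hsub le_rfl))
              exact lintegral_add_left' hm.enorm _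
          _ ≤ _ := add_le_add (lintegral_mono_set hsub) (hM _ ⟨by positivity, by nlinarith [ht.2]⟩)
      calc _ ≤ ENNReal.ofReal ((t ^ n)⁻¹) * ((∫⁻ z in K, ‖fderiv ℝ (v k) z - D z‖ₑ) +
          M * volume (Metric.closedBall x (t * R))) := by gcongr
        _ = ENNReal.ofReal ((t ^ n)⁻¹) * (∫⁻ z in K, ‖fderiv ℝ (v k) z - D z‖ₑ) + M * volume K := by
          rw [mul_add, volume_closedBall_mul x ht0, mul_left_comm (ENNReal.ofReal _) M,
            ← mul_assoc (ENNReal.ofReal _) (ENNReal.ofReal _), ← ENNReal.ofReal_mul (by positivity),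
            inv_mul_cancel₀ (by positivity), ENNReal.ofReal_one, one_mul]
        _ ≤ _ := by
          rw [add_comm]
          gcongr
          · exact pow_pos hτ.1 n
          · exact hτ.1.le
          · exact ht.1.le
    calc _ ≤ ∫⁻ t in Ioc τ 1, (M * volume K +
          ENNReal.ofReal ((τ ^ n)⁻¹) * ∫⁻ z in K, ‖fderiv ℝ (v k) z - D z‖ₑ) :=
          setLIntegral_mono' measurableSet_Ioc hc
      _ ≤ (M * volume K +
          ENNReal.ofReal ((τ ^ n)⁻¹) * ∫⁻ z in K, ‖fderiv ℝ (v k) z - D z‖ₑ) * 1 := by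
          rw [setLIntegral_const, Real.volume_Ioc]
          gcongr
          simpa using hτ.1.le
      _ = _ := mul_one _
  have hbound : ∀ τ ∈ Ioc (0 : ℝ) 1,
      ∫⁻ z in K, ‖(u z - a z) - (u (x + τ • (z - x)) - a (x + τ • (z - x)))‖ₑ ≤
      ENNReal.ofReal R * (M * volume K) := by
    intro τ hτ
    refine lintegral_le_of_tendsto (fun k => ?_) ?_ (Eventually.of_forall (hcont τ hτ)) ?_
    · have hc := (hw k).continuous
      exact ((hc.sub (hc.comp (by fun_prop : Continuous fun z => x + τ • (z - x)))).enorm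
        ).measurable.aemeasurable
    · filter_upwards [ae_restrict_mem hKm] with z hz
      exact (((hv2.tendsto_at hz).sub_const _).sub
        ((hv2.tendsto_at (hmem z hz τ hτ)).sub_const _)).enorm
    · have := ((ENNReal.Tendsto.const_mul (a := ENNReal.ofReal ((τ ^ n)⁻¹)) hv3
        (Or.inr ENNReal.ofReal_ne_top)).const_add (M * volume K))
      rw [mul_zero, add_zero] at this
      exact ENNReal.Tendsto.const_mul this (Or.inr ENNReal.ofReal_ne_top)
  have hlim : Tendsto (fun k : ℕ => 1 / ((k : ℝ) + 1)) atTop (nhds 0) := tendsto_one_div_nat_add_one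
  have hmemk : ∀ k : ℕ, 1 / ((k : ℝ) + 1) ∈ Ioc (0 : ℝ) 1 := fun k =>
    ⟨by positivity, by rw [div_le_one (by positivity)]; simp⟩
  refine lintegral_le_of_tendsto (f := fun (k : ℕ) z => ‖(u z - a z) -
    (u (x + (1 / ((k : ℝ) + 1)) • (z - x)) - a (x + (1 / ((k : ℝ) + 1)) • (z - x)))‖ₑ)
    (fun k => ?_) ?_ (Eventually.of_forall fun k => hbound _ (hmemk k)) tendsto_const_nhds
  · have hc : ContinuousOn (fun z => u z - a z) K := (hu.mono hball).sub a.continuous.continuousOn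
    have hc2 : ContinuousOn (fun z => x + (1 / ((k : ℝ) + 1)) • (z - x)) K := by fun_prop
    exact (hc.sub (hc.comp hc2 fun z hz => hmem z hz _ (hmemk k))).enorm.aemeasurable hKm
  · filter_upwards [ae_restrict_mem hKm] with z hz
    have hp : Tendsto (fun k : ℕ => x + (1 / ((k : ℝ) + 1)) • (z - x)) atTop (nhds x) := by
      simpa using (hlim.smul_const (z - x)).const_add x
    have hux : Tendsto (fun k : ℕ => u (x + (1 / ((k : ℝ) + 1)) • (z - x))) atTop (nhds (u x)) :=
      ((hu.continuousAt (hU.mem_nhds (hball hxK))).tendsto).comp hp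
    have := ((hux.sub ((a.continuous.tendsto x).comp hp)).const_sub (u z - a z)).enorm
    have e : u z - u x - a (z - x) = u z - a z - (u x - a x) := by rw [map_sub]; abel
    rw [e]
    exact this

lemma enorm_sub_mul_volume_le {f g : Euc n → F} {B : Set (Euc n)} (hB : MeasurableSet B)
    (hf : AEStronglyMeasurable f (volume.restrict B)) {c : F} (h : ∀ z ∈ B, f z - g z = c) :
    ‖c‖ₑ * volume B ≤ (∫⁻ z in B, ‖f z‖ₑ) + ∫⁻ z in B, ‖g z‖ₑ := by
  rw [← lintegral_add_left' hf.enorm, ← setLIntegral_const]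
  refine setLIntegral_mono' hB fun z hz => ?_
  rw [← h z hz, sub_eq_add_neg]
  exact (enorm_add_le (f z) (-g z)).trans_eq (by rw [enorm_neg])

lemma closedBall_midpoint_subset_left (x y : Euc n) :
    Metric.closedBall (midpoint ℝ x y) (dist x y / 2) ⊆ Metric.closedBall x (dist x y) := by
  refine Metric.closedBall_subset_closedBall' ?_
  rw [dist_midpoint_left, Real.norm_of_nonneg (by norm_num)]
  linarith

lemma volume_closedBall_half (x y w : Euc n) :
    volume (Metric.closedBall w (dist x y)) =
      2 ^ n * volume (Metric.closedBall (midpoint ℝ x y) (dist x y / 2)) := by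
  have h := volume_closedBall_mul (midpoint ℝ x y) (t := 2) two_pos (dist x y / 2)
  rw [mul_div_cancel₀ _ two_ne_zero] at h
  rw [Measure.addHaar_closedBall_center, ← Measure.addHaar_closedBall_center _ (midpoint ℝ x y), h,
    ENNReal.ofReal_pow two_pos.le]
  norm_num

lemma WeakDeriv.enorm_sub_sub_le [CompleteSpace F] {u : Euc n → F}
    {D : Euc n → Euc n →L[ℝ] F} {U : Set (Euc n)} (hU : IsOpen U) (h : WeakDeriv u D U)
    (hu : ContinuousOn u U) {x y : Euc n} (hxy : x ≠ y)
    (hx : Metric.closedBall x (dist x y) ⊆ U) (hy : Metric.closedBall y (dist x y) ⊆ U)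
    (a b : Euc n →L[ℝ] F) (M : ℝ≥0∞)
    (hMx : ∀ ρ ∈ Ioc 0 (dist x y), ∫⁻ z in Metric.closedBall x ρ, ‖D z - a‖ₑ ≤
      M * volume (Metric.closedBall x ρ))
    (hMy : ∀ ρ ∈ Ioc 0 (dist x y), ∫⁻ z in Metric.closedBall y ρ, ‖D z - b‖ₑ ≤
      M * volume (Metric.closedBall y ρ)) :
    ‖u y - u x - a (y - x)‖ₑ ≤ 2 ^ (n + 1) * (M + 2 ^ (n + 1) * M) * edist x y := by
  have hR : 0 < dist x y := dist_pos.2 hxy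
  have hvol := volume_closedBall_half x y
  have hBx := closedBall_midpoint_subset_left x y
  have hBy : Metric.closedBall (midpoint ℝ x y) (dist x y / 2) ⊆
      Metric.closedBall y (dist x y) := by
    have := closedBall_midpoint_subset_left y x
    rwa [midpoint_comm, dist_comm] at this
  set R := dist x y with hRdef
  set B := Metric.closedBall (midpoint ℝ x y) (R / 2) with hB
  have hBm : MeasurableSet B := measurableSet_closedBall
  have hB0 : volume B ≠ 0 := (Metric.measure_closedBall_pos _ _ (by positivity)).ne'
  have hBt : volume B ≠ ∞ := measure_closedBall_lt_top.ne
  have hDB : AEStronglyMeasurable D (volume.restrict B) :=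
    (h.2.1.integrableOn_compact_subset (hBx.trans hx) (isCompact_closedBall _ _)).1
  have hab : ‖b - a‖ₑ ≤ 2 ^ (n + 1) * M := by
    refine (ENNReal.mul_le_mul_iff_left hB0 hBt).1 ?_
    calc ‖b - a‖ₑ * volume B ≤ (∫⁻ z in B, ‖D z - a‖ₑ) + ∫⁻ z in B, ‖D z - b‖ₑ :=
          enorm_sub_mul_volume_le hBm (hDB.sub aestronglyMeasurable_const)
            fun z _ => sub_sub_sub_cancel_left _ _ _
      _ ≤ M * (2 ^ n * volume B) + M * (2 ^ n * volume B) := by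
          refine add_le_add ((lintegral_mono_set hBx).trans ?_) ((lintegral_mono_set hBy).trans ?_)
          · exact (hMx R ⟨hR, le_rfl⟩).trans_eq (by rw [hvol])
          · exact (hMy R ⟨hR, le_rfl⟩).trans_eq (by rw [hvol])
      _ = _ := by ring
  have hMx' := WeakDeriv.lintegral_sub_affine_le hU h hu hR hx a _ hMx
  have hMy' := WeakDeriv.lintegral_sub_affine_le hU h hu hR hy a (M + 2 ^ (n + 1) * M)
    (fun ρ hρ => by
      calc ∫⁻ z in Metric.closedBall y ρ, ‖D z - a‖ₑ ≤
          ∫⁻ z in Metric.closedBall y ρ, (‖D z - b‖ₑ + ‖b - a‖ₑ) := by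
            refine lintegral_mono fun z => ?_
            rw [← sub_add_sub_cancel (D z) b a]
            exact enorm_add_le (D z - b) (b - a)
        _ = (∫⁻ z in Metric.closedBall y ρ, ‖D z - b‖ₑ) +
            ‖b - a‖ₑ * volume (Metric.closedBall y ρ) := by
            rw [lintegral_add_right _ measurable_const, setLIntegral_const]
        _ ≤ _ := by rw [add_mul]; gcongr; exact hMy ρ hρ)
  have huB : ContinuousOn u B := hu.mono (hBx.trans hx)
  have hcont : ContinuousOn (fun z => u z - u x - a (z - x)) B := by fun_prop
  have hmain : ‖u y - u x - a (y - x)‖ₑ * volume B ≤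
      (∫⁻ z in B, ‖u z - u x - a (z - x)‖ₑ) + ∫⁻ z in B, ‖u z - u y - a (z - y)‖ₑ :=
    enorm_sub_mul_volume_le hBm (hcont.aestronglyMeasurable hBm) fun z _ => by
      simp only [map_sub]; abel
  refine (ENNReal.mul_le_mul_iff_left hB0 hBt).1 ?_
  calc _ ≤ _ := hmain
    _ ≤ ENNReal.ofReal R * (M * (2 ^ n * volume B)) +
        ENNReal.ofReal R * ((M + 2 ^ (n + 1) * M) * (2 ^ n * volume B)) := by
        rw [← hvol x]
        nth_rewrite 2 [hvol x]
        rw [← hvol y]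
        exact add_le_add ((lintegral_mono_set hBx).trans hMx')
          ((lintegral_mono_set hBy).trans hMy')
    _ ≤ ENNReal.ofReal R * ((M + 2 ^ (n + 1) * M) * (2 ^ n * volume B)) +
        ENNReal.ofReal R * ((M + 2 ^ (n + 1) * M) * (2 ^ n * volume B)) := by
        gcongr
        exact le_self_add
    _ = _ := by rw [edist_dist]; ring

/-- The mean oscillation of `D` at `x` over the ball of radius `r`. -/
def meanOsc (D : Euc n → F) (x : Euc n) (r : ℝ) : ℝ≥0∞ :=
  (∫⁻ z in Metric.closedBall x r, ‖D z - D x‖ₑ) / volume (Metric.closedBall x r)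

lemma ae_tendsto_meanOsc {D : Euc n → F} {U : Set (Euc n)} (hU : IsOpen U)
    (hD : LocallyIntegrableOn D U) :
    ∀ᵐ x, x ∈ U → Tendsto (meanOsc D x) (nhdsWithin 0 (Ioi 0)) (nhds 0) := by
  rw [ae_iff]
  refine measure_null_of_locally_null _ fun x hx => ?_
  simp only [Classical.not_imp, mem_ofPred_eq] at hx
  obtain ⟨δ, hδ, hδU⟩ := Metric.nhds_basis_closedBall.mem_iff.1 (hU.mem_nhds hx.1)
  refine ⟨_, inter_mem_nhdsWithin _ (Metric.ball_mem_nhds x hδ), ?_⟩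
  have hK : MeasurableSet (Metric.closedBall x δ) := measurableSet_closedBall
  have h := (Besicovitch.vitaliFamily (volume : Measure (Euc n))).ae_tendsto_lintegral_enorm_sub_div
    (locallyIntegrable_indicator hK
      (hD.integrableOn_compact_subset hδU (isCompact_closedBall _ _)))
  refine measure_mono_null ?_ (ae_iff.1 h)
  rintro y ⟨hy1, hy2⟩ hy3
  refine hy1 fun hyU => ?_
  have h2 := hy3.comp (Besicovitch.tendsto_filterAt volume y)
  refine h2.congr' ?_
  have hyb : 0 < δ - dist y x := sub_pos.2 hy2
  filter_upwards [nhdsWithin_le_nhds (Iio_mem_nhds hyb), self_mem_nhdsWithin] with r hr hr0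
  simp only [Function.comp, meanOsc]
  congr 1
  refine setLIntegral_congr_fun measurableSet_closedBall fun z hz => ?_
  have hz' : z ∈ Metric.closedBall x δ := by
    rw [Metric.mem_closedBall] at hz ⊢
    have := dist_triangle z y x
    simp only [mem_Iio] at hr
    linarith
  simp only [indicator_of_mem hz', indicator_of_mem (Metric.ball_subset_closedBall hy2)]

lemma measurable_meanOsc {D : Euc n → F} (hD : StronglyMeasurable D) (r : ℝ) :
    Measurable fun x => meanOsc D x r := by
  unfold meanOsc
  have h1 : Measurable fun p : Euc n × Euc n =>
      (Metric.closedBall (0 : Euc n) r).indicator (fun _ => (1 : ℝ≥0∞)) (p.2 - p.1) *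
        ‖D p.2 - D p.1‖ₑ := by
    refine Measurable.mul ?_ ?_
    · exact (measurable_const.indicator measurableSet_closedBall).comp
        (measurable_snd.sub measurable_fst)
    · exact ((hD.comp_measurable measurable_snd).sub (hD.comp_measurable measurable_fst)).enorm
  have h2 : (fun x => (∫⁻ z in Metric.closedBall x r, ‖D z - D x‖ₑ)) = fun x => ∫⁻ z,
      (Metric.closedBall (0 : Euc n) r).indicator (fun _ => (1 : ℝ≥0∞)) (z - x) *
        ‖D z - D x‖ₑ := by
    ext x
    rw [← lintegral_indicator measurableSet_closedBall]
    refine lintegral_congr fun z => ?_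
    simp only [indicator, Metric.mem_closedBall, dist_eq_norm, sub_zero]
    split_ifs <;> simp
  simp_rw [Measure.addHaar_closedBall_center]
  exact (h2 ▸ h1.lintegral_prod_right').div_const _

lemma setLIntegral_le_of_meanOsc_le {D : Euc n → F} {x : Euc n} {M : ℝ≥0∞} {k₀ : ℕ}
    (h : ∀ k ≥ k₀, meanOsc D x ((1 / 2) ^ k) ≤ M) {ρ : ℝ} (hρ : ρ ∈ Ioc 0 ((1 / 2 : ℝ) ^ k₀)) :
    ∫⁻ z in Metric.closedBall x ρ, ‖D z - D x‖ₑ ≤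
      2 ^ n * M * volume (Metric.closedBall x ρ) := by
  obtain ⟨k, hk1, hk2⟩ := exists_nat_pow_near_of_lt_one (y := (1 / 2 : ℝ)) hρ.1
    (hρ.2.trans (pow_le_one₀ (by norm_num) (by norm_num))) (by norm_num) (by norm_num)
  have hk : k₀ ≤ k := by
    by_contra! hlt
    exact absurd (hρ.2.trans (pow_le_pow_of_le_one (by norm_num) (by norm_num) hlt)) hk1.not_ge
  have hpos : (0 : ℝ) < (1 / 2) ^ k := by positivity
  have hv0 : volume (Metric.closedBall x ((1 / 2 : ℝ) ^ k)) ≠ 0 :=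
    (Metric.measure_closedBall_pos _ _ hpos).ne'
  calc ∫⁻ z in Metric.closedBall x ρ, ‖D z - D x‖ₑ
      ≤ ∫⁻ z in Metric.closedBall x ((1 / 2) ^ k), ‖D z - D x‖ₑ :=
        lintegral_mono_set (Metric.closedBall_subset_closedBall hk2)
    _ = meanOsc D x ((1 / 2) ^ k) * volume (Metric.closedBall x ((1 / 2) ^ k)) :=
        (ENNReal.div_mul_cancel hv0 measure_closedBall_lt_top.ne).symm
    _ ≤ M * volume (Metric.closedBall x (2 * ρ)) := by
        refine mul_le_mul' (h k hk) (measure_mono (Metric.closedBall_subset_closedBall ?_))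
        rw [pow_succ] at hk1
        linarith
    _ = _ := by
        rw [volume_closedBall_mul x two_pos, ENNReal.ofReal_pow two_pos.le]
        norm_num
        ring

lemma WeakDeriv.hasFDerivWithinAt_of_tendstoUniformlyOn [CompleteSpace F] {u : Euc n → F}
    {D : Euc n → Euc n →L[ℝ] F} {U A : Set (Euc n)} (hU : IsOpen U) (h : WeakDeriv u D U)
    (hu : ContinuousOn u U) (hA : A ⊆ U)
    (hosc : ∀ M : ℝ≥0∞, 0 < M → ∃ k₀ : ℕ, ∀ k ≥ k₀, ∀ x ∈ A, meanOsc D x ((1 / 2) ^ k) ≤ M)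
    {x : Euc n} (hx : x ∈ A) : HasFDerivWithinAt u (D x) A x := by
  rw [hasFDerivWithinAt_iff_isLittleO, Asymptotics.isLittleO_iff]
  intro c hc
  have hC : (0 : ℝ) < 2 ^ (n + 1) * (1 + 2 ^ (n + 1)) * 2 ^ n := by positivity
  obtain ⟨k₀, hk₀⟩ := hosc (ENNReal.ofReal (c / (2 ^ (n + 1) * (1 + 2 ^ (n + 1)) * 2 ^ n)))
    (ENNReal.ofReal_pos.2 (by positivity))
  set M := ENNReal.ofReal (c / (2 ^ (n + 1) * (1 + 2 ^ (n + 1)) * 2 ^ n)) with hM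
  have hCM : 2 ^ (n + 1) * (2 ^ n * M + 2 ^ (n + 1) * (2 ^ n * M)) = ENNReal.ofReal c := by
    have h2 : (2 : ℝ≥0∞) = ENNReal.ofReal 2 := by norm_num
    rw [h2, hM, ← ENNReal.ofReal_pow two_pos.le, ← ENNReal.ofReal_pow two_pos.le,
      ← ENNReal.ofReal_mul (by positivity), ← ENNReal.ofReal_mul (by positivity),
      ← ENNReal.ofReal_add (by positivity) (by positivity), ← ENNReal.ofReal_mul (by positivity)]
    congr 1
    field_simp
  obtain ⟨δ, hδ, hδU⟩ := Metric.isOpen_iff.1 hU x (hA hx)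
  have hr : 0 < min (δ / 2) ((1 / 2 : ℝ) ^ k₀) := by positivity
  filter_upwards [inter_mem_nhdsWithin A (Metric.ball_mem_nhds x hr)] with y hy
  rcases eq_or_ne x y with rfl | hxy
  · simp
  have hd : dist x y < min (δ / 2) ((1 / 2 : ℝ) ^ k₀) := by
    have := hy.2
    rwa [Metric.mem_ball, dist_comm] at this
  rw [lt_min_iff] at hd
  have key := h.enorm_sub_sub_le hU hu hxy
    ((Metric.closedBall_subset_ball (by linarith)).trans hδU)
    ((Metric.closedBall_subset_ball' (by rw [dist_comm y x]; linarith)).trans hδU)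
    (D x) (D y) (2 ^ n * M)
    (fun ρ hρ => setLIntegral_le_of_meanOsc_le (fun k hk => hk₀ k hk x hx)
      ⟨hρ.1, hρ.2.trans hd.2.le⟩)
    (fun ρ hρ => setLIntegral_le_of_meanOsc_le (fun k hk => hk₀ k hk y hy.1)
      ⟨hρ.1, hρ.2.trans hd.2.le⟩)
  rw [hCM, edist_dist, ← ENNReal.ofReal_mul hc.le, ← ofReal_norm,
    ENNReal.ofReal_le_ofReal_iff (by positivity), dist_comm, dist_eq_norm] at key
  exact key

lemma exists_measurableSet_forall_le_of_ae_tendsto {α : Type*} [MeasurableSpace α] {μ : Measure α}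
    {f : ℕ → α → ℝ≥0∞} (hf : ∀ k, Measurable (f k)) {s : Set α} (hs : MeasurableSet s)
    (hμs : μ s ≠ ∞) (h : ∀ᵐ x ∂μ, x ∈ s → Tendsto (fun k => f k x) atTop (nhds 0))
    {ε : ℝ} (hε : 0 < ε) :
    ∃ t, MeasurableSet t ∧ μ t ≤ ENNReal.ofReal ε ∧
      ∀ M : ℝ≥0∞, 0 < M → ∃ k₀ : ℕ, ∀ k ≥ k₀, ∀ x ∈ s \ t, f k x ≤ M := by
  obtain ⟨t, -, ht1, ht2, ht3⟩ := tendstoUniformlyOn_of_ae_tendsto_of_measurable_edist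
    (μ := μ) (f := fun k x => (min (f k x) 1).toReal) (g := fun _ => 0) (s := s)
    (fun k => ((hf k).min measurable_const).ennreal_toReal.edist measurable_const) hs hμs
    (by
      filter_upwards [h] with x hx hxs
      have h1 : Tendsto (fun k => min (f k x) 1) atTop (nhds 0) := by
        simpa using (hx hxs).min (tendsto_const_nhds (x := (1 : ℝ≥0∞)))
      exact (ENNReal.tendsto_toReal zero_ne_top).comp h1) hε
  refine ⟨t, ht1, ht2, fun M hM => ?_⟩
  have hM' : 0 < min M (1 / 2) := lt_min hM (by norm_num)
  have hMt : min M (1 / 2) ≠ ∞ := ((min_le_right _ _).trans_lt (by norm_num)).ne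
  obtain ⟨k₀, hk₀⟩ := eventually_atTop.1
    (Metric.tendstoUniformlyOn_iff.1 ht3 _ (ENNReal.toReal_pos hM'.ne' hMt))
  refine ⟨k₀, fun k hk x hx => ?_⟩
  have h1 := hk₀ k hk x hx
  rw [dist_comm, Real.dist_0_eq_abs, abs_of_nonneg ENNReal.toReal_nonneg,
    ENNReal.toReal_lt_toReal (by simp) hMt] at h1
  rcases min_lt_iff.1 h1 with h2 | h2
  · exact (h2.trans_le (min_le_left _ _)).le
  · exact absurd (h2.trans_le (min_le_right _ _)) (not_lt.2 (by norm_num))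

theorem WeakDeriv.exists_hasFDerivWithinAt [CompleteSpace F] {u : Euc n → F}
    {D : Euc n → Euc n →L[ℝ] F} {U : Set (Euc n)} (hU : IsOpen U) (h : WeakDeriv u D U)
    (hu : ContinuousOn u U) (hD : StronglyMeasurable D) :
    ∃ A : ℕ → Set (Euc n), (∀ k, MeasurableSet (A k)) ∧ (∀ k, A k ⊆ U) ∧
      volume (U \ ⋃ k, A k) = 0 ∧ ∀ k, ∀ x ∈ A k, HasFDerivWithinAt u (D x) (A k) x := by
  have hpow : Tendsto (fun k : ℕ => (1 / 2 : ℝ) ^ k) atTop (nhdsWithin 0 (Ioi 0)) :=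
    tendsto_nhdsWithin_iff.2 ⟨tendsto_pow_atTop_nhds_zero_of_lt_one (by norm_num) (by norm_num),
      Eventually.of_forall fun k => by simp only [mem_Ioi]; positivity⟩
  have hegorov : ∀ m j : ℕ, ∃ t, MeasurableSet t ∧ volume t ≤ ENNReal.ofReal (1 / ((j : ℝ) + 1)) ∧
      ∀ M : ℝ≥0∞, 0 < M → ∃ k₀ : ℕ, ∀ k ≥ k₀, ∀ x ∈ (U ∩ Metric.ball 0 m) \ t,
        meanOsc D x ((1 / 2) ^ k) ≤ M := fun m j =>
    exists_measurableSet_forall_le_of_ae_tendsto (fun k => measurable_meanOsc hD _)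
      (hU.measurableSet.inter measurableSet_ball)
      (measure_inter_lt_top_of_right_ne_top measure_ball_lt_top.ne).ne
      (by
        filter_upwards [ae_tendsto_meanOsc hU h.2.1] with x hx hxs
        exact (hx hxs.1).comp hpow) (by positivity)
  choose t ht1 ht2 ht3 using hegorov
  refine ⟨fun k => (U ∩ Metric.ball 0 k.unpair.1) \ t k.unpair.1 k.unpair.2,
    fun k => (hU.measurableSet.inter measurableSet_ball).diff (ht1 _ _),
    fun k x hx => hx.1.1, ?_, fun k x hx => ?_⟩
  · have hsub : U \ ⋃ k : ℕ, (U ∩ Metric.ball 0 k.unpair.1) \ t k.unpair.1 k.unpair.2 ⊆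
        ⋃ m, ⋂ j, t m j := by
      rintro x ⟨hxU, hx⟩
      obtain ⟨m, hm⟩ := exists_nat_gt (dist x 0)
      refine mem_iUnion.2 ⟨m, mem_iInter.2 fun j => ?_⟩
      by_contra hj
      exact hx (mem_iUnion.2 ⟨Nat.pair m j, by simpa [hxU, hj] using hm⟩)
    refine measure_mono_null hsub (measure_iUnion_null fun m => ?_)
    refine le_antisymm (ge_of_tendsto' (x := atTop) (f := fun j : ℕ =>
      ENNReal.ofReal (1 / ((j : ℝ) + 1))) ?_ fun j =>
        (measure_mono (iInter_subset _ j)).trans (ht2 m j)) bot_le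
    simpa using ENNReal.tendsto_ofReal tendsto_one_div_nat_add_one
  · exact h.hasFDerivWithinAt_of_tendstoUniformlyOn hU hu (fun x hx => hx.1.1) (ht3 _ _) hx

lemma LocallyIntegrableOn.clm_comp {G H : Type*} [NormedAddCommGroup G] [NormedSpace ℝ G]
    [NormedAddCommGroup H] [NormedSpace ℝ H] (L : G →L[ℝ] H) {f : Euc n → G} {U : Set (Euc n)}
    (h : LocallyIntegrableOn f U) : LocallyIntegrableOn (fun x => L (f x)) U := fun x hx => by
  obtain ⟨s, hs, hi⟩ := h x hx
  exact ⟨s, hs, L.integrable_comp hi⟩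

lemma WeakDeriv.clm_comp [CompleteSpace F] {G : Type*} [NormedAddCommGroup G] [NormedSpace ℝ G]
    [CompleteSpace G] {u : Euc n → F} {D : Euc n → Euc n →L[ℝ] F} {U : Set (Euc n)}
    (h : WeakDeriv u D U) (L : F →L[ℝ] G) :
    WeakDeriv (fun x => L (u x)) (fun x => L.comp (D x)) U := by
  refine weakDeriv_iff.2 ⟨LocallyIntegrableOn.clm_comp L h.1,
    LocallyIntegrableOn.clm_comp (ContinuousLinearMap.compL ℝ (Euc n) F G L) h.2.1,
    fun η h1 h2 h3 v => ?_⟩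
  have hDv : LocallyIntegrableOn (fun x => D x v) U :=
    LocallyIntegrableOn.clm_comp (ContinuousLinearMap.apply ℝ F v) h.2.1
  have hi1 : Integrable fun x => fderiv ℝ η x v • u x :=
    h.1.integrable_smul ((h1.continuous_fderiv (by simp)).clm_apply continuous_const)
      (h2.fderiv_apply ℝ v) ((tsupport_fderiv_apply_subset ℝ v).trans h3)
  have hi2 : Integrable fun x => η x • D x v := hDv.integrable_smul h1.continuous h2 h3
  have := congrArg L (h.integral_eq h1 h2 h3 v)
  rw [map_neg, ← L.integral_comp_comm hi1, ← L.integral_comp_comm hi2] at this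
  simpa using this

lemma locallyIntegrableOn_fun_add {G : Type*} [NormedAddCommGroup G] {f g : Euc n → G}
    {U : Set (Euc n)} (hf : LocallyIntegrableOn f U) (hg : LocallyIntegrableOn g U) :
    LocallyIntegrableOn (fun x => f x + g x) U := hf.add hg

lemma locallyIntegrableOn_fun_zero {G : Type*} [NormedAddCommGroup G] {U : Set (Euc n)} :
    LocallyIntegrableOn (fun _ => (0 : G)) U := locallyIntegrableOn_zero

lemma WeakDeriv.add {u u' : Euc n → F} {D D' : Euc n → Euc n →L[ℝ] F} {U : Set (Euc n)}
    (h : WeakDeriv u D U) (h' : WeakDeriv u' D' U) :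
    WeakDeriv (fun x => u x + u' x) (fun x => D x + D' x) U := by
  refine weakDeriv_iff.2 ⟨locallyIntegrableOn_fun_add h.1 h'.1,
    locallyIntegrableOn_fun_add h.2.1 h'.2.1, fun η h1 h2 h3 v => ?_⟩
  have hDv : ∀ {D : Euc n → Euc n →L[ℝ] F}, LocallyIntegrableOn D U →
      Integrable fun x => η x • D x v := fun hD =>
    (LocallyIntegrableOn.clm_comp (ContinuousLinearMap.apply ℝ F v) hD).integrable_smul
      h1.continuous h2 h3
  have hu : ∀ {u : Euc n → F}, LocallyIntegrableOn u U →
      Integrable fun x => fderiv ℝ η x v • u x := fun hu =>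
    hu.integrable_smul ((h1.continuous_fderiv (by simp)).clm_apply continuous_const)
      (h2.fderiv_apply ℝ v) ((tsupport_fderiv_apply_subset ℝ v).trans h3)
  simp only [smul_add, add_apply]
  rw [integral_add (hu h.1) (hu h'.1), integral_add (hDv h.2.1) (hDv h'.2.1),
    h.integral_eq h1 h2 h3, h'.integral_eq h1 h2 h3, neg_add]

lemma weakDeriv_zero (U : Set (Euc n)) :
    WeakDeriv (fun _ => (0 : F)) (fun _ => (0 : Euc n →L[ℝ] F)) U :=
  weakDeriv_iff.2 ⟨locallyIntegrableOn_fun_zero, locallyIntegrableOn_fun_zero, by simp⟩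

lemma WeakDeriv.sum {ι : Type*} (s : Finset ι) {u : ι → Euc n → F}
    {D : ι → Euc n → Euc n →L[ℝ] F} {U : Set (Euc n)} (h : ∀ i ∈ s, WeakDeriv (u i) (D i) U) :
    WeakDeriv (fun x => ∑ i ∈ s, u i x) (fun x => ∑ i ∈ s, D i x) U := by
  induction s using Finset.induction_on with
  | empty => simpa using weakDeriv_zero U
  | insert a s ha ih =>
    simp only [Finset.sum_insert ha]
    exact (h a (Finset.mem_insert_self a s)).add
      (ih fun i hi => h i (Finset.mem_insert_of_mem hi))

/-- The linear map whose components are `G i`. -/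
def clmOfComponents {m : ℕ} (G : Fin m → Euc n →L[ℝ] ℝ) : Euc n →L[ℝ] Euc m :=
  ∑ i, (ContinuousLinearMap.toSpanSingleton ℝ (EuclideanSpace.single i (1 : ℝ))).comp (G i)

lemma WeakDeriv.of_components {m : ℕ} {u : Euc n → Euc m} {G : Fin m → Euc n → Euc n →L[ℝ] ℝ}
    {U : Set (Euc n)} (h : ∀ i, WeakDeriv (fun x => u x i) (G i) U) :
    WeakDeriv u (fun x => clmOfComponents fun i => G i x) U := by
  have := WeakDeriv.sum Finset.univ fun i _ => (h i).clm_comp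
    (ContinuousLinearMap.toSpanSingleton ℝ (EuclideanSpace.single i (1 : ℝ)))
  convert this using 2 with x
  · ext j
    simp [ContinuousLinearMap.toSpanSingleton_apply, Pi.single_apply]
  · rfl

lemma ContDiff.weakDeriv [CompleteSpace F] {u : Euc n → F} (hu : ContDiff ℝ 1 u)
    (U : Set (Euc n)) : WeakDeriv u (fderiv ℝ u) U :=
  weakDeriv_iff.2 ⟨hu.continuous.locallyIntegrable.locallyIntegrableOn U,
    (hu.continuous_fderiv (by simp)).locallyIntegrable.locallyIntegrableOn U,
    fun _ h1 h2 _ v => (h1.of_le (by simp)).integral_fderiv_smul_eq h2 hu v⟩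

lemma WeakDeriv.exists_stronglyMeasurable {u : Euc n → F} {D : Euc n → Euc n →L[ℝ] F}
    {U : Set (Euc n)} (hU : IsOpen U) (h : WeakDeriv u D U) :
    ∃ D', StronglyMeasurable D' ∧ D =ᵐ[volume.restrict U] D' ∧ (∀ x ∉ U, D' x = 0) ∧
      WeakDeriv u D' U := by
  have hm : AEStronglyMeasurable D (volume.restrict U) := h.2.1.aestronglyMeasurable
  have he : D =ᵐ[volume.restrict U] U.indicator (hm.mk D) := by
    filter_upwards [hm.ae_eq_mk, ae_restrict_mem hU.measurableSet] with x hx hxU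
    rw [indicator_of_mem hxU, hx]
  exact ⟨U.indicator (hm.mk D), hm.stronglyMeasurable_mk.indicator hU.measurableSet, he,
    fun x hx => indicator_of_notMem hx _, h.congr (ae_eq_refl _) he⟩

lemma WeakDeriv.exists_of_locally [CompleteSpace F] {u : Euc n → F} {U : Set (Euc n)}
    (hU : IsOpen U)
    (h : ∀ x ∈ U, ∃ V, IsOpen V ∧ x ∈ V ∧ V ⊆ U ∧ ∃ D, WeakDeriv u D V) :
    ∃ D, StronglyMeasurable D ∧ (∀ x ∉ U, D x = 0) ∧ WeakDeriv u D U := by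
  suffices ∃ D, WeakDeriv u D U by
    obtain ⟨D, hD⟩ := this
    obtain ⟨D', h1, -, h2, h3⟩ := hD.exists_stronglyMeasurable hU
    exact ⟨D', h1, h2, h3⟩
  choose! V hVo hxV hVU D hD using h
  obtain ⟨T, hTc, hT⟩ := TopologicalSpace.isOpen_iUnion_countable (fun x : U => V x)
    (fun x => hVo x x.2)
  have hcov : ∀ x ∈ U, ∃ y ∈ T, x ∈ V y := by
    intro x hx
    have : x ∈ ⋃ i ∈ T, V i.1 := hT ▸ mem_iUnion.2 ⟨⟨x, hx⟩, hxV x hx⟩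
    simpa using this
  rcases T.eq_empty_or_nonempty with rfl | hne
  · have : U = ∅ := eq_empty_of_forall_notMem fun x hx => by simpa using hcov x hx
    exact ⟨0, WeakDeriv.of_locally fun x hx => by simp [this] at hx⟩
  obtain ⟨f, hf⟩ := hTc.exists_eq_range hne
  have hcov' : ∀ x ∈ U, ∃ k, x ∈ V (f k) := by
    intro x hx
    obtain ⟨y, hy, hxy⟩ := hcov x hx
    obtain ⟨k, rfl⟩ := hf ▸ hy
    exact ⟨k, hxy⟩
  let E : Euc n → Euc n →L[ℝ] F := fun x =>
    if hx : ∃ k, x ∈ V (f k) then D (f (Nat.find hx)) x else 0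
  have hae : ∀ j k, ∀ᵐ x, x ∈ V (f j) → x ∈ V (f k) → D (f j) x = D (f k) x := by
    intro j k
    have ho : IsOpen (V (f j) ∩ V (f k)) := (hVo _ (f j).2).inter (hVo _ (f k).2)
    have := WeakDeriv.ae_eq ho ((hD _ (f j).2).mono inter_subset_left)
      ((hD _ (f k).2).mono inter_subset_right)
    rw [ae_restrict_iff' ho.measurableSet] at this
    filter_upwards [this] with x hx h1 h2 using hx ⟨h1, h2⟩
  refine ⟨E, WeakDeriv.of_locally fun x hx => ?_⟩
  obtain ⟨k, hk⟩ := hcov' x hx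
  refine ⟨V (f k), hVo _ (f k).2, hk, (hD _ (f k).2).congr (ae_eq_refl _) ?_⟩
  have h1 := ae_restrict_of_ae (s := V (f k)) (ae_all_iff.2 fun j => hae k j)
  filter_upwards [h1, ae_restrict_mem (hVo _ (f k).2).measurableSet] with y hy hyk
  have hex : ∃ k, y ∈ V (f k) := ⟨k, hyk⟩
  simp only [E, dif_pos hex]
  exact hy _ hyk (Nat.find_spec hex)

lemma HasWeakGradientOn.weakDeriv {f : Euc n → ℝ} {g : Euc n → Euc n} {U : Set (Euc n)}
    (h : HasWeakGradientOn f g U) : WeakDeriv f (fun x => innerSL ℝ (g x)) U := by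
  refine ⟨h.1, LocallyIntegrableOn.clm_comp (innerSL ℝ) h.2.1, fun η h1 h2 h3 v => ?_⟩
  have := h.2.2 η h1 h2 h3 v
  simpa [mul_comm] using this

lemma ContDiff.hasWeakGradientOn {f : Euc n → ℝ} (hf : ContDiff ℝ 1 f) (U : Set (Euc n)) :
    HasWeakGradientOn f (fun x => (InnerProductSpace.toDual ℝ (Euc n)).symm (fderiv ℝ f x)) U := by
  have h := hf.weakDeriv U
  refine ⟨h.1, ?_, fun η h1 h2 h3 v => ?_⟩
  · exact ((InnerProductSpace.toDual ℝ (Euc n)).symm.continuous.comp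
      (hf.continuous_fderiv (by simp))).locallyIntegrable.locallyIntegrableOn U
  · have := h.2.2 η h1 h2 h3 v
    simpa [mul_comm] using this

lemma lpNormE_natCast {f : Euc n → ℝ≥0∞} {m : ℕ} (hm : m ≠ 0) (μ : Measure (Euc n)) :
    lpNormE f m μ ^ m = ∫⁻ x, f x ^ m ∂μ := by
  have hm' : (m : ℝ) ≠ 0 := Nat.cast_ne_zero.2 hm
  rw [lpNormE, if_neg (ENNReal.natCast_ne_top m), ENNReal.toReal_natCast, ← ENNReal.rpow_natCast,
    ← ENNReal.rpow_mul, one_div_mul_cancel hm', ENNReal.rpow_one]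
  simp_rw [ENNReal.rpow_natCast]

lemma HasCompactSupport.lintegral_enorm_pow_ne_top {G : Type*} [NormedAddCommGroup G]
    {f : Euc n → G} (hc : HasCompactSupport f) (hf : Continuous f) {m : ℕ} (hm : m ≠ 0) :
    ∫⁻ y, ‖f y‖ₑ ^ m ≠ ∞ := by
  have hs : HasCompactSupport fun y => ‖f y‖ ^ m := hc.comp_left (g := fun L => ‖L‖ ^ m) (by simp [hm])
  have := ((hf.norm.pow m).integrable_of_hasCompactSupport (μ := volume) hs).2
  rw [HasFiniteIntegral] at this
  simpa [enorm_pow, enorm_norm] using this.ne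

/-- The consequence of the boundedness of the composition operator for test functions. -/
def CompTestBound (φ : Euc n → Euc n) (Ω : Set (Euc n)) (C : ℝ≥0∞) : Prop :=
  ∀ f : Euc n → ℝ, ContDiff ℝ (⊤ : ℕ∞) f → HasCompactSupport f →
    ∃ G, WeakDeriv (f ∘ φ) G Ω ∧
      (∫⁻ x in Ω, ‖G x‖ₑ ^ (n - 1)) ^ n ≤ C * (∫⁻ y, ‖fderiv ℝ f y‖ₑ ^ n) ^ (n - 1)

lemma IsCompOpBdd.exists_compTestBound (hn : 2 ≤ n) {φ : Euc n → Euc n} {Ω Ω' : Set (Euc n)}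
    (h : IsCompOpBdd Ω Ω' φ (n : ℝ≥0∞) ((n : ℝ≥0∞) - 1)) :
    ∃ C ≠ ∞, CompTestBound φ Ω C := by
  obtain ⟨K, hK, h⟩ := h
  have hn0 : n ≠ 0 := by omega
  have hn1 : n - 1 ≠ 0 := by omega
  have hcast : (n : ℝ≥0∞) - 1 = ((n - 1 : ℕ) : ℝ≥0∞) := by push_cast; rfl
  rw [hcast] at h
  refine ⟨K ^ ((n - 1) * n), ENNReal.pow_ne_top hK, fun f hf hc => ?_⟩
  have hg := (hf.of_le (by simp) : ContDiff ℝ 1 f).hasWeakGradientOn Ω'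
  have hnorm : ∀ y, (‖(InnerProductSpace.toDual ℝ (Euc n)).symm (fderiv ℝ f y)‖₊ : ℝ≥0∞) =
      ‖fderiv ℝ f y‖ₑ := fun y => by
    rw [LinearIsometryEquiv.nnnorm_map]; rfl
  have hle : lpNormE (fun y => (‖(InnerProductSpace.toDual ℝ (Euc n)).symm (fderiv ℝ f y)‖₊ : ℝ≥0∞))
      n (volume.restrict Ω') ^ n ≤ ∫⁻ y, ‖fderiv ℝ f y‖ₑ ^ n := by
    rw [lpNormE_natCast hn0]
    simp_rw [hnorm]
    exact setLIntegral_le_lintegral _ _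
  have hfin : ∫⁻ y, ‖fderiv ℝ f y‖ₑ ^ n ≠ ∞ :=
    (hc.fderiv ℝ).lintegral_enorm_pow_ne_top (hf.continuous_fderiv (by simp)) hn0
  obtain ⟨g, hg1, hg2⟩ := h f _ hg (fun htop => by
    rw [htop, ENNReal.top_pow hn0] at hle
    exact hfin (top_le_iff.1 hle))
  refine ⟨_, hg1.weakDeriv, ?_⟩
  have h1 := pow_le_pow_left' hg2 ((n - 1) * n)
  rw [pow_mul, lpNormE_natCast hn1, mul_pow, mul_comm (n - 1) n, pow_mul (lpNormE _ _ _) n] at h1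
  have h2 : ∀ x, ‖innerSL ℝ (g x)‖ₑ = (‖g x‖₊ : ℝ≥0∞) := fun x => by
    rw [← ofReal_norm, innerSL_apply_norm, ofReal_norm]; rfl
  simp_rw [h2]
  rw [mul_comm (n - 1) n]
  exact h1.trans (by gcongr)

section homeo

variable {φ : Euc n → Euc n} {Ω Ω' : Set (Euc n)}

lemma IsHomeoOn.isOpen_inter_preimage (h : IsHomeoOn φ Ω Ω') (hΩ : IsOpen Ω) {V : Set (Euc n)}
    (hV : IsOpen V) : IsOpen (Ω ∩ φ ⁻¹' V) := h.2.1.isOpen_inter_preimage hΩ hV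

lemma IsHomeoOn.invFunOn_mem (h : IsHomeoOn φ Ω Ω') {y : Euc n} (hy : y ∈ Ω') :
    Function.invFunOn φ Ω y ∈ Ω := h.1.surjOn.mapsTo_invFunOn hy

lemma IsHomeoOn.apply_invFunOn (h : IsHomeoOn φ Ω Ω') {y : Euc n} (hy : y ∈ Ω') :
    φ (Function.invFunOn φ Ω y) = y := h.1.surjOn.rightInvOn_invFunOn hy

lemma IsHomeoOn.invFunOn_apply (h : IsHomeoOn φ Ω Ω') {x : Euc n} (hx : x ∈ Ω) :
    Function.invFunOn φ Ω (φ x) = x := h.1.injOn.leftInvOn_invFunOn hx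

lemma IsHomeoOn.isCompact_inter_preimage (h : IsHomeoOn φ Ω Ω') {K : Set (Euc n)}
    (hK : IsCompact K) (hKΩ : K ⊆ Ω') : IsCompact (Ω ∩ φ ⁻¹' K) := by
  have : Ω ∩ φ ⁻¹' K = Function.invFunOn φ Ω '' K := by
    ext x
    constructor
    · rintro ⟨hx, hxK⟩
      exact ⟨φ x, hxK, h.invFunOn_apply hx⟩
    · rintro ⟨y, hy, rfl⟩
      exact ⟨h.invFunOn_mem (hKΩ hy), by simpa [h.apply_invFunOn (hKΩ hy)] using hy⟩
  rw [this]
  exact hK.image_of_continuousOn (h.2.2.mono hKΩ)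

/-- Smooth cutoff functions for compact subsets of open sets. -/
lemma exists_smooth_cutoff {K U : Set (Euc n)} (hK : IsCompact K) (hU : IsOpen U) (hKU : K ⊆ U) :
    ∃ χ : Euc n → ℝ, ContDiff ℝ (⊤ : ℕ∞) χ ∧ HasCompactSupport χ ∧ tsupport χ ⊆ U ∧
      (∀ x, χ x ∈ Icc (0 : ℝ) 1) ∧ ∃ V, IsOpen V ∧ K ⊆ V ∧ V ⊆ U ∧ ∀ x ∈ V, χ x = 1 := by
  obtain ⟨K₁, hK₁, hKK₁, hK₁U⟩ := exists_compact_between hK hU hKU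
  obtain ⟨K₂, hK₂, hKK₂, hK₂U⟩ := exists_compact_between hK₁ hU hK₁U
  obtain ⟨χ, h1, h2, h3, h4⟩ := exists_contMDiff_support_eq_eq_one_iff
    (modelWithCornersSelf ℝ (Euc n)) (n := (⊤ : ℕ∞)) isOpen_interior (hK₁.isClosed) hKK₂
  have hts : tsupport χ ⊆ K₂ := closure_minimal (h3.le.trans interior_subset) hK₂.isClosed
  refine ⟨χ, h1.contDiff, hK₂.of_isClosed_subset (isClosed_tsupport _) hts, hts.trans hK₂U,
    fun x => h2 (mem_range_self x), interior K₁, isOpen_interior, hKK₁,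
    interior_subset.trans hK₁U, fun x hx => (h4 x).1 (interior_subset hx)⟩

end homeo

lemma sum_pow_le_card_pow_mul_sum {m : ℕ} (a : Fin m → ℝ≥0∞) {p : ℕ} (hp : p ≠ 0) :
    (∑ i, a i) ^ p ≤ m ^ p * ∑ i, a i ^ p := by
  rcases Nat.eq_zero_or_pos m with rfl | hm
  · simp [hp]
  · obtain ⟨i, -, hi⟩ := Finset.exists_max_image Finset.univ a ⟨⟨0, hm⟩, Finset.mem_univ _⟩
    calc (∑ i, a i) ^ p ≤ (m * a i) ^ p := by
          gcongr
          simpa using Finset.sum_le_card_nsmul Finset.univ a (a i) hi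
      _ = m ^ p * a i ^ p := mul_pow _ _ _
      _ ≤ _ := by
          gcongr
          exact Finset.single_le_sum (f := fun i => a i ^ p) (fun _ _ => bot_le) (Finset.mem_univ i)

lemma add_pow_le_two_pow_mul (a b : ℝ≥0∞) (p : ℕ) : (a + b) ^ p ≤ 2 ^ p * (a ^ p + b ^ p) := by
  rcases le_total a b with h | h
  · calc (a + b) ^ p ≤ (2 * b) ^ p := by rw [two_mul]; gcongr
      _ ≤ _ := by rw [mul_pow]; gcongr; exact le_add_self
  · calc (a + b) ^ p ≤ (2 * a) ^ p := by rw [two_mul]; gcongr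
      _ ≤ _ := by rw [mul_pow]; gcongr; exact le_self_add

lemma clmOfComponents_proj_comp {m : ℕ} (T : Euc n →L[ℝ] Euc m) :
    clmOfComponents (fun i => (EuclideanSpace.proj i : Euc m →L[ℝ] ℝ).comp T) = T := by
  ext x j
  simp [clmOfComponents, ContinuousLinearMap.toSpanSingleton_apply, Pi.single_apply]

lemma enorm_clmOfComponents_le {m : ℕ} (G : Fin m → Euc n →L[ℝ] ℝ) :
    ‖clmOfComponents G‖ₑ ≤ ∑ i, ‖G i‖ₑ := by
  refine (enorm_sum_le Finset.univ fun i => (ContinuousLinearMap.toSpanSingleton ℝ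
    (EuclideanSpace.single i (1 : ℝ))).comp (G i)).trans (Finset.sum_le_sum fun i _ => ?_)
  rw [← ofReal_norm, ← ofReal_norm]
  refine ENNReal.ofReal_le_ofReal ((ContinuousLinearMap.opNorm_comp_le _ _).trans ?_)
  simp

lemma enorm_proj_comp_le {m : ℕ} (i : Fin m) (T : Euc n →L[ℝ] Euc m) :
    ‖(EuclideanSpace.proj i : Euc m →L[ℝ] ℝ).comp T‖ₑ ≤ ‖T‖ₑ := by
  rw [← ofReal_norm, ← ofReal_norm]
  refine ENNReal.ofReal_le_ofReal (ContinuousLinearMap.opNorm_le_bound _ (norm_nonneg _) fun x => ?_)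
  exact (PiLp.norm_apply_le (T x) i).trans (T.le_opNorm x)

lemma enorm_clmOfComponents_pow_le {m : ℕ} (G : Fin m → Euc n →L[ℝ] ℝ) {p : ℕ} (hp : p ≠ 0) :
    ‖clmOfComponents G‖ₑ ^ p ≤ m ^ p * ∑ i, ‖G i‖ₑ ^ p :=
  (pow_le_pow_left' (enorm_clmOfComponents_le G) p).trans (sum_pow_le_card_pow_mul_sum _ hp)

section composition

variable {φ : Euc n → Euc n} {Ω Ω' : Set (Euc n)} {C : ℝ≥0∞}

lemma CompTestBound.exists_weakDeriv_near (hC : CompTestBound φ Ω C) (hC' : C ≠ ∞)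
    (hn : 2 ≤ n) (hΩ : IsOpen Ω)
    (hΩ' : IsOpen Ω') (hφ : IsHomeoOn φ Ω Ω') {K : Set (Euc n)} (hK : IsCompact K) (hKΩ : K ⊆ Ω) :
    ∃ V, IsOpen V ∧ K ⊆ V ∧ V ⊆ Ω ∧ ∃ D, WeakDeriv φ D V ∧ ∫⁻ x in V, ‖D x‖ₑ ^ (n - 1) ≠ ∞ := by
  have hK' : IsCompact (φ '' K) := hK.image_of_continuousOn (hφ.2.1.mono hKΩ)
  obtain ⟨χ, h1, h2, -, -, V', hV', hKV', -, hV1⟩ := exists_smooth_cutoff hK' hΩ'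
    ((image_mono hKΩ).trans hφ.1.mapsTo.image_subset)
  have hf : ∀ i : Fin n, ContDiff ℝ (⊤ : ℕ∞) fun y : Euc n => χ y * y i := fun i =>
    h1.mul (EuclideanSpace.proj i : Euc n →L[ℝ] ℝ).contDiff
  have hfc : ∀ i : Fin n, HasCompactSupport fun y : Euc n => χ y * y i := fun i => h2.mul_right
  choose G hG1 hG2 using fun i => hC _ (hf i) (hfc i)
  have hVo := hφ.isOpen_inter_preimage hΩ hV'
  refine ⟨Ω ∩ φ ⁻¹' V', hVo, fun x hx => ⟨hKΩ hx, hKV' ⟨x, hx, rfl⟩⟩, inter_subset_left,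
    fun x => clmOfComponents fun i => G i x, WeakDeriv.of_components fun i => ?_, ?_⟩
  · refine ((hG1 i).mono inter_subset_left).congr ?_ (ae_eq_refl _)
    filter_upwards [ae_restrict_mem hVo.measurableSet] with x hx
    simp [hV1 _ hx.2]
  · refine ne_top_of_le_ne_top ?_ ((lintegral_mono_set inter_subset_left).trans
      (lintegral_mono fun x => enorm_clmOfComponents_pow_le (fun i => G i x) (by omega)))
    have hm : ∀ i, AEStronglyMeasurable (G i) (volume.restrict Ω) := fun i =>
      (hG1 i).2.1.aestronglyMeasurable
    rw [lintegral_const_mul' _ _ (ENNReal.pow_ne_top (ENNReal.natCast_ne_top n)),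
      lintegral_finsetSum' _ fun i _ => (hm i).enorm.pow_const (n - 1)]
    refine ENNReal.mul_ne_top (ENNReal.pow_ne_top (ENNReal.natCast_ne_top n))
      (ENNReal.sum_ne_top.2 fun i _ htop => ?_)
    have := hG2 i
    rw [htop, ENNReal.top_pow (by omega)] at this
    refine ENNReal.mul_ne_top hC' (ENNReal.pow_ne_top ?_) (top_le_iff.1 this)
    exact ((hfc i).fderiv ℝ).lintegral_enorm_pow_ne_top ((hf i).continuous_fderiv (by simp))
      (by omega)

lemma CompTestBound.exists_weakDeriv (hC : CompTestBound φ Ω C) (hC' : C ≠ ∞)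
    (hn : 2 ≤ n) (hΩ : IsOpen Ω) (hΩ' : IsOpen Ω') (hφ : IsHomeoOn φ Ω Ω') :
    ∃ D, StronglyMeasurable D ∧ (∀ x ∉ Ω, D x = 0) ∧ WeakDeriv φ D Ω ∧
      ∀ K ⊆ Ω, IsCompact K → ∫⁻ x in K, ‖D x‖ₑ ^ (n - 1) ≠ ∞ := by
  obtain ⟨D, h1, h2, h3⟩ := WeakDeriv.exists_of_locally (u := φ) hΩ fun x hx => by
    obtain ⟨V, hV, hKV, hVΩ, D, hD, -⟩ := hC.exists_weakDeriv_near hC' hn hΩ hΩ' hφ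
      (isCompact_singleton (x := x)) (by simpa using hx)
    exact ⟨V, hV, by simpa using hKV, hVΩ, D, hD⟩
  refine ⟨D, h1, h2, h3, fun K hKΩ hK => ?_⟩
  obtain ⟨V, hV, hKV, hVΩ, D', hD', hfin⟩ := hC.exists_weakDeriv_near hC' hn hΩ hΩ' hφ hK hKΩ
  refine ne_top_of_le_ne_top hfin ((lintegral_mono_set hKV).trans_eq (lintegral_congr_ae ?_))
  filter_upwards [WeakDeriv.ae_eq hV (h3.mono hVΩ) hD'] with x hx
  rw [hx]

lemma CompTestBound.lintegral_oscillating_le (hC : CompTestBound φ Ω C)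
    (hΩ : IsOpen Ω) (hφ : ContinuousOn φ Ω) {D : Euc n → Euc n →L[ℝ] Euc n}
    (hD : WeakDeriv φ D Ω) {S T : ℝ → ℝ} (hS : ContDiff ℝ (⊤ : ℕ∞) S)
    (hST : ∀ t, HasDerivAt S (T t) t) (hS1 : ∀ t, |S t| ≤ 1) (hT1 : ∀ t, |T t| ≤ 1)
    {w : Euc n → ℝ} (hw : ContDiff ℝ (⊤ : ℕ∞) w) (hwc : HasCompactSupport w) (i : Fin n)
    {ε : ℝ} (hε : 0 < ε) :
    (∫⁻ x in Ω, (‖T (ε⁻¹ * φ x i)‖ₑ * ‖w (φ x)‖ₑ *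
        ‖(EuclideanSpace.proj i : Euc n →L[ℝ] ℝ).comp (D x)‖ₑ) ^ (n - 1)) ^ n ≤
      (2 ^ (n - 1)) ^ n * (2 ^ n * (C * (2 ^ n * ((∫⁻ y, ‖w y‖ₑ ^ n) +
        ENNReal.ofReal ε ^ n * ∫⁻ y, ‖fderiv ℝ w y‖ₑ ^ n)) ^ (n - 1) +
        (ENNReal.ofReal ε ^ (n - 1) * ∫⁻ x in Ω, (‖fderiv ℝ w (φ x)‖ₑ * ‖D x‖ₑ) ^ (n - 1)) ^ n)) := by
  set L : Euc n →L[ℝ] ℝ := EuclideanSpace.proj i with hL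
  set f : Euc n → ℝ := fun y => (ε * S (ε⁻¹ * L y)) * w y with hf
  have hSL : ContDiff ℝ (⊤ : ℕ∞) fun y => ε * S (ε⁻¹ * L y) :=
    contDiff_const.mul (hS.comp (contDiff_const.mul L.contDiff))
  have hfs : ContDiff ℝ (⊤ : ℕ∞) f := hSL.mul hw
  have hfc : HasCompactSupport f := hwc.mul_left
  have hfd : ∀ y, fderiv ℝ f y = (T (ε⁻¹ * L y) * w y) • L + (ε * S (ε⁻¹ * L y)) • fderiv ℝ w y := by
    intro y
    have h1 : HasFDerivAt (fun y => ε * S (ε⁻¹ * L y)) (T (ε⁻¹ * L y) • L) y := by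
      have h2 := ((hST (ε⁻¹ * L y)).comp_hasFDerivAt y (L.hasFDerivAt.const_mul ε⁻¹)).const_mul ε
      have e : T (ε⁻¹ * L y) • L = ε • T (ε⁻¹ * L y) • ε⁻¹ • L := by
        rw [smul_smul, smul_smul]
        congr 1
        field_simp
      rw [e]
      exact h2
    have h3 := (h1.mul (hw.differentiable (by simp) y).hasFDerivAt).fderiv
    rw [hf]
    refine h3.trans ?_
    rw [add_comm, smul_smul, mul_comm (w y)]
  have hLn : ‖L‖ₑ ≤ 1 := by
    have := enorm_proj_comp_le i (ContinuousLinearMap.id ℝ (Euc n))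
    rw [ContinuousLinearMap.comp_id] at this
    refine this.trans ?_
    rw [← ofReal_norm, ← ENNReal.ofReal_one]
    exact ENNReal.ofReal_le_ofReal ContinuousLinearMap.norm_id_le
  have hTe : ∀ t, ‖T t‖ₑ ≤ 1 := fun t => by
    rw [← ofReal_norm, ← ENNReal.ofReal_one]; exact ENNReal.ofReal_le_ofReal (hT1 t)
  have hSe : ∀ t, ‖ε * S t‖ₑ ≤ ENNReal.ofReal ε := fun t => by
    rw [← ofReal_norm]
    refine ENNReal.ofReal_le_ofReal ?_
    rw [norm_mul, Real.norm_of_nonneg hε.le]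
    exact mul_le_of_le_one_right hε.le (hS1 t)
  obtain ⟨G, hG1, hG2⟩ := hC f hfs hfc
  have hchain : WeakDeriv (f ∘ φ) (fun x => (fderiv ℝ f (φ x)).comp (D x)) Ω := by
    obtain ⟨C₁, hC₁⟩ := hfc.exists_bound_of_continuous hfs.continuous
    obtain ⟨C₂, hC₂⟩ := (hfc.fderiv ℝ).exists_bound_of_continuous (hfs.continuous_fderiv (by simp))
    exact hD.comp_left hΩ hφ (hfs.of_le (by simp)) (C := max C₁ C₂)
      (fun y => (hC₁ y).trans (le_max_left _ _)) (fun y => (hC₂ y).trans (le_max_right _ _))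
  have hae := WeakDeriv.ae_eq hΩ hG1 hchain
  have hpt : ∀ᵐ x ∂volume.restrict Ω, (‖T (ε⁻¹ * φ x i)‖ₑ * ‖w (φ x)‖ₑ * ‖L.comp (D x)‖ₑ) ^ (n - 1) ≤
      2 ^ (n - 1) * (‖G x‖ₑ ^ (n - 1) + ENNReal.ofReal ε ^ (n - 1) *
        (‖fderiv ℝ w (φ x)‖ₑ * ‖D x‖ₑ) ^ (n - 1)) := by
    filter_upwards [hae] with x hx
    rw [← mul_pow (ENNReal.ofReal ε)]
    refine le_trans (pow_le_pow_left' ?_ _) (add_pow_le_two_pow_mul _ _ _)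
    have e : (T (ε⁻¹ * L (φ x)) * w (φ x)) • L.comp (D x) =
        G x - (ε * S (ε⁻¹ * L (φ x))) • (fderiv ℝ w (φ x)).comp (D x) := by
      rw [hx, hfd]
      ext v
      simp
    calc _ = ‖(T (ε⁻¹ * L (φ x)) * w (φ x)) • L.comp (D x)‖ₑ := by
          rw [enorm_smul, enorm_mul]; rfl
      _ ≤ ‖G x‖ₑ + ‖(ε * S (ε⁻¹ * L (φ x))) • (fderiv ℝ w (φ x)).comp (D x)‖ₑ := by
          rw [e, sub_eq_add_neg]
          exact (enorm_add_le (G x) (-_)).trans_eq (by rw [enorm_neg])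
      _ ≤ _ := by
          rw [enorm_smul]
          gcongr
          · exact hSe _
          · rw [← ofReal_norm, ← ofReal_norm, ← ofReal_norm, ← ENNReal.ofReal_mul (norm_nonneg _)]
            exact ENNReal.ofReal_le_ofReal (ContinuousLinearMap.opNorm_comp_le _ _)
  have hGm : AEMeasurable (fun x => ‖G x‖ₑ ^ (n - 1)) (volume.restrict Ω) :=
    (hG1.2.1.aestronglyMeasurable).enorm.pow_const _
  have hfn : ∫⁻ y, ‖fderiv ℝ f y‖ₑ ^ n ≤ 2 ^ n * ((∫⁻ y, ‖w y‖ₑ ^ n) +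
        ENNReal.ofReal ε ^ n * ∫⁻ y, ‖fderiv ℝ w y‖ₑ ^ n) := by
    calc _ ≤ ∫⁻ y, 2 ^ n * (‖w y‖ₑ ^ n + ENNReal.ofReal ε ^ n * ‖fderiv ℝ w y‖ₑ ^ n) := by
          refine lintegral_mono fun y => ?_
          rw [hfd, ← mul_pow (ENNReal.ofReal ε)]
          refine le_trans (pow_le_pow_left' ?_ _) (add_pow_le_two_pow_mul _ _ _)
          refine (enorm_add_le ((T (ε⁻¹ * L y) * w y) • L) _).trans ?_
          rw [enorm_smul, enorm_smul, enorm_mul]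
          gcongr
          · calc _ ≤ 1 * ‖w y‖ₑ * 1 := by
                  gcongr
                  exact hTe _
              _ = _ := by simp
          · exact hSe _
      _ = _ := by
          have m1 : Measurable fun y => ‖w y‖ₑ ^ n := hw.continuous.enorm.measurable.pow_const n
          rw [lintegral_const_mul' _ _ (by simp), lintegral_add_left m1,
            lintegral_const_mul' _ _ (by simp)]
  calc _ ≤ (∫⁻ x in Ω, 2 ^ (n - 1) * (‖G x‖ₑ ^ (n - 1) + ENNReal.ofReal ε ^ (n - 1) *
        (‖fderiv ℝ w (φ x)‖ₑ * ‖D x‖ₑ) ^ (n - 1))) ^ n := by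
        gcongr 1
        exact lintegral_mono_ae hpt
    _ = (2 ^ (n - 1)) ^ n * ((∫⁻ x in Ω, ‖G x‖ₑ ^ (n - 1)) + ENNReal.ofReal ε ^ (n - 1) *
        ∫⁻ x in Ω, (‖fderiv ℝ w (φ x)‖ₑ * ‖D x‖ₑ) ^ (n - 1)) ^ n := by
        rw [lintegral_const_mul' _ _ (by simp), lintegral_add_left' hGm,
          lintegral_const_mul' _ _ (by simp), mul_pow]
    _ ≤ _ := by
        gcongr
        refine (add_pow_le_two_pow_mul _ _ _).trans ?_
        gcongr
        refine hG2.trans ?_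
        gcongr

lemma CompTestBound.lintegral_mul_pow_le (hC : CompTestBound φ Ω C) (hC' : C ≠ ∞) (hn : 2 ≤ n)
    (hΩ : IsOpen Ω) (hφ : IsHomeoOn φ Ω Ω') {D : Euc n → Euc n →L[ℝ] Euc n}
    (hD : WeakDeriv φ D Ω) (hDq : ∀ K ⊆ Ω, IsCompact K → ∫⁻ x in K, ‖D x‖ₑ ^ (n - 1) ≠ ∞) :
    ∃ C₁ ≠ ∞, ∀ w : Euc n → ℝ, ContDiff ℝ (⊤ : ℕ∞) w → HasCompactSupport w → tsupport w ⊆ Ω' →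
      (∫⁻ x in Ω, (‖w (φ x)‖ₑ * ‖D x‖ₑ) ^ (n - 1)) ^ n ≤ C₁ * (∫⁻ y, ‖w y‖ₑ ^ n) ^ (n - 1) := by
  have hn1 : n - 1 ≠ 0 := by omega
  have hn0 : n ≠ 0 := by omega
  set A : ℝ≥0∞ := (2 ^ (n - 1)) ^ n * (2 ^ n * (C * (2 ^ n) ^ (n - 1))) with hA
  have hAt : A ≠ ∞ := by finiteness
  have hDi : ∀ i : Fin n, AEMeasurable
      (fun x => ‖(EuclideanSpace.proj i : Euc n →L[ℝ] ℝ).comp (D x)‖ₑ) (volume.restrict Ω) :=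
    fun i => ((ContinuousLinearMap.compL ℝ (Euc n) (Euc n) ℝ
      (EuclideanSpace.proj i)).continuous.comp_aestronglyMeasurable
        hD.2.1.aestronglyMeasurable).enorm
  have hcomp : ∀ w : Euc n → ℝ, ContDiff ℝ (⊤ : ℕ∞) w → HasCompactSupport w → tsupport w ⊆ Ω' →
      ∀ i : Fin n, (∫⁻ x in Ω, (‖w (φ x)‖ₑ *
        ‖(EuclideanSpace.proj i : Euc n →L[ℝ] ℝ).comp (D x)‖ₑ) ^ (n - 1)) ^ n ≤
        (2 ^ (n - 1)) ^ n * (2 ^ n * (2 * A)) * (∫⁻ y, ‖w y‖ₑ ^ n) ^ (n - 1) := by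
    intro w hw hwc hws i
    set B := ∫⁻ y, ‖w y‖ₑ ^ n with hB
    set B' := ∫⁻ y, ‖fderiv ℝ w y‖ₑ ^ n with hB'
    set P := ∫⁻ x in Ω, (‖fderiv ℝ w (φ x)‖ₑ * ‖D x‖ₑ) ^ (n - 1) with hP
    have hBt : B ≠ ∞ := hwc.lintegral_enorm_pow_ne_top hw.continuous hn0
    have hBt' : B' ≠ ∞ := (hwc.fderiv ℝ).lintegral_enorm_pow_ne_top
      (hw.continuous_fderiv (by simp)) hn0
    have hPt : P ≠ ∞ := by
      obtain ⟨M, hM⟩ := (hwc.fderiv ℝ).exists_bound_of_continuous (hw.continuous_fderiv (by simp))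
      have hK := hφ.isCompact_inter_preimage hwc hws
      have hfin := hDq _ inter_subset_left hK
      refine ne_top_of_le_ne_top (b := ENNReal.ofReal M ^ (n - 1) *
        ∫⁻ x in Ω ∩ φ ⁻¹' tsupport w, ‖D x‖ₑ ^ (n - 1)) (by finiteness) ?_
      rw [hP, ← lintegral_const_mul' _ _ (by finiteness), ← lintegral_indicator hΩ.measurableSet,
        ← lintegral_indicator hK.measurableSet]
      refine lintegral_mono fun x => ?_
      by_cases hx : x ∈ Ω
      · by_cases hx' : φ x ∈ tsupport w
        · have hm : x ∈ Ω ∩ φ ⁻¹' tsupport w := ⟨hx, hx'⟩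
          rw [indicator_of_mem hx, indicator_of_mem hm, ← mul_pow]
          gcongr
          rw [← ofReal_norm]
          exact ENNReal.ofReal_le_ofReal (hM _)
        · have : fderiv ℝ w (φ x) = 0 :=
            image_eq_zero_of_notMem_tsupport fun h => hx' (tsupport_fderiv_subset ℝ h)
          have h0 : ‖fderiv ℝ w (φ x)‖ₑ = 0 := by
            rw [← ofReal_norm, this, norm_zero, ENNReal.ofReal_zero]
          rw [indicator_of_mem hx, h0, zero_mul, zero_pow hn1]
          exact bot_le
      · simp [indicator_of_notMem hx]
    have hbound : ∀ k : ℕ, (∫⁻ x in Ω, (‖w (φ x)‖ₑ *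
        ‖(EuclideanSpace.proj i : Euc n →L[ℝ] ℝ).comp (D x)‖ₑ) ^ (n - 1)) ^ n ≤
        (2 ^ (n - 1)) ^ n * (2 ^ n * (2 * ((2 ^ (n - 1)) ^ n * (2 ^ n * (C * (2 ^ n * (B +
        ENNReal.ofReal (1 / ((k : ℝ) + 1)) ^ n * B')) ^ (n - 1) +
        (ENNReal.ofReal (1 / ((k : ℝ) + 1)) ^ (n - 1) * P) ^ n))))) := by
      intro k
      have hk : 0 < 1 / ((k : ℝ) + 1) := by positivity
      set ε := 1 / ((k : ℝ) + 1)
      have h1 := hC.lintegral_oscillating_le hΩ hφ.2.1 hD Real.contDiff_sin Real.hasDerivAt_sin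
        Real.abs_sin_le_one Real.abs_cos_le_one hw hwc i hk
      have h2 := hC.lintegral_oscillating_le hΩ hφ.2.1 hD (S := fun t => - Real.cos t)
        Real.contDiff_cos.neg (fun t => by simpa using (Real.hasDerivAt_cos t).fun_neg)
        (fun t => by simpa using Real.abs_cos_le_one t) Real.abs_sin_le_one hw hwc i hk
      have hone : ∀ t : ℝ, 1 ≤ ‖Real.cos t‖ₑ + ‖Real.sin t‖ₑ := by
        intro t
        rw [← ofReal_norm, ← ofReal_norm, ← ENNReal.ofReal_add (norm_nonneg _) (norm_nonneg _),
          ENNReal.one_le_ofReal, Real.norm_eq_abs, Real.norm_eq_abs]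
        nlinarith [Real.sin_sq_add_cos_sq t, sq_abs (Real.sin t), sq_abs (Real.cos t),
          abs_nonneg (Real.sin t), abs_nonneg (Real.cos t), Real.abs_sin_le_one t,
          Real.abs_cos_le_one t]
      set g := fun x => ‖w (φ x)‖ₑ * ‖(EuclideanSpace.proj i : Euc n →L[ℝ] ℝ).comp (D x)‖ₑ with hg
      have hφm : AEMeasurable φ (volume.restrict Ω) := hφ.2.1.aemeasurable hΩ.measurableSet
      have hgm : AEMeasurable g (volume.restrict Ω) := by
        have m1 : AEMeasurable (fun x => ‖w (φ x)‖ₑ) (volume.restrict Ω) :=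
          (hw.continuous.measurable.comp_aemeasurable hφm).enorm
        exact m1.mul (hDi i)
      have hcm : AEMeasurable (fun x => (‖Real.cos (ε⁻¹ * φ x i)‖ₑ * g x) ^ (n - 1))
          (volume.restrict Ω) := by
        have m1 : AEMeasurable (fun x => ‖Real.cos (ε⁻¹ * φ x i)‖ₑ) (volume.restrict Ω) :=
          ((by fun_prop : Continuous fun y : Euc n =>
            Real.cos (ε⁻¹ * y i)).measurable.comp_aemeasurable hφm).enorm
        exact (m1.mul hgm).pow_const _
      calc (∫⁻ x in Ω, g x ^ (n - 1)) ^ n ≤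
          (∫⁻ x in Ω, 2 ^ (n - 1) * ((‖Real.cos (ε⁻¹ * φ x i)‖ₑ * g x) ^ (n - 1) +
            (‖Real.sin (ε⁻¹ * φ x i)‖ₑ * g x) ^ (n - 1))) ^ n := by
            gcongr with x
            refine le_trans (pow_le_pow_left' ?_ _) (add_pow_le_two_pow_mul _ _ _)
            rw [← add_mul]
            exact le_mul_of_one_le_left bot_le (hone _)
        _ = (2 ^ (n - 1)) ^ n * ((∫⁻ x in Ω, (‖Real.cos (ε⁻¹ * φ x i)‖ₑ * g x) ^ (n - 1)) +
            ∫⁻ x in Ω, (‖Real.sin (ε⁻¹ * φ x i)‖ₑ * g x) ^ (n - 1)) ^ n := by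
            rw [lintegral_const_mul' _ _ (by simp), lintegral_add_left' hcm, mul_pow]
        _ ≤ _ := by
            gcongr
            refine (add_pow_le_two_pow_mul _ _ _).trans ?_
            gcongr
            rw [two_mul]
            simp only [hg, ← mul_assoc]
            exact add_le_add (by simpa only [← mul_assoc] using h1)
              (by simpa only [← mul_assoc] using h2)
    have hε : Tendsto (fun k : ℕ => ENNReal.ofReal (1 / ((k : ℝ) + 1))) atTop (nhds 0) := by
      simpa using ENNReal.tendsto_ofReal tendsto_one_div_nat_add_one
    have hεp : ∀ {p : ℕ} {X : ℝ≥0∞}, p ≠ 0 → X ≠ ∞ →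
        Tendsto (fun k : ℕ => ENNReal.ofReal (1 / ((k : ℝ) + 1)) ^ p * X) atTop (nhds 0) := by
      intro p X hp hX
      have := ENNReal.Tendsto.mul_const (ENNReal.Tendsto.pow (n := p) hε) (Or.inr hX) (b := X)
      simpa [hp] using this
    have hlim : Tendsto (fun k : ℕ => (2 ^ (n - 1)) ^ n * (2 ^ n * (2 * ((2 ^ (n - 1)) ^ n * (2 ^ n *
        (C * (2 ^ n * (B + ENNReal.ofReal (1 / ((k : ℝ) + 1)) ^ n * B')) ^ (n - 1) +
        (ENNReal.ofReal (1 / ((k : ℝ) + 1)) ^ (n - 1) * P) ^ n)))))) atTop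
        (nhds ((2 ^ (n - 1)) ^ n * (2 ^ n * (2 * ((2 ^ (n - 1)) ^ n * (2 ^ n *
        (C * (2 ^ n * (B + 0)) ^ (n - 1) + 0 ^ n))))))) := by
      refine ENNReal.Tendsto.const_mul ?_ (Or.inr (by finiteness))
      refine ENNReal.Tendsto.const_mul ?_ (Or.inr (by finiteness))
      refine ENNReal.Tendsto.const_mul ?_ (Or.inr (by finiteness))
      refine ENNReal.Tendsto.const_mul ?_ (Or.inr (by finiteness))
      refine ENNReal.Tendsto.const_mul ?_ (Or.inr (by finiteness))
      refine Tendsto.add ?_ (ENNReal.Tendsto.pow (n := n) (hεp hn1 hPt))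
      refine ENNReal.Tendsto.const_mul ?_ (Or.inr hC')
      exact ENNReal.Tendsto.pow (ENNReal.Tendsto.const_mul (tendsto_const_nhds.add (hεp hn0 hBt'))
        (Or.inr (by finiteness)))
    refine (ge_of_tendsto' hlim hbound).trans_eq ?_
    rw [add_zero, zero_pow hn0, add_zero, mul_pow, hA]
    ring
  refine ⟨((n : ℝ≥0∞) ^ (n - 1)) ^ n * (n ^ n * (n * ((2 ^ (n - 1)) ^ n * (2 ^ n * (2 * A))))),
    by finiteness, fun w hw hwc hws => ?_⟩
  have hφm : AEMeasurable φ (volume.restrict Ω) := hφ.2.1.aemeasurable hΩ.measurableSet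
  calc _ ≤ (∫⁻ x in Ω, n ^ (n - 1) * ∑ i : Fin n, (‖w (φ x)‖ₑ *
        ‖(EuclideanSpace.proj i : Euc n →L[ℝ] ℝ).comp (D x)‖ₑ) ^ (n - 1)) ^ n := by
        gcongr with x
        nth_rewrite 1 [← clmOfComponents_proj_comp (D x)]
        simp only [mul_pow, ← Finset.mul_sum]
        rw [mul_left_comm]
        gcongr
        exact enorm_clmOfComponents_pow_le _ hn1
    _ = (n ^ (n - 1)) ^ n * (∑ i : Fin n, ∫⁻ x in Ω, (‖w (φ x)‖ₑ *
        ‖(EuclideanSpace.proj i : Euc n →L[ℝ] ℝ).comp (D x)‖ₑ) ^ (n - 1)) ^ n := by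
        rw [lintegral_const_mul' _ _ (by finiteness), mul_pow, lintegral_finsetSum']
        intro i _
        have m1 : AEMeasurable (fun x => ‖w (φ x)‖ₑ) (volume.restrict Ω) :=
          (hw.continuous.measurable.comp_aemeasurable hφm).enorm
        exact (m1.mul (hDi i)).pow_const _
    _ ≤ (n ^ (n - 1)) ^ n * (n ^ n * ∑ i : Fin n, (2 ^ (n - 1)) ^ n * (2 ^ n * (2 * A)) *
        (∫⁻ y, ‖w y‖ₑ ^ n) ^ (n - 1)) := by
        gcongr
        refine (sum_pow_le_card_pow_mul_sum _ hn0).trans ?_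
        gcongr with i
        exact hcomp w hw hwc hws i
    _ = _ := by
        rw [Finset.sum_const, Finset.card_univ, Fintype.card_fin, nsmul_eq_mul]
        ring

end composition

lemma abs_det_le_prod_norm (T : Euc n →L[ℝ] Euc n) (b : OrthonormalBasis (Fin n) ℝ (Euc n)) :
    |LinearMap.det (T : Euc n →ₗ[ℝ] Euc n)| ≤ ∏ i, ‖T (b i)‖ := by
  have : Fact (Module.finrank ℝ (Euc n) = n) := ⟨by simp⟩
  have h := b.toBasis.orientation.abs_volumeForm_apply_le fun i => T (b i)
  rw [Orientation.volumeForm_robust' _ b] at h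
  have e : b.toBasis.det (fun i => T (b i)) = LinearMap.det (T : Euc n →ₗ[ℝ] Euc n) := by
    have := b.toBasis.det_comp (T : Euc n →ₗ[ℝ] Euc n) b.toBasis
    rw [b.toBasis.det_self, mul_one] at this
    rw [← this]
    congr 1
  rwa [e] at h

lemma abs_det_le_norm_mul (T : Euc n →L[ℝ] Euc n) {h : Euc n} (hh : ‖h‖ = 1) :
    |LinearMap.det (T : Euc n →ₗ[ℝ] Euc n)| ≤ ‖T h‖ * ‖T‖ ^ (n - 1) := by
  rcases Nat.eq_zero_or_pos n with rfl | hn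
  · have : h = 0 := Subsingleton.elim _ _
    simp [this] at hh
  set i₀ : Fin n := ⟨0, hn⟩
  obtain ⟨b, hb⟩ := Orthonormal.exists_orthonormalBasis_extension_of_card_eq (𝕜 := ℝ)
    (ι := Fin n) (E := Euc n) (by simp) (v := fun _ => h) (s := {i₀}) (by
      rw [orthonormal_iff_ite]
      rintro ⟨i, hi⟩ ⟨j, hj⟩
      obtain rfl : i = i₀ := hi
      obtain rfl : j = i₀ := hj
      simp [Set.domRestrict_apply, hh])
  refine (abs_det_le_prod_norm T b).trans ?_
  rw [← Finset.mul_prod_erase _ _ (Finset.mem_univ i₀), hb i₀ rfl]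
  refine mul_le_mul_of_nonneg_left ?_ (norm_nonneg _)
  calc _ ≤ ∏ _i ∈ Finset.univ.erase i₀, ‖T‖ := by
        refine Finset.prod_le_prod (fun _ _ => norm_nonneg _) fun i _ => ?_
        simpa using T.le_opNorm (b i)
    _ = _ := by simp

lemma nonempty_unit_sphere (hn : 0 < n) : Nonempty {h : Euc n // ‖h‖ = 1} :=
  ⟨⟨EuclideanSpace.single ⟨0, hn⟩ 1, by simp⟩⟩

lemma minStretch_nonneg (T : Euc n →L[ℝ] Euc n) : 0 ≤ minStretch T :=
  Real.iInf_nonneg fun _ => norm_nonneg _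

lemma minStretch_le (T : Euc n →L[ℝ] Euc n) {h : Euc n} (hh : ‖h‖ = 1) : minStretch T ≤ ‖T h‖ :=
  ciInf_le (f := fun h : {h : Euc n // ‖h‖ = 1} => ‖T h.1‖)
    ⟨0, by rintro _ ⟨h, rfl⟩; exact norm_nonneg _⟩ ⟨h, hh⟩

lemma minStretch_mul_norm_le (T : Euc n →L[ℝ] Euc n) (v : Euc n) : minStretch T * ‖v‖ ≤ ‖T v‖ := by
  rcases eq_or_ne v 0 with rfl | hv
  · simp
  have hv' : 0 < ‖v‖ := norm_pos_iff.2 hv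
  have h := minStretch_le T (h := ‖v‖⁻¹ • v) (by rw [norm_smul]; simp [hv])
  rw [map_smul, norm_smul, norm_inv, norm_norm] at h
  calc minStretch T * ‖v‖ ≤ ‖v‖⁻¹ * ‖T v‖ * ‖v‖ := by gcongr
    _ = ‖T v‖ := by field_simp

lemma abs_det_le_minStretch_mul (hn : 0 < n) (T : Euc n →L[ℝ] Euc n) :
    |LinearMap.det (T : Euc n →ₗ[ℝ] Euc n)| ≤ minStretch T * ‖T‖ ^ (n - 1) := by
  have := nonempty_unit_sphere hn
  rw [minStretch, Real.iInf_mul_of_nonneg (by positivity)]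
  exact le_ciInf fun h => abs_det_le_norm_mul T h.2

lemma minStretch_le_add (hn : 0 < n) (S T : Euc n →L[ℝ] Euc n) :
    minStretch S ≤ minStretch T + ‖S - T‖ := by
  have := nonempty_unit_sphere hn
  rw [← sub_le_iff_le_add]
  refine le_ciInf fun h => ?_
  have h1 := minStretch_le S h.2
  have h2 : ‖(S - T) h.1‖ ≤ ‖S - T‖ := by simpa [h.2] using (S - T).le_opNorm h.1
  have h3 : ‖S h.1‖ ≤ ‖T h.1‖ + ‖(S - T) h.1‖ := by
    have : S h.1 = T h.1 + (S - T) h.1 := by simp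
    rw [this]
    exact norm_add_le _ _
  linarith

lemma continuous_minStretch (hn : 0 < n) :
    Continuous (minStretch : (Euc n →L[ℝ] Euc n) → ℝ) := by
  refine (LipschitzWith.of_le_add (f := (minStretch : (Euc n →L[ℝ] Euc n) → ℝ)) fun S T => ?_).continuous
  rw [dist_eq_norm]
  exact minStretch_le_add hn S T

lemma measurable_jacobian {D : Euc n → Euc n →L[ℝ] Euc n} (hD : StronglyMeasurable D) :
    Measurable (jacobian D) :=
  (ContinuousLinearMap.continuous_det.comp_stronglyMeasurable hD).measurable

lemma measurable_innerDil (hn : 0 < n) {D : Euc n → Euc n →L[ℝ] Euc n}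
    (hD : StronglyMeasurable D) : Measurable (innerDil D) := by
  have h1 := measurable_jacobian hD
  have h2 : Measurable fun x => minStretch (D x) :=
    ((continuous_minStretch hn).comp_stronglyMeasurable hD).measurable
  exact Measurable.ite (h1 (measurableSet_singleton 0)) measurable_const
    ((continuous_abs.measurable.comp h1).div (h2.pow_const n)).ennreal_ofReal

lemma innerDil_le (hn : 2 ≤ n) (D : Euc n → Euc n →L[ℝ] Euc n) (x : Euc n) :
    innerDil D x ≤ ENNReal.ofReal (|jacobian D x| *
      (‖D x‖ ^ (n - 1) / |jacobian D x|) ^ n) := by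
  unfold innerDil
  split_ifs with h
  · exact bot_le
  · refine ENNReal.ofReal_le_ofReal ?_
    have hJ : 0 < |jacobian D x| := abs_pos.2 h
    have h1 := abs_det_le_minStretch_mul (by omega) (D x)
    change |jacobian D x| ≤ _ at h1
    have hl : 0 < minStretch (D x) := by
      by_contra hl
      have : minStretch (D x) = 0 := le_antisymm (not_lt.1 hl) (minStretch_nonneg _)
      rw [this, zero_mul] at h1
      linarith
    rw [div_eq_mul_inv]
    refine mul_le_mul_of_nonneg_left ?_ hJ.le
    rw [← inv_pow]
    refine pow_le_pow_left₀ (by positivity) ?_ _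
    rw [inv_le_iff_one_le_mul₀ hl, div_mul_eq_mul_div, one_le_div hJ, mul_comm]
    exact h1

section area

variable {φ : Euc n → Euc n} {Ω Ω' : Set (Euc n)} {D : Euc n → Euc n →L[ℝ] Euc n}

lemma IsHomeoOn.measurableSet_image (hφ : IsHomeoOn φ Ω Ω') {E : Set (Euc n)}
    (hE : MeasurableSet E) (hEΩ : E ⊆ Ω) : MeasurableSet (φ '' E) :=
  hE.image_of_continuousOn_injOn (hφ.2.1.mono hEΩ) (hφ.1.injOn.mono hEΩ)

lemma IsHomeoOn.lintegral_image (hφ : IsHomeoOn φ Ω Ω') (hΩ : IsOpen Ω)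
    (hN : LuzinN φ Ω) (hDm : StronglyMeasurable D) (hD : WeakDeriv φ D Ω) {E : Set (Euc n)}
    (hE : MeasurableSet E) (hEΩ : E ⊆ Ω) (g : Euc n → ℝ≥0∞) :
    ∫⁻ y in φ '' E, g y = ∫⁻ x in E, ENNReal.ofReal |jacobian D x| * g (φ x) := by
  obtain ⟨A, hAm, hAΩ, hA0, hAd⟩ := hD.exists_hasFDerivWithinAt hΩ hφ.2.1 hDm
  set B : ℕ → Set (Euc n) := fun k => E ∩ disjointed A k with hB
  have hBm : ∀ k, MeasurableSet (B k) := fun k => hE.inter (.disjointed hAm k)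
  have hBd : Pairwise (Function.onFun Disjoint B) := fun i j hij =>
    (disjoint_disjointed A hij).mono inter_subset_right inter_subset_right
  have hBE : ∀ k, B k ⊆ E := fun k => inter_subset_left
  have hBu : ⋃ k, B k = E ∩ ⋃ k, A k := by
    rw [hB, ← inter_iUnion, iUnion_disjointed]
  have hnull : volume (E \ ⋃ k, B k) = 0 := by
    rw [hBu, sdiff_self_inter]
    exact measure_mono_null (sdiff_subset_sdiff_left hEΩ) hA0
  have hnull' : volume (φ '' (E \ ⋃ k, B k)) = 0 := hN _ (sdiff_subset.trans hEΩ) hnull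
  have hinj : InjOn φ E := hφ.1.injOn.mono hEΩ
  have e1 : ∫⁻ y in φ '' E, g y = ∫⁻ y in ⋃ k, φ '' B k, g y := by
    refine setLIntegral_congr ?_
    refine (ae_eq_set.2 ⟨measure_mono_null ?_ hnull', measure_mono_null ?_ measure_empty⟩)
    · rintro _ ⟨⟨x, hx, rfl⟩, hx'⟩
      refine ⟨x, ⟨hx, fun h => hx' ?_⟩, rfl⟩
      rw [← image_iUnion]
      exact mem_image_of_mem _ h
    · rintro y ⟨hy, hy'⟩
      rw [← image_iUnion] at hy
      exact hy' (image_mono (iUnion_subset hBE) hy)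
  have e2 : ∫⁻ x in E, ENNReal.ofReal |jacobian D x| * g (φ x) =
      ∫⁻ x in ⋃ k, B k, ENNReal.ofReal |jacobian D x| * g (φ x) := by
    refine setLIntegral_congr ?_
    exact (ae_eq_set.2 ⟨hnull, by rw [sdiff_eq_empty.2 (iUnion_subset hBE), measure_empty]⟩)
  rw [e1, e2, lintegral_iUnion (fun k => hφ.measurableSet_image (hBm k) ((hBE k).trans hEΩ)),
    lintegral_iUnion hBm hBd]
  · congr with k
    exact lintegral_image_eq_lintegral_abs_det_fderiv_mul volume (hBm k)
      (fun x hx => (hAd k x (disjointed_subset A k hx.2)).mono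
        fun y hy => disjointed_subset A k hy.2) (hinj.mono (hBE k)) g
  · intro i j hij
    exact (hBd hij).image hinj (hBE i) (hBE j)

end area

section distortion

variable {φ : Euc n → Euc n} {Ω Ω' : Set (Euc n)} {D : Euc n → Euc n →L[ℝ] Euc n} {C : ℝ≥0∞}

lemma IsHomeoOn.measurableSet_inter_preimage (hφ : IsHomeoOn φ Ω Ω') (hΩ : IsOpen Ω)
    {M : Set (Euc n)} (hM : MeasurableSet M) : MeasurableSet (Ω ∩ φ ⁻¹' M) := by
  have h : Measurable (Ω.domRestrict φ) :=
    (continuousOn_iff_continuous_domRestrict.1 hφ.2.1).measurable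
  have := hΩ.measurableSet.subtype_image (h hM)
  rwa [show Subtype.val '' (Ω.domRestrict φ ⁻¹' M) = Ω ∩ φ ⁻¹' M by
    ext x; simp [Set.domRestrict_apply, and_comm]] at this

lemma IsHomeoOn.volume_image (hφ : IsHomeoOn φ Ω Ω') (hΩ : IsOpen Ω)
    (hN : LuzinN φ Ω) (hDm : StronglyMeasurable D) (hD : WeakDeriv φ D Ω) {E : Set (Euc n)}
    (hE : MeasurableSet E) (hEΩ : E ⊆ Ω) :
    volume (φ '' E) = ∫⁻ x in E, ENNReal.ofReal |jacobian D x| := by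
  have := hφ.lintegral_image hΩ hN hDm hD hE hEΩ 1
  simpa using this

lemma IsHomeoOn.ae_notMem_of_null (hφ : IsHomeoOn φ Ω Ω') (hΩ : IsOpen Ω)
    (hN : LuzinN φ Ω) (hDm : StronglyMeasurable D) (hD : WeakDeriv φ D Ω) {M : Set (Euc n)}
    (hM : volume M = 0) : ∀ᵐ x ∂volume.restrict Ω, jacobian D x ≠ 0 → φ x ∉ M := by
  set M' := toMeasurable volume M with hM'
  have hM'm : MeasurableSet M' := measurableSet_toMeasurable _ _
  have hE := hφ.measurableSet_inter_preimage hΩ hM'm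
  have h0 := hφ.volume_image hΩ hN hDm hD hE inter_subset_left
  have h1 : volume (φ '' (Ω ∩ φ ⁻¹' M')) = 0 := by
    refine measure_mono_null ?_ ((measure_toMeasurable M).trans hM)
    rintro _ ⟨x, hx, rfl⟩
    exact hx.2
  have hJm : Measurable fun x => ENNReal.ofReal |jacobian D x| :=
    (continuous_abs.measurable.comp (measurable_jacobian hDm)).ennreal_ofReal
  rw [h1, eq_comm, lintegral_eq_zero_iff hJm, Filter.EventuallyEq, ae_restrict_iff' hE] at h0
  rw [ae_restrict_iff' hΩ.measurableSet]
  filter_upwards [h0] with x hx hxΩ hJ hxM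
  have := hx ⟨hxΩ, subset_toMeasurable _ _ hxM⟩
  simp [hJ] at this

lemma ae_eq_zero_of_forall_compact {Z : Set (Euc n)} (hZ : MeasurableSet Z) {f : Euc n → ℝ≥0∞}
    (hf : Measurable f) (h : ∀ K ⊆ Z, IsCompact K → ∫⁻ x in K, f x = 0) :
    ∀ᵐ x, x ∈ Z → f x = 0 := by
  set P := Z ∩ {x | f x ≠ 0} with hP
  have hPm : MeasurableSet P := hZ.inter (hf (measurableSet_singleton 0).compl)
  by_contra hcon
  have hpos : 0 < volume P := by
    rw [pos_iff_ne_zero]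
    intro h0
    apply hcon
    filter_upwards [measure_eq_zero_iff_ae_notMem.1 h0] with x hx hxZ
    by_contra hfx
    exact hx ⟨hxZ, hfx⟩
  obtain ⟨K, hKP, hK, hK0⟩ := hPm.exists_lt_isCompact hpos
  have h0 := h K (hKP.trans inter_subset_left) hK
  rw [lintegral_eq_zero_iff hf, Filter.EventuallyEq, ae_restrict_iff' hK.measurableSet] at h0
  refine hK0.ne' (measure_eq_zero_iff_ae_notMem.2 ?_)
  filter_upwards [h0] with x hx hxK
  exact (hKP hxK).2 (hx hxK)

/-- The weighted inequality for the composition operator, tested on smooth functions. -/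
def SmoothWeightBound (φ : Euc n → Euc n) (Ω Ω' : Set (Euc n)) (D : Euc n → Euc n →L[ℝ] Euc n)
    (C : ℝ≥0∞) : Prop :=
  ∀ w : Euc n → ℝ, ContDiff ℝ (⊤ : ℕ∞) w → HasCompactSupport w → tsupport w ⊆ Ω' →
    (∫⁻ x in Ω, (‖w (φ x)‖ₑ * ‖D x‖ₑ) ^ (n - 1)) ^ n ≤ C * (∫⁻ y, ‖w y‖ₑ ^ n) ^ (n - 1)

lemma SmoothWeightBound.pow_le (hC : SmoothWeightBound φ Ω Ω' D C) (hn : 2 ≤ n)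
    (hφ : IsHomeoOn φ Ω Ω') {K U : Set (Euc n)} (hK : IsCompact K) (hKΩ : K ⊆ Ω) (hU : IsOpen U)
    (hKU : φ '' K ⊆ U) (hUΩ : U ⊆ Ω') :
    (∫⁻ x in K, ‖D x‖ₑ ^ (n - 1)) ^ n ≤ C * volume U ^ (n - 1) := by
  obtain ⟨χ, hχ1, hχ2, hχ3, hχ4, V, hV, hKV, hVU, hχ5⟩ := exists_smooth_cutoff
    (hK.image_of_continuousOn (hφ.2.1.mono hKΩ)) hU hKU
  refine le_trans ?_ ((hC χ hχ1 hχ2 (hχ3.trans hUΩ)).trans ?_)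
  · gcongr 1
    refine le_trans ?_ (lintegral_mono_set hKΩ)
    refine setLIntegral_mono' hK.measurableSet fun x hx => ?_
    rw [hχ5 _ (hKV (mem_image_of_mem φ hx))]
    simp
  · gcongr
    calc ∫⁻ y, ‖χ y‖ₑ ^ n ≤ ∫⁻ y, U.indicator 1 y := by
          refine lintegral_mono fun y => ?_
          by_cases hy : y ∈ U
          · rw [indicator_of_mem hy]
            refine pow_le_one' ?_ _
            rw [← ofReal_norm, Real.norm_of_nonneg (hχ4 y).1]
            exact ENNReal.ofReal_le_one.2 (hχ4 y).2
          · have : χ y = 0 := image_eq_zero_of_notMem_tsupport fun h => hy (hχ3 h)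
            rw [this, enorm_zero, zero_pow (by omega)]
            exact bot_le
      _ = volume U := lintegral_indicator_one hU.measurableSet

lemma SmoothWeightBound.finiteDistortionOn (hC : SmoothWeightBound φ Ω Ω' D C) (hC' : C ≠ ∞)
    (hn : 2 ≤ n) (hφ : IsHomeoOn φ Ω Ω') (hΩ : IsOpen Ω) (hΩ' : IsOpen Ω')
    (hN : LuzinN φ Ω) (hDm : StronglyMeasurable D) (hD : WeakDeriv φ D Ω) :
    FiniteDistortionOn D Ω := by
  set Z := Ω ∩ {x | jacobian D x = 0} with hZ
  have hZm : MeasurableSet Z :=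
    hΩ.measurableSet.inter (measurable_jacobian hDm (measurableSet_singleton 0))
  have hfm : Measurable fun x => ‖D x‖ₑ ^ (n - 1) := hDm.enorm.pow_const _
  have key : ∀ K ⊆ Z, IsCompact K → ∫⁻ x in K, ‖D x‖ₑ ^ (n - 1) = 0 := by
    intro K hKZ hK
    have hKΩ : K ⊆ Ω := hKZ.trans inter_subset_left
    have h0 : volume (φ '' K) = 0 := by
      rw [hφ.volume_image hΩ hN hDm hD hK.measurableSet hKΩ]
      refine (setLIntegral_congr_fun hK.measurableSet fun x hx => ?_).trans lintegral_zero
      have : jacobian D x = 0 := (hKZ hx).2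
      simp [this]
    have hle : ∀ k : ℕ, (∫⁻ x in K, ‖D x‖ₑ ^ (n - 1)) ^ n ≤
        C * ENNReal.ofReal (1 / ((k : ℝ) + 1)) ^ (n - 1) := by
      intro k
      have hk : volume (φ '' K) < ENNReal.ofReal (1 / ((k : ℝ) + 1)) := by
        rw [h0]
        exact ENNReal.ofReal_pos.2 (by positivity)
      obtain ⟨U, hUK, hU, hUk⟩ := Set.exists_isOpen_lt_of_lt _ _ hk
      refine (hC.pow_le hn hφ hK hKΩ (hU.inter hΩ') (subset_inter hUK ?_)
        inter_subset_right).trans ?_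
      · rintro _ ⟨x, hx, rfl⟩
        exact hφ.1.mapsTo (hKΩ hx)
      · gcongr
        exact (measure_mono inter_subset_left).trans hUk.le
    have hlim : Tendsto (fun k : ℕ => C * ENNReal.ofReal (1 / ((k : ℝ) + 1)) ^ (n - 1)) atTop
        (nhds (C * ENNReal.ofReal 0 ^ (n - 1))) :=
      ENNReal.Tendsto.const_mul (ENNReal.Tendsto.pow
        (ENNReal.tendsto_ofReal tendsto_one_div_nat_add_one)) (Or.inr hC')
    have := ge_of_tendsto' hlim hle
    rw [ENNReal.ofReal_zero, zero_pow (by omega), mul_zero] at this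
    exact eq_zero_of_pow_eq_zero (le_antisymm this bot_le)
  rw [FiniteDistortionOn, ae_restrict_iff' hΩ.measurableSet]
  filter_upwards [ae_eq_zero_of_forall_compact hZm hfm key] with x hx hxΩ hJ
  have := eq_zero_of_pow_eq_zero (hx ⟨hxΩ, hJ⟩)
  rw [← ofReal_norm, ENNReal.ofReal_eq_zero] at this
  exact norm_le_zero_iff.1 this

lemma SmoothWeightBound.lintegral_le_of_measurable (hC : SmoothWeightBound φ Ω Ω' D C)
    (hC' : C ≠ ∞) (hn : 2 ≤ n) (hφ : IsHomeoOn φ Ω Ω') (hΩ : IsOpen Ω) (hΩ' : IsOpen Ω')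
    (hN : LuzinN φ Ω) (hDm : StronglyMeasurable D) (hD : WeakDeriv φ D Ω)
    {w : Euc n → ℝ} (hw : Measurable w) {m : ℝ} (hwm : ∀ y, ‖w y‖ ≤ m) {K : Set (Euc n)}
    (hK : IsCompact K) (hKΩ : K ⊆ Ω') (hwK : ∀ y ∉ K, w y = 0) :
    (∫⁻ x in Ω, (‖w (φ x)‖ₑ * ‖D x‖ₑ) ^ (n - 1)) ^ n ≤ C * (∫⁻ y, ‖w y‖ₑ ^ n) ^ (n - 1) := by
  have hn0 : n ≠ 0 := by omega
  have hn1 : n - 1 ≠ 0 := by omega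
  have hm : 0 ≤ m := (norm_nonneg _).trans (hwm 0)
  have hwint : Integrable w := by
    refine (integrableOn_iff_integrable_of_support_subset (s := K) fun y hy => ?_).1 ?_
    · by_contra h
      exact hy (hwK y h)
    · exact IntegrableOn.of_bound hK.measure_lt_top hw.aestronglyMeasurable m
        (Eventually.of_forall hwm)
  obtain ⟨δ, hδ, hδK⟩ := hK.exists_cthickening_subset_open hΩ' hKΩ
  set K' := Metric.cthickening δ K with hK'
  have hK'c : IsCompact K' := hK.cthickening
  obtain ⟨k₀, hk₀⟩ := (exists_nat_one_div_lt' hδ).exists_forall_of_atTop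
  set v : ℕ → Euc n → ℝ := fun k => mollify (k + k₀) w with hv
  have hvs : ∀ k, ContDiff ℝ (⊤ : ℕ∞) (v k) := fun k =>
    contDiff_mollify _ hwint.locallyIntegrable
  have hvK : ∀ k, ∀ y ∉ K', v k y = 0 := by
    intro k y hy
    refine integral_eq_zero_of_ae (Eventually.of_forall fun t => ?_)
    simp only [Pi.zero_apply, smul_eq_mul, mul_eq_zero]
    by_cases ht : 1 / (((k + k₀ : ℕ) : ℝ) + 1) < ‖t‖
    · exact Or.inl (mollKernel_eq_zero ht)
    · refine Or.inr (hwK _ fun h => hy ?_)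
      refine Metric.mem_cthickening_of_dist_le y (y - t) δ K h ?_
      rw [dist_eq_norm, show y - (y - t) = t by abel]
      exact (not_lt.1 ht).trans (hk₀ _ (by omega)).le
  have hvt : ∀ k, tsupport (v k) ⊆ K' := fun k =>
    closure_minimal (fun y hy => by_contra fun h => hy (hvK k y h)) hK'c.isClosed
  have hvm : ∀ k y, ‖v k y‖ ≤ m := by
    intro k y
    calc ‖v k y‖ ≤ ∫ t, mollKernel n (k + k₀) t * m := by
          refine norm_integral_le_of_norm_le ((integrable_mollKernel _).mul_const m)
            (Eventually.of_forall fun t => ?_)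
          rw [norm_smul, Real.norm_of_nonneg (mollKernel_nonneg _ _)]
          exact mul_le_mul_of_nonneg_left (hwm _) (mollKernel_nonneg _ _)
      _ = m := by rw [integral_mul_const, integral_mollKernel, one_mul]
  have hae : ∀ᵐ y, Tendsto (fun k => v k y) atTop (nhds (w y)) := by
    have h1 : Tendsto (fun k => (mollifier n (k + k₀)).rOut) atTop (nhds 0) :=
      tendsto_one_div_nat_add_one.comp (tendsto_add_atTop_nat k₀)
    refine ContDiffBump.ae_convolution_tendsto_right_of_locallyIntegrable
      (φ := fun k => mollifier n (k + k₀)) (K := 2) h1 (Eventually.of_forall fun k => ?_)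
      hwint.locallyIntegrable
    change 1 / (((k + k₀ : ℕ) : ℝ) + 1) ≤ 2 * (1 / (((k + k₀ : ℕ) : ℝ) + 1) / 2)
    linarith
  have hlim : Tendsto (fun k => ∫⁻ y, ‖v k y‖ₑ ^ n) atTop (nhds (∫⁻ y, ‖w y‖ₑ ^ n)) := by
    refine tendsto_lintegral_of_dominated_convergence (K'.indicator fun _ => ENNReal.ofReal m ^ n)
      (fun k => ((hvs k).continuous.enorm.measurable.pow_const n)) (fun k => ?_) ?_ ?_
    · refine Eventually.of_forall fun y => ?_
      by_cases hy : y ∈ K'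
      · simp only [indicator_of_mem hy]
        gcongr
        rw [← ofReal_norm]
        exact ENNReal.ofReal_le_ofReal (hvm k y)
      · simp [hvK k y hy, hn0]
    · rw [lintegral_indicator hK'c.measurableSet, setLIntegral_const]
      exact ENNReal.mul_ne_top (by finiteness) hK'c.measure_lt_top.ne
    · filter_upwards [hae] with y hy
      exact ENNReal.Tendsto.pow ((continuous_enorm.tendsto _).comp hy)
  have hae2 : ∀ᵐ x ∂volume.restrict Ω,
      Tendsto (fun k => (‖v k (φ x)‖ₑ * ‖D x‖ₑ) ^ (n - 1)) atTop
        (nhds ((‖w (φ x)‖ₑ * ‖D x‖ₑ) ^ (n - 1))) := by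
    filter_upwards [hφ.ae_notMem_of_null hΩ hN hDm hD (ae_iff.1 hae),
      hC.finiteDistortionOn hC' hn hφ hΩ hΩ' hN hDm hD] with x hx hx'
    by_cases hJ : jacobian D x = 0
    · have h0 : ‖D x‖ₑ = 0 := by rw [← ofReal_norm, hx' hJ, norm_zero, ENNReal.ofReal_zero]
      simp only [h0, mul_zero]
      exact tendsto_const_nhds
    · have h1 : Tendsto (fun k => v k (φ x)) atTop (nhds (w (φ x))) := by
        have := hx hJ
        simpa using this
      exact ENNReal.Tendsto.pow (ENNReal.Tendsto.mul_const
        ((continuous_enorm.tendsto _).comp h1) (Or.inr enorm_ne_top))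
  have hφm : AEMeasurable φ (volume.restrict Ω) := hφ.2.1.aemeasurable hΩ.measurableSet
  have hvm' : ∀ k, AEMeasurable (fun x => (‖v k (φ x)‖ₑ * ‖D x‖ₑ) ^ (n - 1))
      (volume.restrict Ω) := by
    intro k
    have m1 : AEMeasurable (fun x => ‖v k (φ x)‖ₑ) (volume.restrict Ω) :=
      ((hvs k).continuous.measurable.comp_aemeasurable hφm).enorm
    have m2 : AEMeasurable (fun x => ‖D x‖ₑ) (volume.restrict Ω) := hDm.enorm.aemeasurable
    exact (m1.mul m2).pow_const _
  have hroot : ∀ X Y : ℝ≥0∞, X ^ n ≤ Y ↔ X ≤ Y ^ (n : ℝ)⁻¹ := fun X Y => by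
    rw [ENNReal.le_rpow_inv_iff (by positivity), ENNReal.rpow_natCast]
  rw [hroot]
  refine lintegral_le_of_tendsto hvm' hae2 (b := fun k =>
    (C * (∫⁻ y, ‖v k y‖ₑ ^ n) ^ (n - 1)) ^ (n : ℝ)⁻¹) (Eventually.of_forall fun k => ?_) ?_
  · rw [← hroot]
    exact hC _ (hvs k) (HasCompactSupport.of_support_subset_isCompact hK'c
      ((subset_tsupport _).trans (hvt k))) ((hvt k).trans hδK)
  · exact (ENNReal.continuous_rpow_const.tendsto _).comp
      (ENNReal.Tendsto.const_mul (ENNReal.Tendsto.pow hlim) (Or.inr hC'))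

end distortion

section dilatation

variable {φ : Euc n → Euc n} {Ω Ω' : Set (Euc n)} {D : Euc n → Euc n →L[ℝ] Euc n} {C : ℝ≥0∞}

lemma IsHomeoOn.measurable_indicator_comp_invFunOn (hφ : IsHomeoOn φ Ω Ω') (hΩ' : IsOpen Ω')
    {β : Type*} [MeasurableSpace β] [Zero β] {f : Euc n → β} (hf : Measurable f) :
    Measurable (Ω'.indicator fun y => f (Function.invFunOn φ Ω y)) := by
  have h1 : Measurable (Ω'.piecewise (Function.invFunOn φ Ω) fun _ => 0) :=
    hφ.2.2.measurable_piecewise continuousOn_const hΩ'.measurableSet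
  convert (hf.comp h1).indicator hΩ'.measurableSet using 1
  ext y
  by_cases hy : y ∈ Ω'
  · simp [indicator_of_mem hy, piecewise_eq_of_mem _ _ _ hy]
  · simp [indicator_of_notMem hy]

lemma IsOpen.exists_compact_exhaustion {U : Set (Euc n)} (hU : IsOpen U) :
    ∃ K : ℕ → Set (Euc n), (∀ k, IsCompact (K k)) ∧ (∀ k, K k ⊆ U) ∧ Monotone K ∧
      ∀ x ∈ U, ∃ k, x ∈ K k := by
  obtain ⟨F, hF1, hF2, hF3, hF4⟩ := hU.exists_iUnion_isClosed
  refine ⟨fun k => F k ∩ Metric.closedBall 0 k, fun k =>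
    (isCompact_closedBall _ _).inter_left (hF1 k), fun k => inter_subset_left.trans (hF2 k),
    fun i j hij => inter_subset_inter (hF4 hij)
      (Metric.closedBall_subset_closedBall (by exact_mod_cast hij)), fun x hx => ?_⟩
  rw [← hF3, mem_iUnion] at hx
  obtain ⟨i, hi⟩ := hx
  obtain ⟨j, hj⟩ := exists_nat_ge ‖x‖
  refine ⟨max i j, hF4 (le_max_left _ _) hi, ?_⟩
  rw [mem_closedBall_zero_iff]
  exact hj.trans (by exact_mod_cast le_max_right _ _)

lemma SmoothWeightBound.lintegral_distortion_le (hC : SmoothWeightBound φ Ω Ω' D C)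
    (hC' : C ≠ ∞) (hn : 2 ≤ n) (hφ : IsHomeoOn φ Ω Ω') (hΩ : IsOpen Ω) (hΩ' : IsOpen Ω')
    (hN : LuzinN φ Ω) (hDm : StronglyMeasurable D) (hD : WeakDeriv φ D Ω) :
    ∫⁻ x in Ω, ENNReal.ofReal (|jacobian D x| * (‖D x‖ ^ (n - 1) / |jacobian D x|) ^ n) ≤ C := by
  have hn0 : n ≠ 0 := by omega
  have hn1 : n - 1 + 1 = n := by omega
  have himg : φ '' Ω = Ω' := hφ.1.image_eq
  set f : Euc n → ℝ := fun x => ‖D x‖ ^ (n - 1) / |jacobian D x| with hf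
  have hfm : Measurable f := (hDm.norm.measurable.pow_const _).div
    (continuous_abs.measurable.comp (measurable_jacobian hDm))
  have hf0 : ∀ x, 0 ≤ f x := fun x => by positivity
  set g : Euc n → ℝ := Ω'.indicator fun y => f (Function.invFunOn φ Ω y) with hg
  have hgm : Measurable g := hφ.measurable_indicator_comp_invFunOn hΩ' hfm
  have hg0 : ∀ y, 0 ≤ g y := fun y => indicator_nonneg (fun _ _ => hf0 _) y
  have hgφ : ∀ x ∈ Ω, g (φ x) = f x := fun x hx => by
    rw [hg, indicator_of_mem (hφ.1.mapsTo hx), hφ.invFunOn_apply hx]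
  obtain ⟨K, hK1, hK2, hK3, hK4⟩ := IsOpen.exists_compact_exhaustion hΩ'
  set w : ℕ → Euc n → ℝ := fun k => (K k).indicator fun y => min (g y) k with hw
  have hwm : ∀ k, Measurable (w k) := fun k =>
    (hgm.min measurable_const).indicator (hK1 k).measurableSet
  have hw0 : ∀ k y, 0 ≤ w k y := fun k y =>
    indicator_nonneg (fun _ _ => le_min (hg0 _) (Nat.cast_nonneg _)) y
  have hwk : ∀ k y, ‖w k y‖ ≤ k := fun k y => by
    rw [Real.norm_of_nonneg (hw0 k y)]
    exact indicator_apply_le' (fun _ => min_le_right _ _) fun _ => Nat.cast_nonneg _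
  have hwg : ∀ k y, w k y ≤ g y := fun k y =>
    indicator_apply_le' (fun _ => min_le_left _ _) fun _ => hg0 _
  have hwK : ∀ k, ∀ y ∉ K k, w k y = 0 := fun k y hy => indicator_of_notMem hy _
  have hbound : ∀ k, ∫⁻ y in Ω', ‖w k y‖ₑ ^ n ≤ C := by
    intro k
    have h1 := hC.lintegral_le_of_measurable hC' hn hφ hΩ hΩ' hN hDm hD (hwm k) (hwk k)
      (hK1 k) (hK2 k) (hwK k)
    have e1 : ∫⁻ y in Ω', ‖w k y‖ₑ ^ n = ∫⁻ y, ‖w k y‖ₑ ^ n := by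
      rw [← lintegral_indicator hΩ'.measurableSet]
      congr with y
      by_cases hy : y ∈ Ω'
      · rw [indicator_of_mem hy]
      · rw [indicator_of_notMem hy, hwK k y fun h => hy (hK2 k h), enorm_zero, zero_pow hn0]
    set W := ∫⁻ y, ‖w k y‖ₑ ^ n with hW
    have hWt : W ≠ ∞ := by
      refine ne_top_of_le_ne_top (b := ∫⁻ y, (K k).indicator (fun _ => ENNReal.ofReal k ^ n) y)
        ?_ (lintegral_mono fun y => ?_)
      · rw [lintegral_indicator (hK1 k).measurableSet, setLIntegral_const]
        exact ENNReal.mul_ne_top (by finiteness) (hK1 k).measure_lt_top.ne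
      · by_cases hy : y ∈ K k
        · rw [indicator_of_mem hy, ← ofReal_norm]
          gcongr
          exact hwk k y
        · rw [indicator_of_notMem hy, hwK k y hy, enorm_zero, zero_pow hn0]
    have h2 : W ≤ ∫⁻ x in Ω, (‖w k (φ x)‖ₑ * ‖D x‖ₑ) ^ (n - 1) := by
      rw [← e1, ← himg, hφ.lintegral_image hΩ hN hDm hD hΩ.measurableSet subset_rfl]
      refine setLIntegral_mono' hΩ.measurableSet fun x hx => ?_
      rw [← ofReal_norm, ← ofReal_norm, ← ENNReal.ofReal_mul (norm_nonneg _),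
        ← ENNReal.ofReal_pow (by positivity), ← ENNReal.ofReal_pow (by positivity),
        ← ENNReal.ofReal_mul (by positivity)]
      refine ENNReal.ofReal_le_ofReal ?_
      rw [Real.norm_of_nonneg (hw0 _ _)]
      rw [show w k (φ x) ^ n = w k (φ x) ^ (n - 1) * w k (φ x) by rw [← pow_succ, hn1], mul_pow,
        mul_left_comm]
      refine mul_le_mul_of_nonneg_left ?_ (pow_nonneg (hw0 _ _) _)
      calc |jacobian D x| * w k (φ x) ≤ |jacobian D x| * f x := by
            gcongr
            rw [← hgφ x hx]
            exact hwg k _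
        _ ≤ ‖D x‖ ^ (n - 1) := by
            rw [hf]
            rcases eq_or_ne (|jacobian D x|) 0 with h | h
            · rw [h, zero_mul]; positivity
            · rw [mul_div_cancel₀ _ h]
    rw [e1]
    have h3 : W ^ n ≤ C * W ^ (n - 1) := (pow_le_pow_left' h2 n).trans h1
    rcases eq_or_ne W 0 with h0 | h0
    · rw [h0]; exact bot_le
    · rw [show W ^ n = W * W ^ (n - 1) by rw [← pow_succ', hn1]] at h3
      exact (ENNReal.mul_le_mul_iff_left (pow_ne_zero _ h0) (by finiteness)).1 h3
  have hlim : ∀ y ∈ Ω', Tendsto (fun k => ‖w k y‖ₑ ^ n) atTop (nhds (‖g y‖ₑ ^ n)) := by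
    intro y hy
    refine tendsto_const_nhds.congr' ?_
    obtain ⟨i, hi⟩ := hK4 y hy
    obtain ⟨j, hj⟩ := exists_nat_ge (g y)
    filter_upwards [eventually_ge_atTop (max i j)] with k hk
    have h1 : y ∈ K k := hK3 ((le_max_left _ _).trans hk) hi
    have h2 : g y ≤ k := hj.trans (by exact_mod_cast (le_max_right _ _).trans hk)
    rw [hw]
    simp only [indicator_of_mem h1, min_eq_left h2]
  have hfin : ∫⁻ y in Ω', ‖g y‖ₑ ^ n ≤ C :=
    lintegral_le_of_tendsto (fun k => ((hwm k).enorm.pow_const n).aemeasurable)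
      ((ae_restrict_iff' hΩ'.measurableSet).2 (Eventually.of_forall hlim))
      (Eventually.of_forall hbound) tendsto_const_nhds
  rw [← himg, hφ.lintegral_image hΩ hN hDm hD hΩ.measurableSet subset_rfl] at hfin
  refine le_trans (le_of_eq ?_) hfin
  refine setLIntegral_congr_fun hΩ.measurableSet fun x hx => ?_
  rw [← ofReal_norm, hgφ x hx, ENNReal.ofReal_mul (abs_nonneg _), ENNReal.ofReal_pow (hf0 x),
    Real.norm_of_nonneg (hf0 x)]

lemma SmoothWeightBound.lintegral_innerDil_le (hC : SmoothWeightBound φ Ω Ω' D C)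
    (hC' : C ≠ ∞) (hn : 2 ≤ n) (hφ : IsHomeoOn φ Ω Ω') (hΩ : IsOpen Ω) (hΩ' : IsOpen Ω')
    (hN : LuzinN φ Ω) (hDm : StronglyMeasurable D) (hD : WeakDeriv φ D Ω) :
    ∫⁻ x in Ω, innerDil D x ≤ C :=
  (lintegral_mono fun x => innerDil_le hn D x).trans
    (hC.lintegral_distortion_le hC' hn hφ hΩ hΩ' hN hDm hD)

end dilatation

/-- The adjugate of an endomorphism of `ℝⁿ`. -/
def adjMap (T : Euc n →L[ℝ] Euc n) : Euc n →L[ℝ] Euc n :=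
  Matrix.toEuclideanCLM (𝕜 := ℝ) ((Matrix.toEuclideanCLM (n := Fin n) (𝕜 := ℝ)).symm T).adjugate

lemma exists_toEuclideanCLM_eq (T : Euc n →L[ℝ] Euc n) :
    ∃ A : Matrix (Fin n) (Fin n) ℝ, Matrix.toEuclideanCLM (𝕜 := ℝ) A = T :=
  ⟨(Matrix.toEuclideanCLM (n := Fin n) (𝕜 := ℝ)).symm T, StarAlgEquiv.apply_symm_apply _ _⟩

lemma toEuclideanCLM_symm_apply (T : Euc n →L[ℝ] Euc n) (i j : Fin n) :
    (Matrix.toEuclideanCLM (n := Fin n) (𝕜 := ℝ)).symm T i j = T (EuclideanSpace.single j 1) i := by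
  obtain ⟨A, rfl⟩ := exists_toEuclideanCLM_eq T
  simp

lemma det_toEuclideanCLM (A : Matrix (Fin n) (Fin n) ℝ) :
    LinearMap.det (Matrix.toEuclideanCLM (𝕜 := ℝ) A : Euc n →ₗ[ℝ] Euc n) = A.det := by
  rw [Matrix.coe_toEuclideanCLM_eq_toEuclideanLin, Matrix.toEuclideanLin, Matrix.toLpLin_eq_toLin,
    LinearMap.det_toLin]

lemma apply_adjMap (T : Euc n →L[ℝ] Euc n) (v : Euc n) :
    T (adjMap T v) = LinearMap.det (T : Euc n →ₗ[ℝ] Euc n) • v := by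
  have h : T * adjMap T = LinearMap.det (T : Euc n →ₗ[ℝ] Euc n) • 1 := by
    obtain ⟨A, rfl⟩ := exists_toEuclideanCLM_eq T
    rw [adjMap, StarAlgEquiv.symm_apply_apply, ← map_mul, Matrix.mul_adjugate,
      map_smul, map_one, det_toEuclideanCLM]
  exact congrArg (fun S : Euc n →L[ℝ] Euc n => S v) h

lemma adjMap_smul (r : ℝ) (T : Euc n →L[ℝ] Euc n) : adjMap (r • T) = r ^ (n - 1) • adjMap T := by
  rw [adjMap, map_smul, Matrix.adjugate_smul, map_smul, Fintype.card_fin, adjMap]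

lemma continuous_adjMap : Continuous (adjMap : (Euc n →L[ℝ] Euc n) → (Euc n →L[ℝ] Euc n)) := by
  have h1 : Continuous ((Matrix.toEuclideanCLM (n := Fin n) (𝕜 := ℝ)).symm :
      (Euc n →L[ℝ] Euc n) → Matrix (Fin n) (Fin n) ℝ) := by
    refine continuous_matrix fun i j => ?_
    simp only [toEuclideanCLM_symm_apply]
    fun_prop
  have h2 : Continuous (Matrix.toEuclideanCLM (n := Fin n) (𝕜 := ℝ) :
      Matrix (Fin n) (Fin n) ℝ → (Euc n →L[ℝ] Euc n)) :=
    LinearMap.continuous_of_finiteDimensional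
      ((Matrix.toEuclideanCLM (n := Fin n) (𝕜 := ℝ)).toAlgEquiv.toLinearMap)
  exact h2.comp h1.matrix_adjugate

lemma clm_adjMap_single (f : Euc n →L[ℝ] ℝ) (T : Euc n →L[ℝ] Euc n) (j : Fin n) :
    f (adjMap T (EuclideanSpace.single j 1)) =
      ∑ σ : Equiv.Perm (Fin n), (Equiv.Perm.sign σ : ℝ) * (f (EuclideanSpace.single (σ j) 1) *
        ∏ l ∈ Finset.univ.erase j, T (EuclideanSpace.single (σ l) 1) l) := by
  set A := (Matrix.toEuclideanCLM (n := Fin n) (𝕜 := ℝ)).symm T with hA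
  have h1 : adjMap T (EuclideanSpace.single j 1) =
      ∑ i, (A.adjugate i j) • EuclideanSpace.single i (1 : ℝ) := by
    ext m
    simp [adjMap, ← hA, Matrix.mulVec, dotProduct, Pi.single_apply]
  have h2 : f (adjMap T (EuclideanSpace.single j 1)) =
      (A.updateRow j fun m => f (EuclideanSpace.single m 1)).det := by
    rw [h1, map_sum, Matrix.det_eq_sum_mul_adjugate_row _ j]
    refine Finset.sum_congr rfl fun i _ => ?_
    rw [Matrix.updateRow_self, Matrix.adjugate_apply, Matrix.adjugate_apply,
      Matrix.updateRow_idem, map_smul, smul_eq_mul, mul_comm]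
  rw [h2, ← Matrix.det_transpose, Matrix.det_apply']
  refine Finset.sum_congr rfl fun σ _ => ?_
  rw [← Finset.mul_prod_erase _ _ (Finset.mem_univ j)]
  simp only [Matrix.transpose_apply, Matrix.updateRow_self]
  congr 2
  refine Finset.prod_congr rfl fun l hl => ?_
  rw [Matrix.updateRow_ne (Finset.ne_of_mem_erase hl), hA, toEuclideanCLM_symm_apply]

lemma norm_smul_sub_smul (r : ℝ) (x y : F) : ‖r • x - r • y‖ = |r| * ‖x - y‖ := by
  rw [← smul_sub, norm_smul, Real.norm_eq_abs]

lemma exists_norm_adjMap_le (n : ℕ) :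
    ∃ C : ℝ, 0 ≤ C ∧ ∀ T : Euc n →L[ℝ] Euc n, ‖adjMap T‖ ≤ C * ‖T‖ ^ (n - 1) := by
  obtain ⟨C, hC⟩ := (isCompact_closedBall (0 : Euc n →L[ℝ] Euc n) 1).exists_bound_of_continuousOn
    continuous_adjMap.continuousOn
  refine ⟨C, (norm_nonneg _).trans (hC 0 (by simp)), fun T => ?_⟩
  have h1 : T = ‖T‖ • (‖T‖⁻¹ • T) := by
    rcases eq_or_ne T 0 with rfl | h
    · ext; simp
    · rw [smul_smul, mul_inv_cancel₀ (norm_ne_zero_iff.2 h), one_smul]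
  have h2 : ‖adjMap (‖T‖⁻¹ • T)‖ ≤ C := by
    refine hC _ ?_
    rw [mem_closedBall_zero_iff, norm_smul, norm_inv, norm_norm]
    exact inv_mul_le_one
  calc ‖adjMap T‖ = ‖T‖ ^ (n - 1) * ‖adjMap (‖T‖⁻¹ • T)‖ := by
        conv_lhs => rw [h1]
        rw [adjMap_smul, norm_smul, norm_pow, norm_norm]
    _ ≤ ‖T‖ ^ (n - 1) * C := by gcongr
    _ = _ := mul_comm _ _

lemma exists_norm_adjMap_sub_le (n : ℕ) {ε : ℝ} (hε : 0 < ε) :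
    ∃ C : ℝ, 0 ≤ C ∧ ∀ S T : Euc n →L[ℝ] Euc n,
      ‖adjMap S - adjMap T‖ ≤ ε * ‖T‖ ^ (n - 1) + C * ‖S - T‖ ^ (n - 1) := by
  obtain ⟨C₀, hC₀, hb⟩ := exists_norm_adjMap_le n
  have huc := (isCompact_closedBall (0 : Euc n →L[ℝ] Euc n) 2).uniformContinuousOn_of_continuous
    continuous_adjMap.continuousOn
  obtain ⟨δ, hδ, hd⟩ := Metric.uniformContinuousOn_iff_le.1 huc ε hε
  set d := min δ 1 with hd'
  have hd0 : 0 < d := lt_min hδ one_pos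
  refine ⟨2 * C₀ * (1 + 1 / d) ^ (n - 1), by positivity, fun S T => ?_⟩
  rcases lt_or_ge (‖S - T‖) (d * ‖T‖) with h | h
  · have hT : 0 < ‖T‖ := by
      by_contra h0
      have : ‖T‖ = 0 := le_antisymm (not_lt.1 h0) (norm_nonneg _)
      rw [this, mul_zero] at h
      exact absurd h (not_lt.2 (norm_nonneg _))
    have hsc : ∀ R : Euc n →L[ℝ] Euc n, adjMap R = ‖T‖ ^ (n - 1) • adjMap (‖T‖⁻¹ • R) := by
      intro R
      rw [← adjMap_smul, smul_smul, mul_inv_cancel₀ hT.ne', one_smul]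
    have hST : ‖‖T‖⁻¹ • S - ‖T‖⁻¹ • T‖ ≤ d := by
      rw [show ‖‖T‖⁻¹ • S - ‖T‖⁻¹ • T‖ = |‖T‖⁻¹| * ‖S - T‖ from norm_smul_sub_smul _ _ _,
        abs_inv, abs_norm, inv_mul_le_iff₀ hT, mul_comm]
      exact h.le
    have hT1 : ‖‖T‖⁻¹ • T‖ = 1 := by
      rw [norm_smul, norm_inv, norm_norm, inv_mul_cancel₀ hT.ne']
    have hS2 : ‖‖T‖⁻¹ • S‖ ≤ 2 := by
      have := norm_le_norm_add_norm_sub (‖T‖⁻¹ • T) (‖T‖⁻¹ • S)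
      rw [norm_sub_rev] at hST
      linarith [min_le_right δ 1]
    have := hd (‖T‖⁻¹ • S) (by simpa using hS2) (‖T‖⁻¹ • T)
      (by rw [mem_closedBall_zero_iff, hT1]; norm_num)
      (by rw [dist_eq_norm]; exact hST.trans (min_le_left _ _))
    rw [dist_eq_norm] at this
    calc ‖adjMap S - adjMap T‖ = ‖T‖ ^ (n - 1) * ‖adjMap (‖T‖⁻¹ • S) - adjMap (‖T‖⁻¹ • T)‖ := by
          rw [hsc S, hsc T]
          refine (norm_smul_sub_smul _ _ _).trans ?_
          rw [abs_pow, abs_norm]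
      _ ≤ ‖T‖ ^ (n - 1) * ε := by gcongr
      _ ≤ _ := by
          rw [mul_comm]
          exact le_add_of_nonneg_right (by positivity)
  · have hT : ‖T‖ ≤ (1 + 1 / d) * ‖S - T‖ := by
      have : ‖T‖ ≤ 1 / d * ‖S - T‖ := by
        rw [one_div, inv_mul_eq_div, le_div_iff₀ hd0, mul_comm]
        exact h
      linarith [norm_nonneg (S - T)]
    have hS : ‖S‖ ≤ (1 + 1 / d) * ‖S - T‖ := by
      have h1 : ‖T‖ ≤ 1 / d * ‖S - T‖ := by
        rw [one_div, inv_mul_eq_div, le_div_iff₀ hd0, mul_comm]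
        exact h
      have h2 := norm_le_norm_add_norm_sub T S
      rw [norm_sub_rev] at h2
      linarith
    have aux : ∀ R : Euc n →L[ℝ] Euc n, ‖R‖ ≤ (1 + 1 / d) * ‖S - T‖ →
        ‖adjMap R‖ ≤ C₀ * ((1 + 1 / d) * ‖S - T‖) ^ (n - 1) := fun R hR =>
      (hb R).trans (by gcongr)
    calc ‖adjMap S - adjMap T‖ ≤ ‖adjMap S‖ + ‖adjMap T‖ := norm_sub_le _ _
      _ ≤ C₀ * ((1 + 1 / d) * ‖S - T‖) ^ (n - 1) + C₀ * ((1 + 1 / d) * ‖S - T‖) ^ (n - 1) :=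
          add_le_add (aux S hS) (aux T hT)
      _ = 2 * C₀ * (1 + 1 / d) ^ (n - 1) * ‖S - T‖ ^ (n - 1) := by rw [mul_pow]; ring
      _ ≤ _ := le_add_of_nonneg_left (by positivity)

lemma tendsto_lintegral_adjMap_sub {μ : Measure (Euc n)} {S : ℕ → Euc n → Euc n →L[ℝ] Euc n}
    {D : Euc n → Euc n →L[ℝ] Euc n} (hS : ∀ k, Measurable (S k)) (hD : Measurable D)
    (hDq : ∫⁻ x, ‖D x‖ₑ ^ (n - 1) ∂μ ≠ ∞)
    (h : Tendsto (fun k => ∫⁻ x, ‖S k x - D x‖ₑ ^ (n - 1) ∂μ) atTop (nhds 0)) :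
    Tendsto (fun k => ∫⁻ x, ‖adjMap (S k x) - adjMap (D x)‖ₑ ∂μ) atTop (nhds 0) := by
  set I := ∫⁻ x, ‖D x‖ₑ ^ (n - 1) ∂μ with hI
  have key : ∀ ε : ℝ, 0 < ε → ∃ C : ℝ, ∀ k, ∫⁻ x, ‖adjMap (S k x) - adjMap (D x)‖ₑ ∂μ ≤
      ENNReal.ofReal ε * I + ENNReal.ofReal C * ∫⁻ x, ‖S k x - D x‖ₑ ^ (n - 1) ∂μ := by
    intro ε hε
    obtain ⟨C, hC0, hC⟩ := exists_norm_adjMap_sub_le n hε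
    refine ⟨C, fun k => ?_⟩
    have m1 : Measurable fun x => ENNReal.ofReal ε * ‖D x‖ₑ ^ (n - 1) :=
      (hD.enorm.pow_const _).const_mul _
    have m2 : Measurable fun x => ‖S k x - D x‖ₑ ^ (n - 1) := by
      have : Measurable fun x => S k x - D x := (hS k).sub hD
      exact this.enorm.pow_const _
    rw [hI, ← lintegral_const_mul _ (hD.enorm.pow_const _), ← lintegral_const_mul _ m2,
      ← lintegral_add_left m1]
    refine lintegral_mono fun x => ?_
    simp only [← ofReal_norm]
    rw [← ENNReal.ofReal_pow (norm_nonneg _), ← ENNReal.ofReal_pow (norm_nonneg _),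
      ← ENNReal.ofReal_mul hε.le, ← ENNReal.ofReal_mul hC0,
      ← ENNReal.ofReal_add (by positivity) (by positivity)]
    exact ENNReal.ofReal_le_ofReal (hC _ _)
  rw [ENNReal.tendsto_nhds_zero]
  intro r hr
  obtain ⟨ε, hε, hεr⟩ : ∃ ε : ℝ, 0 < ε ∧ ENNReal.ofReal ε * I ≤ r / 2 := by
    have h1 : Tendsto (fun ε : ℝ => ENNReal.ofReal ε * I) (nhdsWithin 0 (Ioi 0)) (nhds 0) := by
      have := ENNReal.Tendsto.mul_const (b := I)
        ((ENNReal.continuous_ofReal.tendsto 0).mono_left (nhdsWithin_le_nhds (s := Ioi 0)))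
        (Or.inr hDq)
      simpa using this
    have h2 := (h1.eventually (Iic_mem_nhds (ENNReal.half_pos hr.ne'))).and
      self_mem_nhdsWithin
    obtain ⟨ε, h3, h4⟩ := h2.exists
    exact ⟨ε, h4, h3⟩
  obtain ⟨C, hC⟩ := key ε hε
  have h1 : Tendsto (fun k => ENNReal.ofReal C * ∫⁻ x, ‖S k x - D x‖ₑ ^ (n - 1) ∂μ) atTop
      (nhds 0) := by
    simpa using ENNReal.Tendsto.const_mul h (Or.inr ENNReal.ofReal_ne_top)
  filter_upwards [h1.eventually (Iic_mem_nhds (ENNReal.half_pos hr.ne'))] with k hk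
  exact (hC k).trans ((add_le_add hεr hk).trans (ENNReal.add_halves r).le)

lemma sum_perm_eq_zero_of_swap {ι : Type*} [Fintype ι] [DecidableEq ι] (j k : ι) (hjk : j ≠ k)
    (g : Equiv.Perm ι → ℝ) (hg : ∀ σ, g (σ * Equiv.swap j k) = g σ) :
    ∑ σ : Equiv.Perm ι, (Equiv.Perm.sign σ : ℝ) * g σ = 0 := by
  have h := Equiv.sum_comp (Equiv.mulRight (Equiv.swap j k))
    fun σ : Equiv.Perm ι => (Equiv.Perm.sign σ : ℝ) * g σ
  simp only [Equiv.coe_mulRight, hg, map_mul, Equiv.Perm.sign_swap hjk] at h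
  simp only [mul_neg, mul_one, Units.val_neg, Int.cast_neg, neg_mul, Finset.sum_neg_distrib] at h
  linarith

lemma sum_sign_mul_fderiv_cofactor_eq_zero {Φ : Euc n → Euc n} (hΦ : ContDiff ℝ (⊤ : ℕ∞) Φ)
    (j : Fin n) (x : Euc n) :
    ∑ σ : Equiv.Perm (Fin n), (Equiv.Perm.sign σ : ℝ) *
      fderiv ℝ (fun x => ∏ l ∈ Finset.univ.erase j,
        fderiv ℝ Φ x (EuclideanSpace.single (σ l) 1) l) x (EuclideanSpace.single (σ j) 1) = 0 := by
  have hsymm : ∀ v w : Euc n, fderiv ℝ (fderiv ℝ Φ) x v w = fderiv ℝ (fderiv ℝ Φ) x w v := by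
    have : IsSymmSndFDerivAt ℝ Φ x := hΦ.contDiffAt.isSymmSndFDerivAt (by
      simp only [minSmoothness_of_isRCLikeNormedField]
      exact WithTop.coe_le_coe.2 (le_top : (2 : ℕ∞) ≤ ⊤))
    exact fun v w => this v w
  have hd : ∀ (m l : Fin n), HasFDerivAt (fun x => fderiv ℝ Φ x (EuclideanSpace.single m 1) l)
      ((EuclideanSpace.proj l : Euc n →L[ℝ] ℝ).comp
        ((fderiv ℝ (fderiv ℝ Φ) x).flip (EuclideanSpace.single m 1))) x := by
    intro m l
    have h1 : HasFDerivAt (fderiv ℝ Φ) (fderiv ℝ (fderiv ℝ Φ) x) x :=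
      ((hΦ.fderiv_right (m := (⊤ : ℕ∞)) (by simp)).differentiable (by simp) x).hasFDerivAt
    have h2 := (ContinuousLinearMap.apply ℝ (Euc n) (EuclideanSpace.single m (1 : ℝ))).hasFDerivAt.comp x h1
    exact (EuclideanSpace.proj l : Euc n →L[ℝ] ℝ).hasFDerivAt.comp x h2
  have h1 : ∀ σ : Equiv.Perm (Fin n), fderiv ℝ (fun x => ∏ l ∈ Finset.univ.erase j,
        fderiv ℝ Φ x (EuclideanSpace.single (σ l) 1) l) x (EuclideanSpace.single (σ j) 1) =
      ∑ k ∈ Finset.univ.erase j, (∏ l ∈ (Finset.univ.erase j).erase k,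
        fderiv ℝ Φ x (EuclideanSpace.single (σ l) 1) l) *
        fderiv ℝ (fderiv ℝ Φ) x (EuclideanSpace.single (σ j) 1)
          (EuclideanSpace.single (σ k) 1) k := by
    intro σ
    rw [(HasFDerivAt.finsetProd fun l _ => hd (σ l) l).fderiv]
    simp
  simp only [h1, Finset.mul_sum]
  rw [Finset.sum_comm]
  refine Finset.sum_eq_zero fun k hk => ?_
  have hkj : k ≠ j := Finset.ne_of_mem_erase hk
  refine sum_perm_eq_zero_of_swap j k hkj.symm (fun σ => (∏ l ∈ (Finset.univ.erase j).erase k,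
        fderiv ℝ Φ x (EuclideanSpace.single (σ l) 1) l) *
        fderiv ℝ (fderiv ℝ Φ) x (EuclideanSpace.single (σ j) 1)
          (EuclideanSpace.single (σ k) 1) k) fun σ => ?_
  simp only [Equiv.Perm.coe_mul, Function.comp_apply, Equiv.swap_apply_left,
    Equiv.swap_apply_right]
  rw [hsymm]
  congr 1
  refine Finset.prod_congr rfl fun l hl => ?_
  rw [Equiv.swap_apply_of_ne_of_ne (Finset.ne_of_mem_erase (Finset.mem_of_mem_erase hl))
    (Finset.ne_of_mem_erase hl)]

lemma contDiff_fderiv_clm_apply_const {Φ : Euc n → F} (hΦ : ContDiff ℝ (⊤ : ℕ∞) Φ) (v : Euc n) :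
    ContDiff ℝ (⊤ : ℕ∞) fun x => fderiv ℝ Φ x v :=
  (hΦ.fderiv_right (m := (⊤ : ℕ∞)) (by simp)).clm_apply contDiff_const

/-- The rows of the adjugate of a smooth Jacobian matrix are divergence free. -/
lemma ContDiff.integral_fderiv_adjMap_eq_zero {f : Euc n → ℝ} {Φ : Euc n → Euc n}
    (hf : ContDiff ℝ (⊤ : ℕ∞) f) (hc : HasCompactSupport f) (hΦ : ContDiff ℝ (⊤ : ℕ∞) Φ)
    (v : Euc n) : ∫ x, fderiv ℝ f x (adjMap (fderiv ℝ Φ x) v) = 0 := by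
  have hcont : Continuous (fderiv ℝ f) := hf.continuous_fderiv (by simp)
  have hcontΦ : Continuous (fderiv ℝ Φ) := hΦ.continuous_fderiv (by simp)
  have hitg : ∀ v, Integrable fun x => fderiv ℝ f x (adjMap (fderiv ℝ Φ x) v) := by
    intro v
    refine Continuous.integrable_of_hasCompactSupport
      (hcont.clm_apply ((continuous_adjMap.comp hcontΦ).clm_apply continuous_const)) ?_
    exact (hc.fderiv ℝ).mono fun x hx h0 => hx (by simp [h0])
  have hbasis : ∀ j : Fin n,
      ∫ x, fderiv ℝ f x (adjMap (fderiv ℝ Φ x) (EuclideanSpace.single j 1)) = 0 := by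
    intro j
    set p : Equiv.Perm (Fin n) → Euc n → ℝ := fun σ x => ∏ l ∈ Finset.univ.erase j,
      fderiv ℝ Φ x (EuclideanSpace.single (σ l) 1) l with hp
    have hpC : ∀ σ, ContDiff ℝ (⊤ : ℕ∞) (p σ) := by
      intro σ
      refine contDiff_prod fun l _ => ?_
      exact (EuclideanSpace.proj l : Euc n →L[ℝ] ℝ).contDiff.comp (contDiff_fderiv_clm_apply_const hΦ _)
    simp only [clm_adjMap_single]
    have i1 : ∀ σ : Equiv.Perm (Fin n),
        Integrable fun x => fderiv ℝ f x (EuclideanSpace.single (σ j) 1) * p σ x := by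
      intro σ
      refine Continuous.integrable_of_hasCompactSupport
        ((hcont.clm_apply continuous_const).mul (hpC σ).continuous) ?_
      exact (hc.fderiv ℝ).mono fun x hx h0 => hx (by simp [h0])
    have i2 : ∀ σ : Equiv.Perm (Fin n),
        Integrable fun x => f x * fderiv ℝ (p σ) x (EuclideanSpace.single (σ j) 1) := fun σ =>
      Continuous.integrable_of_hasCompactSupport
        (hf.continuous.mul (((hpC σ).continuous_fderiv (by simp)).clm_apply continuous_const))
        hc.mul_right
    rw [integral_finsetSum _ fun σ _ => (i1 σ).const_mul _]
    have h1 : ∀ σ : Equiv.Perm (Fin n),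
        ∫ x, (Equiv.Perm.sign σ : ℝ) * (fderiv ℝ f x (EuclideanSpace.single (σ j) 1) * p σ x) =
        - ∫ x, (Equiv.Perm.sign σ : ℝ) *
          (f x * fderiv ℝ (p σ) x (EuclideanSpace.single (σ j) 1)) := by
      intro σ
      rw [integral_const_mul, integral_const_mul, ← mul_neg]
      congr 1
      exact ContDiff.integral_fderiv_smul_eq (hf.of_le (by simp)) hc ((hpC σ).of_le (by simp)) _
    rw [Finset.sum_congr rfl fun σ _ => h1 σ, Finset.sum_neg_distrib,
      ← integral_finsetSum _ fun σ _ => (i2 σ).const_mul _, neg_eq_zero]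
    refine integral_eq_zero_of_ae (Eventually.of_forall fun x => ?_)
    have h2 := sum_sign_mul_fderiv_cofactor_eq_zero hΦ j x
    calc _ = f x * ∑ σ : Equiv.Perm (Fin n), (Equiv.Perm.sign σ : ℝ) *
          fderiv ℝ (p σ) x (EuclideanSpace.single (σ j) 1) := by
          rw [Finset.mul_sum]
          exact Finset.sum_congr rfl fun σ _ => by ring
      _ = 0 := by rw [h2, mul_zero]
  have hv : v = ∑ j, v j • EuclideanSpace.single j (1 : ℝ) := by
    ext i
    simp [Pi.single_apply]
  rw [hv]
  simp only [map_sum, map_smul]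
  have hi : ∀ j ∈ Finset.univ, Integrable fun x => v j •
      fderiv ℝ f x (adjMap (fderiv ℝ Φ x) (EuclideanSpace.single j 1)) :=
    fun j _ => (hitg _).smul (v j)
  rw [integral_finsetSum _ hi]
  refine Finset.sum_eq_zero fun j _ => ?_
  rw [integral_smul, hbasis, smul_zero]

/-- The integral `∫ ζ (H ∘ Φ) det DΦ`. -/
def degInt (ζ : Euc n → ℝ) (Φ : Euc n → Euc n) (H : Euc n → ℝ) : ℝ :=
  ∫ x, ζ x * H (Φ x) * jacobian (fderiv ℝ Φ) x

lemma continuous_jacobian_fderiv {Φ : Euc n → Euc n} (hΦ : ContDiff ℝ (⊤ : ℕ∞) Φ) :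
    Continuous (jacobian (fderiv ℝ Φ)) :=
  ContinuousLinearMap.continuous_det.comp (hΦ.continuous_fderiv (by simp))

lemma integrable_degInt {ζ : Euc n → ℝ} {Φ : Euc n → Euc n} {H : Euc n → ℝ}
    (hζ : Continuous ζ) (hc : HasCompactSupport ζ) (hΦ : ContDiff ℝ (⊤ : ℕ∞) Φ)
    (hH : Continuous H) : Integrable fun x => ζ x * H (Φ x) * jacobian (fderiv ℝ Φ) x :=
  Continuous.integrable_of_hasCompactSupport
    ((hζ.mul (hH.comp hΦ.continuous)).mul (continuous_jacobian_fderiv hΦ)) hc.mul_right.mul_right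

lemma integrable_mul_fderiv_adjMap {ζ g : Euc n → ℝ} {Φ : Euc n → Euc n}
    (hζ : ContDiff ℝ (⊤ : ℕ∞) ζ) (hc : HasCompactSupport ζ) (hΦ : ContDiff ℝ (⊤ : ℕ∞) Φ)
    (hg : Continuous g) (v : Euc n) :
    Integrable fun x => g x * fderiv ℝ ζ x (adjMap (fderiv ℝ Φ x) v) := by
  refine Continuous.integrable_of_hasCompactSupport (hg.mul ((hζ.continuous_fderiv
    (by simp)).clm_apply ((continuous_adjMap.comp (hΦ.continuous_fderiv
      (by simp))).clm_apply continuous_const))) ?_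
  exact (hc.fderiv ℝ).mono fun x hx h0 => hx (by simp [h0])

lemma degInt_fderiv {ζ η : Euc n → ℝ} {Φ : Euc n → Euc n} (hζ : ContDiff ℝ (⊤ : ℕ∞) ζ)
    (hc : HasCompactSupport ζ) (hη : ContDiff ℝ (⊤ : ℕ∞) η) (hΦ : ContDiff ℝ (⊤ : ℕ∞) Φ)
    (v : Euc n) :
    degInt ζ Φ (fun y => fderiv ℝ η y v) =
      - ∫ x, η (Φ x) * fderiv ℝ ζ x (adjMap (fderiv ℝ Φ x) v) := by
  have h := ContDiff.integral_fderiv_adjMap_eq_zero (hζ.mul (hη.comp hΦ)) hc.mul_right hΦ v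
  have h1 : ∀ x, fderiv ℝ (fun x => ζ x * (η ∘ Φ) x) x (adjMap (fderiv ℝ Φ x) v) =
      ζ x * fderiv ℝ η (Φ x) v * jacobian (fderiv ℝ Φ) x +
        η (Φ x) * fderiv ℝ ζ x (adjMap (fderiv ℝ Φ x) v) := by
    intro x
    have d1 : DifferentiableAt ℝ ζ x := hζ.differentiable (by simp) x
    have d2 : DifferentiableAt ℝ (η ∘ Φ) x := (hη.comp hΦ).differentiable (by simp) x
    rw [fderiv_fun_mul d1 d2, fderiv_comp x (hη.differentiable (by simp) _)
      (hΦ.differentiable (by simp) x)]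
    simp only [add_apply, smul_apply, smul_eq_mul,
      ContinuousLinearMap.comp_apply, apply_adjMap, map_smul, Function.comp_apply, jacobian]
    ring
  rw [integral_congr_ae (Eventually.of_forall h1), integral_add] at h
  · rw [degInt]
    linarith
  · exact integrable_degInt hζ.continuous hc hΦ
      ((hη.continuous_fderiv (by simp)).clm_apply continuous_const)
  · exact integrable_mul_fderiv_adjMap hζ hc hΦ (hη.continuous.comp hΦ.continuous) v

lemma hasFDerivAt_integral_mul_comp_sub {a κ : Euc n → ℝ} {Φ : Euc n → Euc n}
    (ha : Continuous a) (hac : HasCompactSupport a) (hΦ : Continuous Φ) (hκ : ContDiff ℝ 1 κ)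
    (hκc : HasCompactSupport κ) (y : Euc n) :
    HasFDerivAt (fun y => ∫ x, a x * κ (Φ x - y)) (∫ x, -(a x) • fderiv ℝ κ (Φ x - y)) y := by
  have hκ' : Continuous (fderiv ℝ κ) := hκ.continuous_fderiv (by simp)
  obtain ⟨C, hC⟩ := hκ'.bounded_above_of_compact_support (hκc.fderiv ℝ)
  refine hasFDerivAt_integral_of_dominated_of_fderiv_le (bound := fun x => ‖a x‖ * C)
    (s := univ) univ_mem
    (F' := fun y x => -(a x) • fderiv ℝ κ (Φ x - y)) ?_ ?_ ?_ ?_ ?_ ?_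
  · exact Eventually.of_forall fun y =>
      (ha.mul (hκ.continuous.comp (hΦ.sub continuous_const))).aestronglyMeasurable
  · exact Continuous.integrable_of_hasCompactSupport
      (ha.mul (hκ.continuous.comp (hΦ.sub continuous_const))) hac.mul_right
  · exact (ha.neg.smul (hκ'.comp (hΦ.sub continuous_const))).aestronglyMeasurable
  · refine Eventually.of_forall fun x y _ => ?_
    rw [norm_smul, norm_neg]
    gcongr
    exact hC _
  · exact (Continuous.integrable_of_hasCompactSupport ha hac).norm.mul_const C
  · refine Eventually.of_forall fun x y _ => ?_
    have h1 : HasFDerivAt (fun y => Φ x - y) (-ContinuousLinearMap.id ℝ (Euc n)) y :=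
      (hasFDerivAt_id y).const_sub (Φ x)
    have h2 := (((hκ.differentiable (by simp) (Φ x - y)).hasFDerivAt).comp y h1).const_mul (a x)
    refine h2.congr_fderiv ?_
    ext v
    simp

lemma contDiff_integral_mul_comp_sub {a κ : Euc n → ℝ} {Φ : Euc n → Euc n}
    (ha : Continuous a) (hac : HasCompactSupport a) (hΦ : Continuous Φ) (hκ : ContDiff ℝ 1 κ)
    (hκc : HasCompactSupport κ) : ContDiff ℝ 1 (fun y => ∫ x, a x * κ (Φ x - y)) := by
  have hd := hasFDerivAt_integral_mul_comp_sub ha hac hΦ hκ hκc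
  have hκ' : Continuous (fderiv ℝ κ) := hκ.continuous_fderiv (by simp)
  obtain ⟨C, hC⟩ := hκ'.bounded_above_of_compact_support (hκc.fderiv ℝ)
  rw [contDiff_one_iff_fderiv]
  refine ⟨fun y => (hd y).differentiableAt, ?_⟩
  rw [show fderiv ℝ (fun y => ∫ x, a x * κ (Φ x - y)) =
    fun y => ∫ x, -(a x) • fderiv ℝ κ (Φ x - y) from funext fun y => (hd y).fderiv]
  refine continuous_of_dominated (bound := fun x => ‖a x‖ * C) ?_ ?_ ?_ ?_
  · exact fun y => (ha.neg.smul (hκ'.comp (hΦ.sub continuous_const))).aestronglyMeasurable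
  · refine fun y => Eventually.of_forall fun x => ?_
    rw [norm_smul, norm_neg]
    gcongr
    exact hC _
  · exact (Continuous.integrable_of_hasCompactSupport ha hac).norm.mul_const C
  · refine Eventually.of_forall fun x => ?_
    have : Continuous fun y => fderiv ℝ κ (Φ x - y) := hκ'.comp (continuous_sub_left _)
    exact this.const_smul (-(a x))

lemma hasCompactSupport_integral_mul_comp_sub {a κ : Euc n → ℝ} {Φ : Euc n → Euc n}
    (hac : HasCompactSupport a) (hΦ : Continuous Φ) (hκc : HasCompactSupport κ) :
    HasCompactSupport (fun y => ∫ x, a x * κ (Φ x - y)) := by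
  refine HasCompactSupport.of_support_subset_isCompact
    (((hac.isCompact.image hΦ).prod hκc.isCompact).image continuous_sub) fun y hy => ?_
  obtain ⟨x, hx⟩ : ∃ x, a x * κ (Φ x - y) ≠ 0 := by
    by_contra! h
    exact hy (by simp [h])
  exact ⟨(Φ x, Φ x - y), ⟨⟨x, subset_tsupport _ (left_ne_zero_of_mul hx), rfl⟩,
    subset_tsupport _ (right_ne_zero_of_mul hx)⟩, sub_sub_cancel _ _⟩

/-- The smoothed degree density of `Φ` with weight `ζ`. -/
def degDensity (k : ℕ) (ζ : Euc n → ℝ) (Φ : Euc n → Euc n) (y : Euc n) : ℝ :=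
  ∫ x, ζ x * jacobian (fderiv ℝ Φ) x * mollKernel n k (Φ x - y)

lemma contDiff_degDensity (k : ℕ) {ζ : Euc n → ℝ} {Φ : Euc n → Euc n} (hζ : Continuous ζ)
    (hc : HasCompactSupport ζ) (hΦ : ContDiff ℝ (⊤ : ℕ∞) Φ) :
    ContDiff ℝ 1 (degDensity k ζ Φ) :=
  contDiff_integral_mul_comp_sub (hζ.mul (continuous_jacobian_fderiv hΦ)) hc.mul_right
    hΦ.continuous ((contDiff_mollKernel k).of_le (by simp)) (hasCompactSupport_mollKernel k)

lemma hasCompactSupport_degDensity (k : ℕ) {ζ : Euc n → ℝ} {Φ : Euc n → Euc n}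
    (hc : HasCompactSupport ζ) (hΦ : ContDiff ℝ (⊤ : ℕ∞) Φ) :
    HasCompactSupport (degDensity k ζ Φ) :=
  hasCompactSupport_integral_mul_comp_sub hc.mul_right hΦ.continuous
    (hasCompactSupport_mollKernel k)

lemma fderiv_degDensity (k : ℕ) {ζ : Euc n → ℝ} {Φ : Euc n → Euc n}
    (hζ : ContDiff ℝ (⊤ : ℕ∞) ζ) (hc : HasCompactSupport ζ) (hΦ : ContDiff ℝ (⊤ : ℕ∞) Φ)
    (y v : Euc n) : fderiv ℝ (degDensity k ζ Φ) y v =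
      ∫ x, mollKernel n k (Φ x - y) * fderiv ℝ ζ x (adjMap (fderiv ℝ Φ x) v) := by
  have ha : Continuous fun x => ζ x * jacobian (fderiv ℝ Φ) x :=
    hζ.continuous.mul (continuous_jacobian_fderiv hΦ)
  have hκ' : Continuous (fderiv ℝ (mollKernel n k)) :=
    (contDiff_mollKernel k).continuous_fderiv (by simp)
  have h1 : fderiv ℝ (degDensity k ζ Φ) y = _ :=
    (hasFDerivAt_integral_mul_comp_sub ha hc.mul_right hΦ.continuous
    ((contDiff_mollKernel k).of_le (by simp)) (hasCompactSupport_mollKernel k) y).fderiv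
  have hη : ContDiff ℝ (⊤ : ℕ∞) fun z => mollKernel n k (z - y) :=
    (contDiff_mollKernel k).comp (contDiff_id.sub contDiff_const)
  have h2 := degInt_fderiv hζ hc hη hΦ v
  rw [h1, ContinuousLinearMap.integral_apply, ← neg_eq_iff_eq_neg.2 h2, degInt, ← integral_neg]
  · refine integral_congr_ae (Eventually.of_forall fun x => ?_)
    simp only [fderiv_comp_sub, smul_apply, smul_eq_mul]
    ring
  · exact Continuous.integrable_of_hasCompactSupport
      (ha.neg.smul (hκ'.comp (hΦ.continuous.sub continuous_const))) hc.mul_right.neg.smul_right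

lemma mollify_eq_integral_mul (k : ℕ) (H : Euc n → ℝ) (z : Euc n) :
    mollify k H z = ∫ y, mollKernel n k (z - y) * H y := by
  rw [mollify, ← integral_sub_left_eq_self _ volume z]
  simp

lemma norm_mollify_le (k : ℕ) {H : Euc n → ℝ} {C : ℝ} (hC : ∀ y, ‖H y‖ ≤ C) (z : Euc n) :
    ‖mollify k H z‖ ≤ C := by
  calc ‖mollify k H z‖ ≤ ∫ t, mollKernel n k t * C := by
        refine norm_integral_le_of_norm_le ((integrable_mollKernel k).mul_const C)
          (Eventually.of_forall fun t => ?_)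
        rw [norm_smul, Real.norm_eq_abs, abs_of_nonneg (mollKernel_nonneg k t)]
        exact mul_le_mul_of_nonneg_left (hC _) (mollKernel_nonneg k t)
    _ = C := by rw [integral_mul_const, integral_mollKernel, one_mul]

lemma integral_degDensity_mul (k : ℕ) {ζ H : Euc n → ℝ} {Φ : Euc n → Euc n}
    (hζ : Continuous ζ) (hc : HasCompactSupport ζ) (hΦ : ContDiff ℝ (⊤ : ℕ∞) Φ)
    (hH : Continuous H) (hHc : HasCompactSupport H) :
    ∫ y, degDensity k ζ Φ y * H y =
      ∫ x, ζ x * jacobian (fderiv ℝ Φ) x * mollify k H (Φ x) := by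
  have hJ := continuous_jacobian_fderiv hΦ
  have hκ : Continuous (mollKernel n k) := (contDiff_mollKernel k).continuous
  simp only [degDensity, ← integral_mul_const]
  rw [integral_integral_swap_of_hasCompactSupport]
  · refine integral_congr_ae (Eventually.of_forall fun x => ?_)
    simp only [mollify_eq_integral_mul, ← integral_const_mul, mul_assoc]
  · have h1 := hΦ.continuous
    simp only [Function.uncurry_def]
    fun_prop
  · refine HasCompactSupport.of_support_subset_isCompact (hHc.isCompact.prod hc.isCompact) ?_
    rintro ⟨y, x⟩ hxy
    have h1 : ζ x * jacobian (fderiv ℝ Φ) x * mollKernel n k (Φ x - y) * H y ≠ 0 := hxy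
    exact ⟨subset_tsupport _ (right_ne_zero_of_mul h1), subset_tsupport _
      (left_ne_zero_of_mul (left_ne_zero_of_mul (left_ne_zero_of_mul h1)))⟩

lemma tendsto_integral_degDensity_mul {ζ H : Euc n → ℝ} {Φ : Euc n → Euc n}
    (hζ : Continuous ζ) (hc : HasCompactSupport ζ) (hΦ : ContDiff ℝ (⊤ : ℕ∞) Φ)
    (hH : Continuous H) (hHc : HasCompactSupport H) :
    Tendsto (fun k => ∫ y, degDensity k ζ Φ y * H y) atTop (nhds (degInt ζ Φ H)) := by
  obtain ⟨C, hC⟩ := hH.bounded_above_of_compact_support hHc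
  have hloc : LocallyIntegrable H := hH.locallyIntegrable
  have ha : Continuous fun x => ζ x * jacobian (fderiv ℝ Φ) x :=
    hζ.mul (continuous_jacobian_fderiv hΦ)
  simp only [integral_degDensity_mul _ hζ hc hΦ hH hHc]
  refine tendsto_integral_of_dominated_convergence
    (fun x => ‖ζ x * jacobian (fderiv ℝ Φ) x‖ * C) (fun k => ?_) ?_ (fun k => ?_) ?_
  · exact (ha.mul ((contDiff_mollify k hloc).continuous.comp hΦ.continuous)).aestronglyMeasurable
  · exact (Continuous.integrable_of_hasCompactSupport ha hc.mul_right).norm.mul_const C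
  · refine Eventually.of_forall fun x => ?_
    rw [norm_mul]
    gcongr
    exact norm_mollify_le k hC _
  · refine Eventually.of_forall fun x => ?_
    have h1 : Tendsto (fun k => mollify k H (Φ x)) atTop (nhds (H (Φ x))) :=
      ContDiffBump.convolution_tendsto_right_of_continuous (φ := mollifier n)
        tendsto_one_div_nat_add_one hH (Φ x)
    have h2 := h1.const_mul (ζ x * jacobian (fderiv ℝ Φ) x)
    rwa [mul_right_comm] at h2

lemma lintegral_fderiv_degDensity_le (k : ℕ) {ζ : Euc n → ℝ} {Φ : Euc n → Euc n}
    (hζ : ContDiff ℝ (⊤ : ℕ∞) ζ) (hc : HasCompactSupport ζ) (hΦ : ContDiff ℝ (⊤ : ℕ∞) Φ) :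
    ∫⁻ y, ‖fderiv ℝ (degDensity k ζ Φ) y‖ₑ ≤
      ∫⁻ x, ‖fderiv ℝ ζ x‖ₑ * ‖adjMap (fderiv ℝ Φ x)‖ₑ := by
  have hκ : Continuous (mollKernel n k) := (contDiff_mollKernel k).continuous
  have hA : Continuous fun x => adjMap (fderiv ℝ Φ x) :=
    continuous_adjMap.comp (hΦ.continuous_fderiv (by simp))
  have hζ' : Continuous (fderiv ℝ ζ) := hζ.continuous_fderiv (by simp)
  have hb : ∀ y, ‖fderiv ℝ (degDensity k ζ Φ) y‖ ≤
      ∫ x, mollKernel n k (Φ x - y) * (‖fderiv ℝ ζ x‖ * ‖adjMap (fderiv ℝ Φ x)‖) := by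
    intro y
    have hi : Integrable fun x =>
        mollKernel n k (Φ x - y) * (‖fderiv ℝ ζ x‖ * ‖adjMap (fderiv ℝ Φ x)‖) := by
      refine Continuous.integrable_of_hasCompactSupport
        ((hκ.comp (hΦ.continuous.sub continuous_const)).mul (hζ'.norm.mul hA.norm)) ?_
      exact (hc.fderiv ℝ).mono fun x hx h0 => hx (by simp [h0])
    refine ContinuousLinearMap.opNorm_le_bound _ (integral_nonneg fun x =>
      mul_nonneg (mollKernel_nonneg _ _) (by positivity)) fun v => ?_
    rw [fderiv_degDensity k hζ hc hΦ, ← integral_mul_const]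
    refine norm_integral_le_of_norm_le (hi.mul_const _) (Eventually.of_forall fun x => ?_)
    rw [norm_mul, Real.norm_eq_abs, abs_of_nonneg (mollKernel_nonneg _ _), mul_assoc, mul_assoc]
    refine mul_le_mul_of_nonneg_left ?_ (mollKernel_nonneg _ _)
    refine ((fderiv ℝ ζ x).le_opNorm _).trans ?_
    gcongr
    exact (adjMap (fderiv ℝ Φ x)).le_opNorm v
  have m1 : Measurable fun p : Euc n × Euc n => ENNReal.ofReal (mollKernel n k (Φ p.2 - p.1)) *
      (‖fderiv ℝ ζ p.2‖ₑ * ‖adjMap (fderiv ℝ Φ p.2)‖ₑ) := by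
    have h1 : Measurable fun p : Euc n × Euc n => mollKernel n k (Φ p.2 - p.1) := by
      have := hΦ.continuous
      exact Continuous.measurable (by fun_prop)
    have h2 : Measurable fun p : Euc n × Euc n => ‖fderiv ℝ ζ p.2‖ₑ :=
      (hζ'.measurable.comp measurable_snd).enorm
    have h3 : Measurable fun p : Euc n × Euc n => ‖adjMap (fderiv ℝ Φ p.2)‖ₑ :=
      (hA.measurable.comp measurable_snd).enorm
    exact h1.ennreal_ofReal.mul (h2.mul h3)
  calc ∫⁻ y, ‖fderiv ℝ (degDensity k ζ Φ) y‖ₑ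
      ≤ ∫⁻ y, ∫⁻ x, ENNReal.ofReal (mollKernel n k (Φ x - y)) *
        (‖fderiv ℝ ζ x‖ₑ * ‖adjMap (fderiv ℝ Φ x)‖ₑ) := by
        refine lintegral_mono fun y => ?_
        rw [← ofReal_norm]
        refine (ENNReal.ofReal_le_ofReal (hb y)).trans ((Real.ofReal_le_enorm _).trans
          ((enorm_integral_le_lintegral_enorm _).trans (lintegral_mono fun x => ?_)))
        rw [enorm_mul, enorm_mul, enorm_norm, enorm_norm,
          Real.enorm_of_nonneg (mollKernel_nonneg _ _)]
    _ = ∫⁻ x, ∫⁻ y, ENNReal.ofReal (mollKernel n k (Φ x - y)) *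
        (‖fderiv ℝ ζ x‖ₑ * ‖adjMap (fderiv ℝ Φ x)‖ₑ) := by
        exact lintegral_lintegral_swap m1.aemeasurable
    _ = _ := by
        refine lintegral_congr fun x => ?_
        rw [lintegral_mul_const]
        · rw [lintegral_sub_left_eq_self (fun t => ENNReal.ofReal (mollKernel n k t)) (Φ x),
            lintegral_mollKernel, one_mul]
        · exact (hκ.comp (continuous_const.sub continuous_id)).measurable.ennreal_ofReal

lemma exists_enorm_degInt_le (hn : 2 ≤ n) : ∃ C : ℝ≥0∞, C ≠ ∞ ∧
    ∀ {ζ H : Euc n → ℝ} {Φ : Euc n → Euc n}, ContDiff ℝ (⊤ : ℕ∞) ζ → HasCompactSupport ζ →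
      ContDiff ℝ (⊤ : ℕ∞) Φ → Continuous H → HasCompactSupport H →
      ‖degInt ζ Φ H‖ₑ ≤ C * (∫⁻ y, ‖H y‖ₑ ^ (n : ℝ)) ^ (1 / (n : ℝ)) *
        ∫⁻ x, ‖fderiv ℝ ζ x‖ₑ * ‖adjMap (fderiv ℝ Φ x)‖ₑ := by
  have hn' : (1 : ℝ) < n := by exact_mod_cast hn
  set p := Real.conjExponent (n : ℝ) with hp
  have hpq : Real.HolderConjugate (n : ℝ) p := Real.HolderConjugate.conjExponent hn'
  have hpq' : Real.HolderConjugate (Module.finrank ℝ (Euc n)) p := by simpa using hpq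
  set A := lintegralPowLePowLIntegralFDerivConst (volume : Measure (Euc n)) p
  refine ⟨(A : ℝ≥0∞) ^ (1 / p), ENNReal.rpow_ne_top_of_nonneg
    (one_div_nonneg.2 hpq.symm.nonneg) ENNReal.coe_ne_top, ?_⟩
  intro ζ H Φ hζ hc hΦ hH hHc
  set I := ∫⁻ x, ‖fderiv ℝ ζ x‖ₑ * ‖adjMap (fderiv ℝ Φ x)‖ₑ
  refine le_of_tendsto (tendsto_integral_degDensity_mul hζ.continuous hc hΦ hH hHc).enorm
    (Eventually.of_forall fun k => ?_)
  have hg := contDiff_degDensity k hζ.continuous hc hΦ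
  calc ‖∫ y, degDensity k ζ Φ y * H y‖ₑ
      ≤ ∫⁻ y, ‖degDensity k ζ Φ y‖ₑ * ‖H y‖ₑ := by
        refine (enorm_integral_le_lintegral_enorm _).trans_eq ?_
        simp only [enorm_mul]
    _ ≤ (∫⁻ y, ‖degDensity k ζ Φ y‖ₑ ^ p) ^ (1 / p) *
        (∫⁻ y, ‖H y‖ₑ ^ (n : ℝ)) ^ (1 / (n : ℝ)) :=
        ENNReal.lintegral_mul_le_Lp_mul_Lq _ hpq.symm hg.continuous.measurable.enorm.aemeasurable
          hH.measurable.enorm.aemeasurable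
    _ ≤ (A * I ^ p) ^ (1 / p) * (∫⁻ y, ‖H y‖ₑ ^ (n : ℝ)) ^ (1 / (n : ℝ)) := by
        have h1 := lintegral_pow_le_pow_lintegral_fderiv (volume : Measure (Euc n)) hg
          (hasCompactSupport_degDensity k hc hΦ) hpq'
        have h2 := lintegral_fderiv_degDensity_le k hζ hc hΦ
        have h3 : 0 ≤ p := hpq.symm.nonneg
        have h4 : 0 ≤ 1 / p := one_div_nonneg.2 h3
        gcongr
        exact h1.trans (by gcongr)
    _ = _ := by
        have h3 : p ≠ 0 := hpq.symm.ne_zero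
        rw [ENNReal.mul_rpow_of_nonneg _ _ (one_div_nonneg.2 hpq.symm.nonneg),
          ← ENNReal.rpow_mul, mul_one_div_cancel h3, ENNReal.rpow_one]
        ring

lemma degInt_mul_integral_comm {χ h₁ h₂ : Euc n → ℝ} {Φ : Euc n → Euc n} {c : Euc n} {r δ : ℝ}
    (hχ : ContDiff ℝ (⊤ : ℕ∞) χ) (hc : HasCompactSupport χ) (hΦ : ContDiff ℝ (⊤ : ℕ∞) Φ)
    (hδ : 0 < δ) (hd : ∀ x, Φ x ∈ Metric.ball c (r + δ) → fderiv ℝ χ x = 0)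
    (h₁c : Continuous h₁) (h₁s : HasCompactSupport h₁) (h₁b : Function.support h₁ ⊆ Metric.ball c r)
    (h₂c : Continuous h₂) (h₂s : HasCompactSupport h₂)
    (h₂b : Function.support h₂ ⊆ Metric.ball c r) :
    degInt χ Φ h₁ * ∫ y, h₂ y = degInt χ Φ h₂ * ∫ y, h₁ y := by
  refine tendsto_nhds_unique_of_eventuallyEq
    ((tendsto_integral_degDensity_mul hχ.continuous hc hΦ h₁c h₁s).mul_const _)
    ((tendsto_integral_degDensity_mul hχ.continuous hc hΦ h₂c h₂s).mul_const _) ?_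
  filter_upwards [exists_nat_one_div_lt' hδ] with k hk
  have hg := contDiff_degDensity k hχ.continuous hc hΦ
  have h0 : ∀ y ∈ Metric.ball c r, fderiv ℝ (degDensity k χ Φ) y = 0 := by
    intro y hy
    ext v
    rw [fderiv_degDensity k hχ hc hΦ]
    refine integral_eq_zero_of_ae (Eventually.of_forall fun x => ?_)
    by_cases hx : ‖Φ x - y‖ ≤ 1 / ((k : ℝ) + 1)
    · have : fderiv ℝ χ x = 0 := by
        refine hd x ?_
        rw [Metric.mem_ball] at hy ⊢
        have := dist_triangle (Φ x) y c
        rw [dist_eq_norm (Φ x) y] at this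
        linarith
      simp [this]
    · simp [mollKernel_eq_zero (not_le.1 hx)]
  have hconst : ∀ h : Euc n → ℝ, Function.support h ⊆ Metric.ball c r →
      ∫ y, degDensity k χ Φ y * h y = degDensity k χ Φ c * ∫ y, h y := by
    intro h hh
    rw [← integral_const_mul]
    refine integral_congr_ae (Eventually.of_forall fun y => ?_)
    by_cases hy : h y = 0
    · simp [hy]
    · have hyb : y ∈ Metric.ball c r := hh hy
      have hcb : c ∈ Metric.ball c r := Metric.mem_ball_self (Metric.pos_of_mem_ball hyb)
      have := (convex_ball c r).is_const_of_fderivWithin_eq_zero (𝕜 := ℝ)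
        (hg.differentiable one_ne_zero).differentiableOn (fun z hz => by
          rw [fderivWithin_of_isOpen Metric.isOpen_ball hz, h0 z hz]) hyb hcb
      simp only [this]
  rw [hconst h₁ h₁b, hconst h₂ h₂b]
  ring

/-- The piecewise linear hat function on `[-1, 1]`. -/
def tent (s : ℝ) : ℝ := max 0 (1 - |s|)

lemma continuous_tent : Continuous tent := by unfold tent; fun_prop

lemma tent_nonneg (s : ℝ) : 0 ≤ tent s := le_max_left _ _

lemma tent_le_one (s : ℝ) : tent s ≤ 1 := max_le zero_le_one (by linarith [abs_nonneg s])

lemma tent_eq_zero {s : ℝ} (hs : 1 ≤ |s|) : tent s = 0 := max_eq_left (by linarith)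

lemma sum_mul_tent {N : ℤ} {u : ℝ} (hu : |u| < N) (f : ℤ → ℝ) :
    ∑ j ∈ Finset.Icc (-N) N, f j * tent (u - j) =
      f ⌊u⌋ * (1 - Int.fract u) + f (⌊u⌋ + 1) * Int.fract u := by
  have h0 : (⌊u⌋ : ℝ) + Int.fract u = u := Int.floor_add_fract u
  have h1 := Int.fract_nonneg u
  have h2 := Int.fract_lt_one u
  rw [abs_lt] at hu
  have e1 : -N ≤ ⌊u⌋ := Int.le_floor.2 (by push_cast; linarith)
  have e2 : ⌊u⌋ + 1 ≤ N := by
    have : ⌊u⌋ < N := Int.floor_lt.2 hu.2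
    lia
  have hs : ({⌊u⌋, ⌊u⌋ + 1} : Finset ℤ) ⊆ Finset.Icc (-N) N := by
    intro j hj
    simp only [Finset.mem_insert, Finset.mem_singleton] at hj
    rw [Finset.mem_Icc]
    lia
  rw [← Finset.sum_subset hs, Finset.sum_pair (by lia)]
  · have t1 : tent (u - ⌊u⌋) = 1 - Int.fract u := by
      rw [tent, Int.self_sub_floor, abs_of_nonneg h1, max_eq_right (by linarith)]
    have t2 : tent (u - (⌊u⌋ + 1 : ℤ)) = Int.fract u := by
      have : u - (⌊u⌋ + 1 : ℤ) = Int.fract u - 1 := by push_cast; linarith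
      rw [tent, this, abs_of_nonpos (by linarith), max_eq_right (by linarith)]
      ring
    rw [t1, t2]
  · intro j _ hj
    simp only [Finset.mem_insert, Finset.mem_singleton, not_or] at hj
    rw [tent_eq_zero, mul_zero]
    rcases lt_or_gt_of_ne hj.1 with h | h
    · have : (j : ℝ) + 1 ≤ ⌊u⌋ := by exact_mod_cast h
      exact le_abs.2 (Or.inl (by linarith))
    · have h3 : ⌊u⌋ + 2 ≤ j := by have := hj.2; lia
      have : (⌊u⌋ : ℝ) + 2 ≤ j := by exact_mod_cast h3
      exact le_abs.2 (Or.inr (by linarith))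

lemma sum_tent {N : ℤ} {u : ℝ} (hu : |u| < N) :
    ∑ j ∈ Finset.Icc (-N) N, tent (u - j) = 1 := by
  have := sum_mul_tent hu fun _ => 1
  simpa using this

lemma sum_intCast_mul_tent {N : ℤ} {u : ℝ} (hu : |u| < N) :
    ∑ j ∈ Finset.Icc (-N) N, (j : ℝ) * tent (u - j) = u := by
  rw [sum_mul_tent hu fun j => (j : ℝ)]
  push_cast
  linarith [Int.floor_add_fract u]

lemma card_filter_abs_sub_intCast_le (J : Finset ℤ) (s : ℝ) :
    (J.filter fun j : ℤ => |s - j| ≤ 3).card ≤ 8 := by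
  calc (J.filter fun j : ℤ => |s - j| ≤ 3).card
      ≤ (Finset.Icc (⌊s⌋ - 3) (⌊s⌋ + 4)).card := by
        refine Finset.card_le_card fun j hj => ?_
        have h := (Finset.mem_filter.1 hj).2
        rw [abs_le] at h
        have h1 := Int.floor_le s
        have h2 := Int.lt_floor_add_one s
        rw [Finset.mem_Icc]
        constructor
        · have : ((⌊s⌋ : ℤ) : ℝ) - 3 ≤ j := by linarith
          exact_mod_cast this
        · have : (j : ℝ) < ⌊s⌋ + 4 := by linarith
          exact le_of_lt (by exact_mod_cast this)
    _ = 8 := by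
      rw [Int.card_Icc, show ⌊s⌋ + 4 + 1 - (⌊s⌋ - 3) = 8 by ring]
      rfl

lemma exists_smooth_truncation : ∃ τ : ℝ → ℝ, ContDiff ℝ (⊤ : ℕ∞) τ ∧ HasCompactSupport τ ∧
    (∀ s, |s| ≤ 2 → τ s = s) ∧ tsupport τ ⊆ Icc (-3) 3 := by
  let b : ContDiffBump (0 : ℝ) := ⟨2, 3, by norm_num, by norm_num⟩
  have hsub : tsupport (fun s => s * b s) ⊆ Icc (-3 : ℝ) 3 := by
    refine (closure_mono fun s hs => ?_).trans
      ((b.tsupport_eq.le).trans (by simp [Real.closedBall_eq_Icc, b]))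
    exact right_ne_zero_of_mul (show s * b s ≠ 0 from hs)
  refine ⟨fun s => s * b s, contDiff_id.mul b.contDiff, ?_, fun s hs => ?_, hsub⟩
  · exact HasCompactSupport.mul_left b.hasCompactSupport
  · have : b s = 1 := b.one_of_mem_closedBall (by simpa [b] using hs)
    simp [this]

lemma exists_slab_cutoff {χ : Euc n → ℝ} (hχ : ContDiff ℝ (⊤ : ℕ∞) χ) (hc : HasCompactSupport χ)
    (i : Fin n) : ∃ ζ : ℝ → ℤ → Euc n → ℝ, ∃ C : ℝ≥0∞, C ≠ ∞ ∧ ∀ ε, 0 < ε → ε ≤ 1 →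
      (∀ j, ContDiff ℝ (⊤ : ℕ∞) (ζ ε j) ∧ HasCompactSupport (ζ ε j) ∧
        (∀ x, χ x = 0 → ζ ε j x = 0) ∧
        ∀ x, |x i - ε * j| ≤ 2 * ε → ζ ε j x = (x i - ε * j) * χ x) ∧
      ∀ (J : Finset ℤ) (x : Euc n), ∑ j ∈ J, ‖fderiv ℝ (ζ ε j) x‖ₑ ≤
        (tsupport χ).indicator (fun _ => C) x := by
  obtain ⟨τ, hτ, hτc, hτ2, hτ3⟩ := exists_smooth_truncation
  obtain ⟨C₀, hC₀⟩ := hτ.continuous.bounded_above_of_compact_support hτc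
  obtain ⟨C₁, hC₁⟩ := (hτ.continuous_deriv (by simp)).bounded_above_of_compact_support hτc.deriv
  obtain ⟨C₂, hC₂⟩ := hχ.continuous.bounded_above_of_compact_support hc
  obtain ⟨C₃, hC₃⟩ := (hχ.continuous_fderiv (by simp)).bounded_above_of_compact_support
    (hc.fderiv ℝ)
  set P : Euc n →L[ℝ] ℝ := EuclideanSpace.proj i with hP
  have hPx : ∀ x, P x = x i := fun x => rfl
  set C : ℝ := C₀ * C₃ + C₂ * (C₁ * ‖P‖) with hC
  refine ⟨fun ε j x => ε * τ (ε⁻¹ * P x - j) * χ x, 8 * ENNReal.ofReal C, by finiteness,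
    fun ε hε hε1 => ⟨fun j => ⟨?_, hc.mul_left, fun x hx => by simp [hx],
      fun x hx => ?_⟩, fun J x => ?_⟩⟩
  · exact (contDiff_const.mul (hτ.comp ((contDiff_const.mul P.contDiff).sub contDiff_const))).mul hχ
  · have h1 : ε⁻¹ * P x - j = ε⁻¹ * (x i - ε * j) := by
      rw [hPx]; field_simp
    have h2 : |ε⁻¹ * (x i - ε * j)| ≤ 2 := by
      rw [abs_mul, abs_of_pos (inv_pos.2 hε), inv_mul_le_iff₀ hε]
      linarith
    simp only [h1, hτ2 _ h2]
    field_simp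
  · have hd : ∀ j : ℤ, HasFDerivAt (fun x => ε * τ (ε⁻¹ * P x - j) * χ x)
        ((ε * τ (ε⁻¹ * P x - j)) • fderiv ℝ χ x +
          χ x • (ε • (deriv τ (ε⁻¹ * P x - j) • (ε⁻¹ • P)))) x := by
      intro j
      have h1 : HasFDerivAt (fun x => ε⁻¹ * P x - j) (ε⁻¹ • P) x :=
        (P.hasFDerivAt.const_mul ε⁻¹).sub_const _
      have h2 : HasFDerivAt (fun x => τ (ε⁻¹ * P x - j))
          (deriv τ (ε⁻¹ * P x - j) • (ε⁻¹ • P)) x :=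
        ((hτ.differentiable (by simp)) _).hasDerivAt.comp_hasFDerivAt x h1
      exact (h2.const_mul ε).mul ((hχ.differentiable (by simp)) x).hasFDerivAt
    by_cases hx : x ∈ tsupport χ
    · rw [indicator_of_mem hx]
      have hz : ∀ j : ℤ, ¬ |ε⁻¹ * P x - j| ≤ 3 →
          fderiv ℝ (fun x => ε * τ (ε⁻¹ * P x - j) * χ x) x = 0 := by
        intro j hj
        have h1 : ε⁻¹ * P x - j ∉ tsupport τ := fun h => hj (abs_le.2 (hτ3 h))
        have h2 : deriv τ (ε⁻¹ * P x - j) = 0 := by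
          by_contra h
          exact h1 (tsupport_deriv_subset (subset_tsupport _ h))
        rw [(hd j).fderiv, h2, image_eq_zero_of_notMem_tsupport h1]
        simp
      have hb : ∀ j : ℤ, ‖fderiv ℝ (fun x => ε * τ (ε⁻¹ * P x - j) * χ x) x‖ₑ ≤
          ENNReal.ofReal C := by
        intro j
        rw [← ofReal_norm]
        refine ENNReal.ofReal_le_ofReal ?_
        rw [(hd j).fderiv]
        refine (norm_add_le _ _).trans (add_le_add ?_ ?_)
        · rw [norm_smul, norm_mul, Real.norm_of_nonneg hε.le]
          have := hC₀ (ε⁻¹ * P x - j)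
          have h3 := norm_nonneg (τ (ε⁻¹ * P x - j))
          exact mul_le_mul (by nlinarith) (hC₃ x) (norm_nonneg _) (h3.trans this)
        · rw [norm_smul]
          refine mul_le_mul (hC₂ x) ?_ (norm_nonneg _) ((norm_nonneg _).trans (hC₂ x))
          rw [smul_comm, smul_smul, smul_smul, mul_assoc, mul_inv_cancel₀ hε.ne', mul_one,
            norm_smul]
          exact mul_le_mul_of_nonneg_right (hC₁ _) (norm_nonneg _)
      calc ∑ j ∈ J, ‖fderiv ℝ (fun x => ε * τ (ε⁻¹ * P x - j) * χ x) x‖ₑ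
          = ∑ j ∈ J.filter (fun j : ℤ => |ε⁻¹ * P x - j| ≤ 3),
            ‖fderiv ℝ (fun x => ε * τ (ε⁻¹ * P x - j) * χ x) x‖ₑ := by
            rw [Finset.sum_filter]
            refine Finset.sum_congr rfl fun j _ => ?_
            split_ifs with h
            · rfl
            · rw [hz j h, ← ofReal_norm, norm_zero, ENNReal.ofReal_zero]
        _ ≤ ∑ j ∈ J.filter (fun j : ℤ => |ε⁻¹ * P x - j| ≤ 3), ENNReal.ofReal C :=
            Finset.sum_le_sum fun j _ => hb j
        _ ≤ 8 * ENNReal.ofReal C := by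
            rw [Finset.sum_const, nsmul_eq_mul]
            gcongr
            exact_mod_cast card_filter_abs_sub_intCast_le J _
    · rw [indicator_of_notMem hx]
      refine (Finset.sum_eq_zero fun j _ => ?_).le
      have h1 : χ x = 0 := image_eq_zero_of_notMem_tsupport hx
      have h2 : fderiv ℝ χ x = 0 := by
        by_contra h
        exact hx (tsupport_fderiv_subset ℝ (subset_tsupport _ h))
      rw [(hd j).fderiv, h1, h2, smul_zero, zero_smul, add_zero, ← ofReal_norm, norm_zero,
        ENNReal.ofReal_zero]

lemma volume_closedBall_inter_slab_le (R t w : ℝ) (i : Fin n) :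
    volume (Metric.closedBall (0 : Euc n) R ∩ {x | |x i - t| ≤ w}) ≤
      ENNReal.ofReal (2 * w) * ENNReal.ofReal (2 * R) ^ (n - 1) := by
  set s : Fin n → Set ℝ := fun j => if j = i then Icc (t - w) (t + w) else Icc (-R) R with hs
  have hsub : Metric.closedBall (0 : Euc n) R ∩ {x | |x i - t| ≤ w} ⊆
      (WithLp.ofLp : Euc n → Fin n → ℝ) ⁻¹' (Set.univ.pi s) := by
    rintro x ⟨hx, hxi⟩ j -
    have hxi' : |x i - t| ≤ w := hxi
    rw [abs_le] at hxi'
    simp only [hs]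
    split_ifs with h
    · rw [h]
      exact ⟨by linarith, by linarith⟩
    · have h1 : |x j| ≤ ‖x‖ := by simpa using PiLp.norm_apply_le x j
      have h2 : ‖x‖ ≤ R := by simpa using hx
      exact abs_le.1 (h1.trans h2)
  have hm : MeasurableSet (Set.univ.pi s) := MeasurableSet.univ_pi fun j => by
    simp only [hs]
    split_ifs <;> exact measurableSet_Icc
  refine (measure_mono hsub).trans ?_
  rw [(PiLp.volume_preserving_ofLp (Fin n)).measure_preimage hm.nullMeasurableSet, volume_pi_pi,
    ← Finset.mul_prod_erase _ _ (Finset.mem_univ i)]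
  refine mul_le_mul' ?_ ?_
  · simp only [hs, if_true, Real.volume_Icc]
    exact ENNReal.ofReal_le_ofReal (by linarith)
  · have : ∀ j ∈ Finset.univ.erase i, volume (s j) = ENNReal.ofReal (2 * R) := by
      intro j hj
      simp only [hs, if_neg (Finset.ne_of_mem_erase hj), Real.volume_Icc]
      congr 1
      ring
    rw [Finset.prod_congr rfl this, Finset.prod_const, Finset.card_erase_of_mem (Finset.mem_univ i)]
    simp

section InverseDerivative

variable {Ω Ω' : Set (Euc n)} {φ : Euc n → Euc n} {D : Euc n → Euc n →L[ℝ] Euc n}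

lemma IsHomeoOn.exists_forall_volume_image_slab_le (hφ : IsHomeoOn φ Ω Ω') (hΩ : IsOpen Ω)
    (hN : LuzinN φ Ω) (hDm : StronglyMeasurable D) (hD : WeakDeriv φ D Ω) {K : Set (Euc n)}
    (hK : IsCompact K) (hKΩ : K ⊆ Ω) (i : Fin n) {e : ℝ≥0∞} (he : e ≠ 0) :
    ∃ ε : ℝ, 0 < ε ∧ ε ≤ 1 ∧ ∀ t : ℝ, volume (φ '' (K ∩ {x | |x i - t| ≤ ε})) ≤ e := by
  have hfin : ∫⁻ x in K, ENNReal.ofReal |jacobian D x| ≠ ∞ := by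
    rw [← hφ.volume_image hΩ hN hDm hD hK.measurableSet hKΩ]
    exact (hK.image_of_continuousOn (hφ.2.1.mono hKΩ)).measure_lt_top.ne
  obtain ⟨δ, hδ, hδ'⟩ := exists_pos_setLIntegral_lt_of_measure_lt hfin he
  obtain ⟨R, hR⟩ := hK.isBounded.subset_closedBall 0
  have hlim : Tendsto (fun ε : ℝ => ENNReal.ofReal (2 * ε) * ENNReal.ofReal (2 * R) ^ (n - 1))
      (nhdsWithin 0 (Ioi 0)) (nhds 0) := by
    have h1 : Tendsto (fun ε : ℝ => ENNReal.ofReal (2 * ε)) (nhdsWithin 0 (Ioi 0)) (nhds 0) := by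
      have h : Continuous fun ε : ℝ => ENNReal.ofReal (2 * ε) :=
        ENNReal.continuous_ofReal.comp (continuous_const.mul continuous_id)
      have h' := h.tendsto 0
      simp only [mul_zero, ENNReal.ofReal_zero] at h'
      exact h'.mono_left nhdsWithin_le_nhds
    simpa using ENNReal.Tendsto.mul_const h1 (Or.inr (by finiteness : _ ≠ ∞))
  obtain ⟨ε, hε, hε0, hε1⟩ := ((hlim.eventually_lt_const hδ).and
    (Ioc_mem_nhdsGT (zero_lt_one' ℝ))).exists
  refine ⟨ε, hε0, hε1, fun t => ?_⟩
  have hm : MeasurableSet (K ∩ {x : Euc n | |x i - t| ≤ ε}) := by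
    refine hK.measurableSet.inter (IsClosed.measurableSet ?_)
    exact isClosed_le (by fun_prop) continuous_const
  rw [hφ.volume_image hΩ hN hDm hD hm (inter_subset_left.trans hKΩ)]
  have h1 : volume (K ∩ {x : Euc n | |x i - t| ≤ ε}) < δ :=
    ((measure_mono (inter_subset_inter_left _ hR)).trans
      (volume_closedBall_inter_slab_le R t ε i)).trans_lt hε
  have h2 := hδ' (K ∩ {x : Euc n | |x i - t| ≤ ε}) (by
    rw [Measure.restrict_apply hm]
    exact (measure_mono inter_subset_left).trans_lt h1)
  rw [Measure.restrict_restrict hm] at h2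
  rw [inter_eq_self_of_subset_left (inter_subset_left :
    K ∩ {x : Euc n | |x i - t| ≤ ε} ⊆ K)] at h2
  exact h2.le

lemma continuous_mul_of_tsupport_subset {X : Type*} [TopologicalSpace X] {H g : X → ℝ} {U : Set X}
    (hU : IsOpen U) (hH : Continuous H) (hHU : tsupport H ⊆ U) (hg : ContinuousOn g U) :
    Continuous fun x => H x * g x := by
  refine continuous_of_tsupport fun x hx => ?_
  have hxU : x ∈ U := hHU (closure_mono (fun y hy => left_ne_zero_of_mul hy) hx)
  exact hH.continuousAt.mul (hg.continuousAt (hU.mem_nhds hxU))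

variable {y₀ : Euc n} {r : ℝ} {χ : Euc n → ℝ} {V : Set (Euc n)} {Φ : ℕ → Euc n → Euc n}

lemma fderiv_eq_zero_of_isOpen_of_eq_one (hV : IsOpen V) (hχ1 : ∀ x ∈ V, χ x = 1) {x : Euc n}
    (hx : x ∈ V) : fderiv ℝ χ x = 0 := by
  have : χ =ᶠ[nhds x] fun _ => 1 := by
    filter_upwards [hV.mem_nhds hx] with z hz using hχ1 z hz
  rw [this.fderiv_eq]
  simp

lemma eventually_fderiv_eq_zero_of_mem_ball (hr : 0 < r) (hχΩ : tsupport χ ⊆ Ω) (hV : IsOpen V)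
    (hVB : ∀ x ∈ Ω, φ x ∈ Metric.closedBall y₀ (2 * r) → x ∈ V) (hχ1 : ∀ x ∈ V, χ x = 1)
    (hu : TendstoUniformlyOn Φ φ atTop (tsupport χ)) :
    ∀ᶠ k in atTop, ∀ x, Φ k x ∈ Metric.ball y₀ (r + r / 2) → fderiv ℝ χ x = 0 := by
  filter_upwards [Metric.tendstoUniformlyOn_iff.1 hu (r / 2) (by positivity)] with k hk x hx
  by_cases hxχ : x ∈ tsupport χ
  · refine fderiv_eq_zero_of_isOpen_of_eq_one hV hχ1 (hVB x (hχΩ hxχ) ?_)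
    rw [Metric.mem_ball] at hx
    rw [Metric.mem_closedBall]
    have := dist_triangle (φ x) (Φ k x) y₀
    linarith [hk x hxχ]
  · by_contra h
    exact hxχ (tsupport_fderiv_subset ℝ (subset_tsupport _ h))

lemma IsHomeoOn.eventually_abs_sub_le (hφ : IsHomeoOn φ Ω Ω') (hr : 0 < r)
    (hB : Metric.closedBall y₀ (2 * r) ⊆ Ω') (hχΩ : tsupport χ ⊆ Ω)
    (hu : TendstoUniformlyOn Φ φ atTop (tsupport χ)) (i : Fin n) {ε : ℝ} (hε : 0 < ε) :
    ∀ᶠ k in atTop, ∀ x ∈ tsupport χ, Φ k x ∈ Metric.ball y₀ r →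
      |x i - Function.invFunOn φ Ω (Φ k x) i| ≤ ε := by
  have huc : UniformContinuousOn (Function.invFunOn φ Ω) (Metric.closedBall y₀ (2 * r)) :=
    (isCompact_closedBall y₀ (2 * r)).uniformContinuousOn_of_continuous (hφ.2.2.mono hB)
  obtain ⟨δ, hδ, hδ'⟩ := Metric.uniformContinuousOn_iff.1 huc ε hε
  filter_upwards [Metric.tendstoUniformlyOn_iff.1 hu (min δ r) (by positivity)] with k hk x hx hxB
  have h1 := hk x hx
  rw [lt_min_iff] at h1
  rw [Metric.mem_ball] at hxB
  have h2 : φ x ∈ Metric.closedBall y₀ (2 * r) := by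
    rw [Metric.mem_closedBall]
    have := dist_triangle (φ x) (Φ k x) y₀
    linarith
  have h3 : Φ k x ∈ Metric.closedBall y₀ (2 * r) := by
    rw [Metric.mem_closedBall]
    linarith
  have h4 := hδ' _ h2 _ h3 h1.1
  rw [hφ.invFunOn_apply (hχΩ hx), dist_eq_norm] at h4
  have h5 := PiLp.norm_apply_le (x - Function.invFunOn φ Ω (Φ k x)) i
  rw [PiLp.sub_apply, Real.norm_eq_abs] at h5
  exact h5.trans h4.le

lemma exists_ne_zero_mul_rpow_le {M e : ℝ≥0∞} (hM : M ≠ ∞) (he : e ≠ 0) {p : ℝ} (hp : 0 < p) :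
    ∃ a : ℝ≥0∞, a ≠ 0 ∧ M * a ^ p ≤ e := by
  refine ⟨(e / (M + 1)) ^ p⁻¹, ?_, ?_⟩
  · rw [ne_eq, ENNReal.rpow_eq_zero_iff_of_pos (inv_pos.2 hp), ENNReal.div_eq_zero_iff]
    push Not
    exact ⟨he, by finiteness⟩
  · rw [← ENNReal.rpow_mul, inv_mul_cancel₀ hp.ne', ENNReal.rpow_one]
    calc M * (e / (M + 1)) ≤ (M + 1) * (e / (M + 1)) := by gcongr; exact le_self_add
      _ ≤ e := ENNReal.mul_div_le

lemma lintegral_enorm_mul_pow_le {H g : Euc n → ℝ} {s : Set (Euc n)} {C : ℝ}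
    (hH : ∀ y, ‖H y‖ ≤ C) (hg : ∀ y, ‖g y‖ ≤ 1) (hs : ∀ y, H y * g y ≠ 0 → y ∈ s)
    (hsm : MeasurableSet s) {p : ℝ} (hp : 0 < p) :
    ∫⁻ y, ‖H y * g y‖ₑ ^ p ≤ ENNReal.ofReal C ^ p * volume s := by
  rw [← setLIntegral_const]
  rw [← lintegral_indicator hsm]
  refine lintegral_mono fun y => ?_
  by_cases hy : H y * g y = 0
  · rw [hy, enorm_zero, ENNReal.zero_rpow_of_pos hp]
    exact bot_le
  · rw [indicator_of_mem (hs y hy), ← ofReal_norm]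
    refine ENNReal.rpow_le_rpow (ENNReal.ofReal_le_ofReal ?_) hp.le
    rw [norm_mul]
    calc ‖H y‖ * ‖g y‖ ≤ C * 1 :=
          mul_le_mul (hH y) (hg y) (norm_nonneg _) ((norm_nonneg _).trans (hH y))
      _ = C := mul_one C

section
variable {n : ℕ} {Ω Ω' : Set (Euc n)} {φ : Euc n → Euc n} {D : Euc n → Euc n →L[ℝ] Euc n}
  {y₀ : Euc n} {r : ℝ} {χ : Euc n → ℝ} {V : Set (Euc n)} {Φ : ℕ → Euc n → Euc n}

lemma tendsto_degInt_coord_sub (hn : 2 ≤ n) (hφ : IsHomeoOn φ Ω Ω') (hΩ : IsOpen Ω)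
    (hΩ' : IsOpen Ω') (hN : LuzinN φ Ω) (hDm : StronglyMeasurable D) (hD : WeakDeriv φ D Ω)
    (hr : 0 < r) (hB : Metric.closedBall y₀ (2 * r) ⊆ Ω') (hχ : ContDiff ℝ (⊤ : ℕ∞) χ)
    (hc : HasCompactSupport χ) (hχΩ : tsupport χ ⊆ Ω) (hV : IsOpen V)
    (hVB : ∀ x ∈ Ω, φ x ∈ Metric.closedBall y₀ (2 * r) → x ∈ V) (hχ1 : ∀ x ∈ V, χ x = 1)
    (hΦ : ∀ k, ContDiff ℝ (⊤ : ℕ∞) (Φ k)) (hu : TendstoUniformlyOn Φ φ atTop (tsupport χ))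
    {A : ℝ≥0∞} (hA : A ≠ ∞)
    (hΦA : ∀ᶠ k in atTop, ∫⁻ x in tsupport χ, ‖adjMap (fderiv ℝ (Φ k) x)‖ₑ ≤ A)
    {h H : Euc n → ℝ} (hh : Continuous h) (hhc : HasCompactSupport h)
    (hhb : Function.support h ⊆ Metric.ball y₀ r) (hh1 : ∫ y, h y = 1)
    (hH : Continuous H) (hHc : HasCompactSupport H) (hHb : tsupport H ⊆ Metric.ball y₀ r)
    (i : Fin n) :
    Tendsto (fun k => degInt (fun x => x i * χ x) (Φ k) H -
      degInt χ (Φ k) h * ∫ y, Function.invFunOn φ Ω y i * H y) atTop (nhds 0) := by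
  set ψ := Function.invFunOn φ Ω with hψ
  have hballΩ' : Metric.ball y₀ r ⊆ Ω' := (Metric.ball_subset_closedBall.trans
    (Metric.closedBall_subset_closedBall (by linarith))).trans hB
  have hVχ : V ⊆ tsupport χ := fun x hx => subset_tsupport _ (by simp [hχ1 x hx])
  have hψV : ∀ y ∈ Metric.ball y₀ r, ψ y ∈ V := fun y hy => by
    refine hVB _ (hφ.invFunOn_mem (hballΩ' hy)) ?_
    rw [hφ.apply_invFunOn (hballΩ' hy)]
    exact Metric.closedBall_subset_closedBall (by linarith) (Metric.ball_subset_closedBall hy)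
  have hHsupp : ∀ y, H y ≠ 0 → y ∈ Metric.ball y₀ r := fun y hy => hHb (subset_tsupport _ hy)
  obtain ⟨C₁, hC₁, hS⟩ := exists_enorm_degInt_le hn
  obtain ⟨ζ, C₂, hC₂, hζ⟩ := exists_slab_cutoff hχ hc i
  obtain ⟨C₃, hC₃⟩ := hH.bounded_above_of_compact_support hHc
  obtain ⟨M, hM⟩ := hc.isCompact.isBounded.exists_norm_le
  have hn0 : (0 : ℝ) < n := by exact_mod_cast (by lia : 0 < n)
  have hp : 0 < 1 / (n : ℝ) := by positivity
  rw [tendsto_zero_iff_enorm_tendsto_zero, ENNReal.tendsto_nhds_zero]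
  intro e he
  obtain ⟨a, ha, hae⟩ := exists_ne_zero_mul_rpow_le
    (M := C₁ * ENNReal.ofReal C₃ * (C₂ * A)) (by finiteness) he.ne' hp
  obtain ⟨ε, hε, hε1, hεa⟩ :=
    hφ.exists_forall_volume_image_slab_le hΩ hN hDm hD hc.isCompact hχΩ i ha
  obtain ⟨hζ1, hζ2⟩ := hζ ε hε hε1
  obtain ⟨N, hNM⟩ := exists_nat_gt (M / ε)
  set J : Finset ℤ := Finset.Icc (-(N : ℤ)) N with hJ
  set g : ℤ → Euc n → ℝ := fun j y => tent (ε⁻¹ * ψ y i - j) with hg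
  have hψc : ContinuousOn (fun y => ψ y i) Ω' :=
    (EuclideanSpace.proj (𝕜 := ℝ) i).continuous.comp_continuousOn hφ.2.2
  have hHg : ∀ j, Continuous fun y => H y * g j y := fun j =>
    continuous_mul_of_tsupport_subset hΩ' hH (hHb.trans hballΩ')
      (continuous_tent.comp_continuousOn ((continuousOn_const.mul hψc).sub continuousOn_const))
  have hHgc : ∀ j, HasCompactSupport fun y => H y * g j y := fun j => hHc.mul_right
  have hHgb : ∀ j, Function.support (fun y => H y * g j y) ⊆ Metric.ball y₀ r :=
    fun j y hy => hHsupp y (left_ne_zero_of_mul hy)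
  have hslab : ∀ j y, H y * g j y ≠ 0 → |ψ y i - ε * j| ≤ ε := by
    intro j y hy
    have h1 : |ε⁻¹ * ψ y i - j| < 1 := by
      by_contra h
      exact right_ne_zero_of_mul hy (tent_eq_zero (not_lt.1 h))
    have h2 : ψ y i - ε * j = ε * (ε⁻¹ * ψ y i - j) := by field_simp
    rw [h2, abs_mul, abs_of_pos hε]
    nlinarith
  have habs : ∀ y ∈ Metric.ball y₀ r, |ε⁻¹ * ψ y i| < ((N : ℤ) : ℝ) := by
    intro y hy
    have h1 : |ψ y i| ≤ M :=
      (PiLp.norm_apply_le (ψ y) i).trans (hM _ (hVχ (hψV y hy)))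
    rw [abs_mul, abs_of_pos (inv_pos.2 hε), ← div_eq_inv_mul, Int.cast_natCast]
    exact (div_le_div_of_nonneg_right h1 hε.le).trans_lt hNM
  have hsum1 : ∀ y, ∑ j ∈ J, H y * g j y = H y := by
    intro y
    by_cases hy : H y = 0
    · simp [hy]
    · rw [← Finset.mul_sum, sum_tent (habs y (hHsupp y hy)), mul_one]
  have hsum2 : ∀ y, ∑ j ∈ J, ε * j * (H y * g j y) = ψ y i * H y := by
    intro y
    by_cases hy : H y = 0
    · simp [hy]
    · have h1 := sum_intCast_mul_tent (habs y (hHsupp y hy))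
      calc ∑ j ∈ J, ε * j * (H y * g j y) = ε * H y * ∑ j ∈ J, (j : ℝ) * g j y := by
            rw [Finset.mul_sum]
            exact Finset.sum_congr rfl fun j _ => by ring
        _ = ψ y i * H y := by
            rw [h1]
            field_simp
  have hxχ : Continuous fun x : Euc n => x i * χ x := by
    have := hχ.continuous
    fun_prop
  filter_upwards [hΦA, eventually_fderiv_eq_zero_of_mem_ball hr hχΩ hV hVB hχ1 hu,
    hφ.eventually_abs_sub_le hr hB hχΩ hu i hε] with k hkA hkd hkψ
  have hone : ∀ j, degInt χ (Φ k) (fun y => H y * g j y) =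
      degInt χ (Φ k) h * ∫ y, H y * g j y := by
    intro j
    have := degInt_mul_integral_comm hχ hc (hΦ k) (half_pos hr) hkd hh hhc hhb (hHg j) (hHgc j)
      (hHgb j)
    rw [this, hh1, mul_one]
  have hterm : ∀ j, degInt (fun x => x i * χ x) (Φ k) (fun y => H y * g j y) =
      ε * j * (degInt χ (Φ k) h * ∫ y, H y * g j y) +
        degInt (ζ ε j) (Φ k) (fun y => H y * g j y) := by
    intro j
    rw [← hone j, degInt, degInt, degInt, ← integral_const_mul, ← integral_add
      ((integrable_degInt hχ.continuous hc (hΦ k) (hHg j)).const_mul _)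
      (integrable_degInt (hζ1 j).1.continuous (hζ1 j).2.1 (hΦ k) (hHg j))]
    refine integral_congr_ae (Eventually.of_forall fun x => ?_)
    by_cases hx : H (Φ k x) * g j (Φ k x) = 0
    · simp [hx]
    · by_cases hxs : x ∈ tsupport χ
      · have h1 := hkψ x hxs (hHsupp _ (left_ne_zero_of_mul hx))
        have h2 := hslab j _ hx
        have h3 : |x i - ε * j| ≤ 2 * ε := by
          have := abs_sub_le (x i) (ψ (Φ k x) i) (ε * j)
          linarith
        simp only [(hζ1 j).2.2.2 x h3]
        ring
      · have h1 : χ x = 0 := image_eq_zero_of_notMem_tsupport hxs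
        simp [h1, (hζ1 j).2.2.1 x h1]
  have htot : degInt (fun x => x i * χ x) (Φ k) H -
      degInt χ (Φ k) h * ∫ y, ψ y i * H y =
      ∑ j ∈ J, degInt (ζ ε j) (Φ k) (fun y => H y * g j y) := by
    have h1 : degInt (fun x => x i * χ x) (Φ k) H =
        ∑ j ∈ J, degInt (fun x => x i * χ x) (Φ k) (fun y => H y * g j y) := by
      simp only [degInt]
      rw [← integral_finsetSum _ fun j _ => integrable_degInt hxχ hc.mul_left (hΦ k) (hHg j)]
      refine integral_congr_ae (Eventually.of_forall fun x => ?_)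
      simp only [← Finset.sum_mul, ← Finset.mul_sum]
      rw [Finset.mul_sum, hsum1]
    have h2 : ∫ y, ψ y i * H y = ∑ j ∈ J, ε * j * ∫ y, H y * g j y := by
      simp only [← integral_const_mul, ← hsum2]
      exact integral_finsetSum _ fun j _ =>
        ((hHg j).integrable_of_hasCompactSupport (hHgc j)).const_mul _
    rw [h1, h2, Finset.mul_sum, ← Finset.sum_sub_distrib]
    refine Finset.sum_congr rfl fun j _ => ?_
    rw [hterm j]
    ring
  rw [htot]
  have hbound : ∀ j, (∫⁻ y, ‖H y * g j y‖ₑ ^ (n : ℝ)) ^ (1 / (n : ℝ)) ≤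
      ENNReal.ofReal C₃ * a ^ (1 / (n : ℝ)) := by
    intro j
    have hm : MeasurableSet (φ '' (tsupport χ ∩ {x | |x i - ε * j| ≤ ε})) :=
      hφ.measurableSet_image ((isClosed_tsupport χ).measurableSet.inter
        (isClosed_le (by fun_prop) continuous_const).measurableSet) (inter_subset_left.trans hχΩ)
    have h1 : ∫⁻ y, ‖H y * g j y‖ₑ ^ (n : ℝ) ≤ ENNReal.ofReal C₃ ^ (n : ℝ) * a := by
      refine (lintegral_enorm_mul_pow_le hC₃ (fun y => ?_) (fun y hy => ?_) hm hn0).trans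
        (mul_le_mul_right (hεa _) _)
      · rw [Real.norm_of_nonneg (tent_nonneg _)]
        exact tent_le_one _
      · have hyb := hHsupp y (left_ne_zero_of_mul hy)
        exact ⟨ψ y, ⟨hVχ (hψV y hyb), hslab j y hy⟩, hφ.apply_invFunOn (hballΩ' hyb)⟩
    refine (ENNReal.rpow_le_rpow h1 hp.le).trans_eq ?_
    rw [ENNReal.mul_rpow_of_nonneg _ _ hp.le, ← ENNReal.rpow_mul, mul_one_div_cancel hn0.ne',
      ENNReal.rpow_one]
  have hadj : Continuous fun x => adjMap (fderiv ℝ (Φ k) x) :=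
    continuous_adjMap.comp ((hΦ k).continuous_fderiv (by simp))
  calc ‖∑ j ∈ J, degInt (ζ ε j) (Φ k) (fun y => H y * g j y)‖ₑ
      ≤ ∑ j ∈ J, ‖degInt (ζ ε j) (Φ k) (fun y => H y * g j y)‖ₑ := enorm_sum_le _ _
    _ ≤ ∑ j ∈ J, C₁ * (ENNReal.ofReal C₃ * a ^ (1 / (n : ℝ))) *
        ∫⁻ x, ‖fderiv ℝ (ζ ε j) x‖ₑ * ‖adjMap (fderiv ℝ (Φ k) x)‖ₑ := by
        refine Finset.sum_le_sum fun j _ =>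
          (hS (hζ1 j).1 (hζ1 j).2.1 (hΦ k) (hHg j) (hHgc j)).trans ?_
        gcongr
        exact hbound j
    _ = C₁ * (ENNReal.ofReal C₃ * a ^ (1 / (n : ℝ))) *
        ∫⁻ x, (∑ j ∈ J, ‖fderiv ℝ (ζ ε j) x‖ₑ) * ‖adjMap (fderiv ℝ (Φ k) x)‖ₑ := by
        rw [← Finset.mul_sum]
        congr 1
        simp only [Finset.sum_mul]
        exact (lintegral_finsetSum' _ fun j _ => (((hζ1 j).1.continuous_fderiv
          (by simp)).measurable.enorm.mul hadj.measurable.enorm).aemeasurable).symm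
    _ ≤ C₁ * (ENNReal.ofReal C₃ * a ^ (1 / (n : ℝ))) * (C₂ * A) := by
        gcongr
        calc ∫⁻ x, (∑ j ∈ J, ‖fderiv ℝ (ζ ε j) x‖ₑ) * ‖adjMap (fderiv ℝ (Φ k) x)‖ₑ
            ≤ ∫⁻ x, (tsupport χ).indicator
              (fun x => C₂ * ‖adjMap (fderiv ℝ (Φ k) x)‖ₑ) x := by
              refine lintegral_mono fun x => ?_
              refine (mul_le_mul_left (hζ2 J x) _).trans ?_
              by_cases hx : x ∈ tsupport χ
              · simp [hx]
              · simp [hx]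
          _ = C₂ * ∫⁻ x in tsupport χ, ‖adjMap (fderiv ℝ (Φ k) x)‖ₑ := by
              rw [lintegral_indicator (isClosed_tsupport χ).measurableSet,
                lintegral_const_mul _ hadj.measurable.enorm]
          _ ≤ C₂ * A := by gcongr
    _ = C₁ * ENNReal.ofReal C₃ * (C₂ * A) * a ^ (1 / (n : ℝ)) := by ring
    _ ≤ e := hae
end

lemma tendsto_degInt_fderiv {φ : Euc n → Euc n} {D : Euc n → Euc n →L[ℝ] Euc n}
    {Φ : ℕ → Euc n → Euc n} {ζ η : Euc n → ℝ} {K : Set (Euc n)} (hK : IsCompact K)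
    (hζ : ContDiff ℝ (⊤ : ℕ∞) ζ) (hζK : tsupport ζ ⊆ K) (hη : ContDiff ℝ (⊤ : ℕ∞) η)
    (hηc : HasCompactSupport η) (hφ : ContinuousOn φ K) (hDm : StronglyMeasurable D)
    (hΦ : ∀ k, ContDiff ℝ (⊤ : ℕ∞) (Φ k)) (hu : TendstoUniformlyOn Φ φ atTop K)
    (hDK : ∫⁻ x in K, ‖adjMap (D x)‖ₑ ≠ ∞)
    (hadj : Tendsto (fun k => ∫⁻ x in K, ‖adjMap (fderiv ℝ (Φ k) x) - adjMap (D x)‖ₑ) atTop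
      (nhds 0)) (v : Euc n) :
    Tendsto (fun k => degInt ζ (Φ k) fun y => fderiv ℝ η y v) atTop
      (nhds (-∫ x in K, η (φ x) * fderiv ℝ ζ x (adjMap (D x) v))) := by
  have hζc : HasCompactSupport ζ := hK.of_isClosed_subset (isClosed_tsupport ζ) hζK
  have hζ' := hζ.continuous_fderiv (by simp)
  obtain ⟨C₁, hC₁⟩ := hζ'.bounded_above_of_compact_support (hζc.fderiv ℝ)
  obtain ⟨C₂, hC₂⟩ := hη.continuous.bounded_above_of_compact_support hηc
  have hηφ : AEStronglyMeasurable (fun x => η (φ x)) (volume.restrict K) :=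
    (hη.continuous.comp_continuousOn hφ).aestronglyMeasurable hK.measurableSet
  have hadjm : Measurable fun x => adjMap (D x) := continuous_adjMap.measurable.comp hDm.measurable
  have hadjk : ∀ k, Continuous fun x => adjMap (fderiv ℝ (Φ k) x) := fun k =>
    continuous_adjMap.comp ((hΦ k).continuous_fderiv (by simp))
  have hb : ∀ (T : Euc n →L[ℝ] Euc n) (x : Euc n), ‖fderiv ℝ ζ x (T v)‖ₑ ≤
      ENNReal.ofReal (C₁ * ‖v‖) * ‖T‖ₑ := by
    intro T x
    have hC₁0 : 0 ≤ C₁ := (norm_nonneg _).trans (hC₁ x)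
    rw [← ofReal_norm, ← ofReal_norm, ← ENNReal.ofReal_mul (by positivity)]
    refine ENNReal.ofReal_le_ofReal (((fderiv ℝ ζ x).le_opNorm _).trans ?_)
    calc ‖fderiv ℝ ζ x‖ * ‖T v‖ ≤ C₁ * (‖T‖ * ‖v‖) := by
          gcongr
          · exact hC₁ x
          · exact T.le_opNorm v
      _ = C₁ * ‖v‖ * ‖T‖ := by ring
  have hηb : ∀ y, ‖η y‖ₑ ≤ ENNReal.ofReal C₂ := fun y => by
    rw [← ofReal_norm]
    exact ENNReal.ofReal_le_ofReal (hC₂ y)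
  have hDv : Measurable fun x => fderiv ℝ ζ x (adjMap (D x) v) :=
    (isBoundedBilinearMap_apply.continuous.measurable).comp
      (hζ'.measurable.prodMk (hadjm.apply_continuousLinearMap v))
  simp only [degInt_fderiv hζ hζc hη (hΦ _) v]
  refine Tendsto.neg ?_
  have hset : ∀ k, ∫ x, η (Φ k x) * fderiv ℝ ζ x (adjMap (fderiv ℝ (Φ k) x) v) =
      ∫ x in K, η (Φ k x) * fderiv ℝ ζ x (adjMap (fderiv ℝ (Φ k) x) v) := by
    intro k
    refine (setIntegral_eq_integral_of_forall_compl_eq_zero fun x hx => ?_).symm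
    have : fderiv ℝ ζ x = 0 := by
      by_contra h
      exact hx (hζK (tsupport_fderiv_subset ℝ (subset_tsupport _ h)))
    simp [this]
  simp only [hset]
  refine tendsto_integral_of_L1 _ (hηφ.mul hDv.aestronglyMeasurable) (Eventually.of_forall fun k =>
    (integrable_mul_fderiv_adjMap hζ hζc (hΦ k)
      (hη.continuous.comp (hΦ k).continuous) v).integrableOn) ?_
  have hlim2 : Tendsto (fun k => ∫⁻ x in K, ‖η (Φ k x) - η (φ x)‖ₑ *
      (ENNReal.ofReal (C₁ * ‖v‖) * ‖adjMap (D x)‖ₑ)) atTop (nhds (∫⁻ x in K, 0)) := by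
    refine tendsto_lintegral_of_dominated_convergence'
      (fun x => (ENNReal.ofReal C₂ + ENNReal.ofReal C₂) *
        (ENNReal.ofReal (C₁ * ‖v‖) * ‖adjMap (D x)‖ₑ)) (fun k => ?_) (fun k => ?_) ?_ ?_
    · exact (((hη.continuous.comp (hΦ k).continuous).aestronglyMeasurable.sub hηφ).enorm).mul
        ((hadjm.enorm.const_mul _).aemeasurable)
    · refine Eventually.of_forall fun x => ?_
      simp only
      gcongr
      exact (enorm_sub_le).trans (add_le_add (hηb _) (hηb _))
    · rw [lintegral_const_mul _ (hadjm.enorm.const_mul _), lintegral_const_mul _ hadjm.enorm]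
      finiteness
    · rw [ae_restrict_iff' hK.measurableSet]
      refine ae_of_all _ fun x hx => ?_
      have h1 : Tendsto (fun k => η (Φ k x) - η (φ x)) atTop (nhds 0) := by
        have h := (hη.continuous.tendsto (φ x)).comp (hu.tendsto_at hx)
        simpa using h.sub_const (η (φ x))
      have h2 : Tendsto (fun k => ‖η (Φ k x) - η (φ x)‖ₑ) atTop (nhds 0) := by
        simpa using h1.enorm
      simpa using ENNReal.Tendsto.mul_const h2
        (b := ENNReal.ofReal (C₁ * ‖v‖) * ‖adjMap (D x)‖ₑ) (Or.inr (by finiteness))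
  have hlim1 := ENNReal.Tendsto.const_mul (a := ENNReal.ofReal C₂ * ENNReal.ofReal (C₁ * ‖v‖)) hadj
    (Or.inr (by finiteness))
  have hlim := hlim1.add hlim2
  simp only [mul_zero, lintegral_zero, add_zero] at hlim
  refine tendsto_of_tendsto_of_tendsto_of_le_of_le tendsto_const_nhds hlim (fun _ => bot_le)
    fun k => ?_
  simp only
  have hm : Measurable fun x => ‖adjMap (fderiv ℝ (Φ k) x) - adjMap (D x)‖ₑ :=
    ((hadjk k).measurable.sub hadjm).enorm
  rw [← lintegral_const_mul _ hm, ← lintegral_add_left (hm.const_mul _)]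
  refine lintegral_mono fun x => ?_
  show ‖η (Φ k x) * fderiv ℝ ζ x (adjMap (fderiv ℝ (Φ k) x) v) -
      η (φ x) * fderiv ℝ ζ x (adjMap (D x) v)‖ₑ ≤ _
  have e1 : η (Φ k x) * fderiv ℝ ζ x (adjMap (fderiv ℝ (Φ k) x) v) -
      η (φ x) * fderiv ℝ ζ x (adjMap (D x) v) =
      η (Φ k x) * fderiv ℝ ζ x ((adjMap (fderiv ℝ (Φ k) x) - adjMap (D x)) v) +
      (η (Φ k x) - η (φ x)) * fderiv ℝ ζ x (adjMap (D x) v) := by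
    rw [sub_apply, map_sub]
    ring
  rw [e1]
  refine (enorm_add_le _ _).trans (add_le_add ?_ ?_)
  · rw [enorm_mul, mul_assoc]
    exact mul_le_mul' (hηb _) (hb _ _)
  · rw [enorm_mul]
    exact mul_le_mul' le_rfl (hb _ _)

lemma IsHomeoOn.integral_image {G : Type*} [NormedAddCommGroup G] [NormedSpace ℝ G]
    (hφ : IsHomeoOn φ Ω Ω') (hΩ : IsOpen Ω)
    (hN : LuzinN φ Ω) (hDm : StronglyMeasurable D) (hD : WeakDeriv φ D Ω) {E : Set (Euc n)}
    (hE : MeasurableSet E) (hEΩ : E ⊆ Ω) {g : Euc n → G}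
    (hg : AEStronglyMeasurable g (volume.restrict (φ '' E))) :
    ∫ y in φ '' E, g y = ∫ x in E, |jacobian D x| • g (φ x) := by
  have hJ : Measurable fun x => ENNReal.ofReal |jacobian D x| :=
    (measurable_jacobian hDm).norm.ennreal_ofReal
  have hψ : Measurable (E.piecewise φ fun _ => 0) :=
    (hφ.2.1.mono hEΩ).measurable_piecewise continuousOn_const hE
  have hmap : volume.restrict (φ '' E) = Measure.map (E.piecewise φ fun _ => 0)
      ((volume.restrict E).withDensity fun x => ENNReal.ofReal |jacobian D x|) := by
    ext s hs
    rw [Measure.map_apply hψ hs, withDensity_apply _ (hψ hs), ← lintegral_indicator_one hs,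
      hφ.lintegral_image hΩ hN hDm hD hE hEΩ, ← lintegral_indicator (hψ hs)]
    refine setLIntegral_congr_fun hE fun x hx => ?_
    simp only [indicator_apply, mem_preimage, piecewise_eq_of_mem _ _ _ hx]
    split_ifs <;> simp
  rw [hmap, integral_map hψ.aemeasurable (hmap ▸ hg), integral_withDensity_eq_integral_toReal_smul hJ
    (ae_of_all _ fun x => ENNReal.ofReal_lt_top)]
  refine setIntegral_congr_fun hE fun x hx => ?_
  simp [piecewise_eq_of_mem _ _ _ hx]

/-- The adjugate of `D x` divided by the absolute value of its determinant. -/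
def adjQuotient (D : Euc n → Euc n →L[ℝ] Euc n) (x : Euc n) : Euc n →L[ℝ] Euc n :=
  |jacobian D x|⁻¹ • adjMap (D x)

lemma measurable_adjQuotient (hDm : StronglyMeasurable D) : Measurable (adjQuotient D) :=
  (measurable_jacobian hDm).norm.inv.smul (continuous_adjMap.measurable.comp hDm.measurable)

lemma adjMap_zero (hn : 2 ≤ n) : adjMap (0 : Euc n →L[ℝ] Euc n) = 0 := by
  obtain ⟨C, -, hC⟩ := exists_norm_adjMap_le n
  have := hC 0
  rw [norm_zero, zero_pow (by omega), mul_zero] at this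
  exact norm_le_zero_iff.1 this

lemma FiniteDistortionOn.ae_smul_adjQuotient (hn : 2 ≤ n) (h : FiniteDistortionOn D Ω) :
    ∀ᵐ x ∂volume.restrict Ω, |jacobian D x| • adjQuotient D x = adjMap (D x) := by
  filter_upwards [h] with x hx
  by_cases hJ : jacobian D x = 0
  · rw [hx hJ, adjMap_zero hn, hJ, abs_zero]
    exact zero_smul ℝ (adjQuotient D x)
  · rw [adjQuotient, smul_smul, mul_inv_cancel₀ (abs_ne_zero.2 hJ)]
    exact one_smul ℝ _

lemma lintegral_adjMap_ne_top {s : Set (Euc n)} (h : ∫⁻ x in s, ‖D x‖ₑ ^ (n - 1) ≠ ∞) :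
    ∫⁻ x in s, ‖adjMap (D x)‖ₑ ≠ ∞ := by
  obtain ⟨C, hC0, hC⟩ := exists_norm_adjMap_le n
  have : ∀ x, ‖adjMap (D x)‖ₑ ≤ ENNReal.ofReal C * ‖D x‖ₑ ^ (n - 1) := by
    intro x
    rw [← ofReal_norm, ← ofReal_norm, ← ENNReal.ofReal_pow (norm_nonneg _),
      ← ENNReal.ofReal_mul hC0]
    exact ENNReal.ofReal_le_ofReal (hC _)
  refine ne_top_of_le_ne_top ?_ (lintegral_mono this)
  rw [lintegral_const_mul' _ _ ENNReal.ofReal_ne_top]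
  finiteness

lemma memLp_of_lintegral_pow_ne_top {s : Set (Euc n)} (hn : 2 ≤ n) (hDm : StronglyMeasurable D)
    (h : ∫⁻ x in s, ‖D x‖ₑ ^ (n - 1) ≠ ∞) :
    MemLp D (ENNReal.ofReal ((n - 1 : ℕ) : ℝ)) (volume.restrict s) := by
  refine ⟨hDm.aestronglyMeasurable, ?_⟩
  rw [ENNReal.ofReal_natCast, eLpNorm_lt_top_iff_lintegral_rpow_enorm_lt_top
    (Nat.cast_ne_zero.2 (by omega)) (ENNReal.natCast_ne_top _), ENNReal.toReal_natCast]
  simpa only [ENNReal.rpow_natCast, lt_top_iff_ne_top] using h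

lemma exists_eventually_norm_degInt_le (hn : 2 ≤ n) {χ h : Euc n → ℝ} {Φ : ℕ → Euc n → Euc n}
    (hχ : ContDiff ℝ (⊤ : ℕ∞) χ) (hc : HasCompactSupport χ)
    (hΦ : ∀ k, ContDiff ℝ (⊤ : ℕ∞) (Φ k)) {A : ℝ≥0∞} (hA : A ≠ ∞)
    (hΦA : ∀ᶠ k in atTop, ∫⁻ x in tsupport χ, ‖adjMap (fderiv ℝ (Φ k) x)‖ₑ ≤ A)
    (hh : Continuous h) (hhc : HasCompactSupport h) :
    ∃ R : ℝ, ∀ᶠ k in atTop, ‖degInt χ (Φ k) h‖ ≤ R := by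
  obtain ⟨C, hC, hCb⟩ := exists_enorm_degInt_le hn
  obtain ⟨M, hM⟩ := (hχ.continuous_fderiv (by simp)).bounded_above_of_compact_support (hc.fderiv ℝ)
  have hn0 : (n : ℝ) ≠ 0 := Nat.cast_ne_zero.2 (by omega)
  have hS : (∫⁻ y, ‖h y‖ₑ ^ (n : ℝ)) ^ (1 / (n : ℝ)) ≠ ∞ := by
    refine ENNReal.rpow_ne_top_of_nonneg (by positivity) ?_
    simpa using hhc.lintegral_enorm_pow_ne_top hh (m := n) (by omega)
  set S := (∫⁻ y, ‖h y‖ₑ ^ (n : ℝ)) ^ (1 / (n : ℝ))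
  refine ⟨(C * S * (ENNReal.ofReal M * A)).toReal, ?_⟩
  filter_upwards [hΦA] with k hk
  rw [← toReal_enorm]
  refine ENNReal.toReal_mono (by finiteness) ((hCb hχ hc (hΦ k) hh hhc).trans ?_)
  gcongr
  have hsupp : ∀ x, ‖fderiv ℝ χ x‖ₑ * ‖adjMap (fderiv ℝ (Φ k) x)‖ₑ ≤ (tsupport χ).indicator
      (fun x => ENNReal.ofReal M * ‖adjMap (fderiv ℝ (Φ k) x)‖ₑ) x := by
    intro x
    by_cases hx : x ∈ tsupport χ
    · rw [indicator_of_mem hx, ← ofReal_norm (fderiv ℝ χ x)]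
      gcongr
      exact hM x
    · have : fderiv ℝ χ x = 0 := by
        by_contra h
        exact hx (tsupport_fderiv_subset ℝ (subset_tsupport _ h))
      rw [this, ← ofReal_norm (0 : Euc n →L[ℝ] ℝ), norm_zero, ENNReal.ofReal_zero, zero_mul]
      exact bot_le
  refine (lintegral_mono hsupp).trans ?_
  rw [lintegral_indicator (isClosed_tsupport χ).measurableSet,
    lintegral_const_mul' _ _ ENNReal.ofReal_ne_top]
  gcongr

lemma fderiv_coord_mul_apply {χ : Euc n → ℝ} {V : Set (Euc n)} (hV : IsOpen V)
    (hχ1 : ∀ x ∈ V, χ x = 1) {x : Euc n} (hx : x ∈ V) (i : Fin n) (w : Euc n) :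
    fderiv ℝ (fun x : Euc n => x i * χ x) x w = w i := by
  have h1 : (fun x : Euc n => x i * χ x) =ᶠ[nhds x] (EuclideanSpace.proj i : Euc n →L[ℝ] ℝ) := by
    filter_upwards [hV.mem_nhds hx] with y hy
    simp [hχ1 y hy]
  rw [h1.fderiv_eq, ContinuousLinearMap.fderiv]
  rfl

lemma IsHomeoOn.exists_mul_integral_eq (hn : 2 ≤ n) (hφ : IsHomeoOn φ Ω Ω') (hΩ : IsOpen Ω)
    (hΩ' : IsOpen Ω') (hN : LuzinN φ Ω) (hDm : StronglyMeasurable D) (hD : WeakDeriv φ D Ω)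
    (hDq : ∀ K ⊆ Ω, IsCompact K → ∫⁻ x in K, ‖D x‖ₑ ^ (n - 1) ≠ ∞)
    {y₀ : Euc n} {r : ℝ} (hr : 0 < r) (hB : Metric.closedBall y₀ (2 * r) ⊆ Ω') :
    ∃ d : ℝ, ∀ η : Euc n → ℝ, ContDiff ℝ (⊤ : ℕ∞) η → HasCompactSupport η →
      tsupport η ⊆ Metric.ball y₀ r → ∀ (v : Euc n) (i : Fin n),
      d * ∫ y, Function.invFunOn φ Ω y i * fderiv ℝ η y v =
        -∫ x in Ω ∩ φ ⁻¹' Metric.ball y₀ r, η (φ x) * (adjMap (D x) v) i := by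
  have hBc : IsCompact (Metric.closedBall y₀ (2 * r)) := isCompact_closedBall _ _
  obtain ⟨χ, hχ, hc, hχΩ, -, V, hV, hBV, -, hχ1⟩ :=
    exists_smooth_cutoff (hφ.isCompact_inter_preimage hBc hB) hΩ inter_subset_left
  have hVB : ∀ x ∈ Ω, φ x ∈ Metric.closedBall y₀ (2 * r) → x ∈ V := fun x hx h => hBV ⟨hx, h⟩
  set K := tsupport χ with hK
  have hKc : IsCompact K := hc
  obtain ⟨Φ, hΦ, hu, hL⟩ := hD.exists_smooth_approx hΩ hφ.2.1 hKc hχΩ (p := ((n - 1 : ℕ) : ℝ))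
    (by exact_mod_cast (by omega : 1 ≤ n - 1))
    fun L hL hLc => memLp_of_lintegral_pow_ne_top hn hDm (hDq L hL hLc)
  simp only [ENNReal.rpow_natCast] at hL
  have hDK := lintegral_adjMap_ne_top (hDq K hχΩ hKc)
  have hadj := tendsto_lintegral_adjMap_sub (fun k => ((hΦ k).continuous_fderiv (by simp)).measurable)
    hDm.measurable (hDq K hχΩ hKc) hL
  have hadjm : Measurable fun x => ‖adjMap (D x)‖ₑ :=
    (continuous_adjMap.measurable.comp hDm.measurable).enorm
  set A : ℝ≥0∞ := 1 + ∫⁻ x in K, ‖adjMap (D x)‖ₑ with hAdef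
  have hA : A ≠ ∞ := by finiteness
  have hΦA : ∀ᶠ k in atTop, ∫⁻ x in K, ‖adjMap (fderiv ℝ (Φ k) x)‖ₑ ≤ A := by
    filter_upwards [ENNReal.tendsto_nhds_zero.1 hadj 1 one_pos] with k hk
    refine le_trans ?_ (add_le_add_left hk _)
    rw [← lintegral_add_right _ hadjm]
    refine lintegral_mono fun x => ?_
    simpa using enorm_add_le (adjMap (fderiv ℝ (Φ k) x) - adjMap (D x)) (adjMap (D x))
  let f : ContDiffBump y₀ := ⟨r / 4, r / 2, by positivity, by linarith⟩
  set h : Euc n → ℝ := f.normed volume with hhdef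
  have hh : Continuous h := f.continuous_normed
  have hhc : HasCompactSupport h := f.hasCompactSupport_normed
  have hhb : Function.support h ⊆ Metric.ball y₀ r := by
    rw [hhdef, f.support_normed_eq]
    exact Metric.ball_subset_ball (by show r / 2 ≤ r; linarith)
  have hh1 : ∫ y, h y = 1 := f.integral_normed
  obtain ⟨R, hR⟩ := exists_eventually_norm_degInt_le hn hχ hc hΦ hA hΦA hh hhc
  obtain ⟨d, -, s, hs, hd⟩ := tendsto_subseq_of_frequently_bounded
    (Metric.isBounded_closedBall (x := (0 : ℝ)) (r := R)) (x := fun k => degInt χ (Φ k) h)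
    ((hR.mono fun k hk => by simpa using hk).frequently)
  refine ⟨d, fun η hη hηc hηb v i => ?_⟩
  have hη' : Continuous fun y => fderiv ℝ η y v :=
    (hη.continuous_fderiv (by simp)).clm_apply continuous_const
  have hη'c : HasCompactSupport fun y => fderiv ℝ η y v := hηc.fderiv_apply ℝ v
  have hη'b : tsupport (fun y => fderiv ℝ η y v) ⊆ Metric.ball y₀ r :=
    (tsupport_fderiv_apply_subset ℝ v).trans hηb
  have hζ : ContDiff ℝ (⊤ : ℕ∞) fun x : Euc n => x i * χ x :=
    (EuclideanSpace.proj i : Euc n →L[ℝ] ℝ).contDiff.mul hχ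
  have hζK : tsupport (fun x : Euc n => x i * χ x) ⊆ K := tsupport_mul_subset_right
  have h1 := (tendsto_degInt_coord_sub hn hφ hΩ hΩ' hN hDm hD hr hB hχ hc hχΩ hV hVB hχ1 hΦ hu hA hΦA
    hh hhc hhb hh1 hη' hη'c hη'b i).comp hs.tendsto_atTop
  have h2 := (tendsto_degInt_fderiv hKc hζ hζK hη hηc (hφ.2.1.mono hχΩ) hDm hΦ hu hDK hadj v).comp
    hs.tendsto_atTop
  have h3 := h2.sub (hd.mul_const (∫ y, Function.invFunOn φ Ω y i * fderiv ℝ η y v))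
  have h4 := tendsto_nhds_unique h1 h3
  rw [← sub_eq_zero.1 h4.symm]
  congr 1
  have hUV : Ω ∩ φ ⁻¹' Metric.ball y₀ r ⊆ V := fun x hx => hVB x hx.1
    (Metric.ball_subset_closedBall (Metric.ball_subset_ball (by linarith) hx.2))
  have hVK : V ⊆ K := fun x hx => subset_tsupport _ (by simp [hχ1 x hx])
  rw [setIntegral_eq_of_subset_of_forall_sdiff_eq_zero hKc.measurableSet (hUV.trans hVK)
    fun x hx => ?_]
  · exact setIntegral_congr_fun (hφ.isOpen_inter_preimage hΩ Metric.isOpen_ball).measurableSet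
      fun x hx => by simp only [fderiv_coord_mul_apply hV hχ1 (hUV hx)]
  · have : η (φ x) = 0 := by
      by_contra h
      exact hx.2 ⟨hχΩ hx.1, hηb (subset_tsupport _ h)⟩
    rw [this, zero_mul]

lemma IsHomeoOn.image_inter_preimage (hφ : IsHomeoOn φ Ω Ω') {s : Set (Euc n)} (hs : s ⊆ Ω') :
    φ '' (Ω ∩ φ ⁻¹' s) = s := by
  rw [Set.image_inter_preimage, hφ.1.image_eq, inter_eq_right.2 hs]

lemma IsHomeoOn.ae_jacobian_invFunOn_ne_zero (hφ : IsHomeoOn φ Ω Ω') (hΩ : IsOpen Ω)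
    (hN : LuzinN φ Ω) (hDm : StronglyMeasurable D) (hD : WeakDeriv φ D Ω) (hΩ' : IsOpen Ω') :
    ∀ᵐ y ∂volume.restrict Ω', jacobian D (Function.invFunOn φ Ω y) ≠ 0 := by
  have hZ : MeasurableSet (Ω ∩ {x | jacobian D x = 0}) :=
    hΩ.measurableSet.inter (measurable_jacobian hDm (measurableSet_singleton 0))
  have h0 : volume (φ '' (Ω ∩ {x | jacobian D x = 0})) = 0 := by
    rw [hφ.volume_image hΩ hN hDm hD hZ inter_subset_left]
    refine (setLIntegral_congr_fun hZ fun x hx => ?_).trans lintegral_zero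
    simp [show jacobian D x = 0 from hx.2]
  rw [ae_restrict_iff' hΩ'.measurableSet]
  filter_upwards [measure_eq_zero_iff_ae_notMem.1 h0] with y hy hyΩ' hJ
  exact hy ⟨_, ⟨hφ.invFunOn_mem hyΩ', hJ⟩, hφ.apply_invFunOn hyΩ'⟩

lemma jacobian_eq_zero_of_adjQuotient_eq_zero (hn : 2 ≤ n) {x : Euc n}
    (h : adjQuotient D x = 0) : jacobian D x = 0 := by
  by_contra hJ
  have h1 : adjMap (D x) = 0 := (smul_eq_zero.1 h).resolve_left (inv_ne_zero (abs_ne_zero.2 hJ))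
  have h2 := apply_adjMap (D x) (EuclideanSpace.single ⟨0, by omega⟩ 1)
  rw [h1] at h2
  have h3 := (smul_eq_zero.1 (h2.symm.trans (map_zero (D x)))).resolve_left hJ
  simpa using congrArg norm h3

lemma IsHomeoOn.exists_weakDeriv_invFunOn_ball (hn : 2 ≤ n) (hφ : IsHomeoOn φ Ω Ω')
    (hΩ : IsOpen Ω) (hΩ' : IsOpen Ω') (hN : LuzinN φ Ω) (hDm : StronglyMeasurable D)
    (hD : WeakDeriv φ D Ω) (hfd : FiniteDistortionOn D Ω)
    (hDq : ∀ K ⊆ Ω, IsCompact K → ∫⁻ x in K, ‖D x‖ₑ ^ (n - 1) ≠ ∞)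
    {y₀ : Euc n} {r : ℝ} (hr : 0 < r) (hB : Metric.closedBall y₀ (2 * r) ⊆ Ω') :
    ∃ D', WeakDeriv (Function.invFunOn φ Ω) D' (Metric.ball y₀ r) := by
  set B := Metric.ball y₀ r with hBdef
  have hBB : B ⊆ Metric.closedBall y₀ (2 * r) :=
    (Metric.ball_subset_ball (by linarith)).trans Metric.ball_subset_closedBall
  have hBΩ' : B ⊆ Ω' := hBB.trans hB
  have hBm : MeasurableSet B := Metric.isOpen_ball.measurableSet
  set U := Ω ∩ φ ⁻¹' B with hU
  have hUo : IsOpen U := hφ.isOpen_inter_preimage hΩ Metric.isOpen_ball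
  have hUm := hUo.measurableSet
  have hUΩ : U ⊆ Ω := inter_subset_left
  have himg : φ '' U = B := hφ.image_inter_preimage hBΩ'
  set G : Euc n → Euc n →L[ℝ] Euc n :=
    Ω'.indicator fun y => adjQuotient D (Function.invFunOn φ Ω y) with hG
  have hGm : Measurable G :=
    hφ.measurable_indicator_comp_invFunOn hΩ' (measurable_adjQuotient hDm)
  have hGφ : ∀ x ∈ Ω, G (φ x) = adjQuotient D x := fun x hx => by
    rw [hG, indicator_of_mem (hφ.1.mapsTo hx), hφ.invFunOn_apply hx]
  have hae : ∀ᵐ x ∂volume.restrict U, |jacobian D x| • adjQuotient D x = adjMap (D x) :=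
    ae_restrict_of_ae_restrict_of_subset hUΩ (hfd.ae_smul_adjQuotient hn)
  have hGi : IntegrableOn G B := by
    refine ⟨hGm.aestronglyMeasurable, ?_⟩
    show ∫⁻ y in B, ‖G y‖ₑ < ∞
    rw [← himg, hφ.lintegral_image hΩ hN hDm hD hUm hUΩ]
    refine lt_of_le_of_lt (lintegral_mono_ae ?_) (lt_top_iff_ne_top.2 (lintegral_adjMap_ne_top
      (ne_top_of_le_ne_top (hDq _ inter_subset_left
        (hφ.isCompact_inter_preimage (isCompact_closedBall y₀ (2 * r)) hB))
        (lintegral_mono_set (inter_subset_inter_right Ω (preimage_mono hBB))))))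
    filter_upwards [hae, ae_restrict_mem hUm] with x hx hxU
    rw [hGφ x hxU.1, ← hx, ← ofReal_norm, ← ofReal_norm, norm_smul, Real.norm_eq_abs, abs_abs,
      ENNReal.ofReal_mul (abs_nonneg _)]
  have hGv : ∀ (v : Euc n) (i : Fin n), Measurable fun y => (G y v) i := fun v i =>
    (EuclideanSpace.proj i : Euc n →L[ℝ] ℝ).continuous.measurable.comp
      (hGm.apply_continuousLinearMap v)
  obtain ⟨d, hd⟩ := hφ.exists_mul_integral_eq hn hΩ hΩ' hN hDm hD hDq hr hB
  have hd' : ∀ η : Euc n → ℝ, ContDiff ℝ (⊤ : ℕ∞) η → HasCompactSupport η →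
      tsupport η ⊆ B → ∀ (v : Euc n) (i : Fin n),
      d * ∫ y, Function.invFunOn φ Ω y i * fderiv ℝ η y v = -∫ y in B, η y * (G y v) i := by
    intro η h1 h2 h3 v i
    have hm : Measurable fun y => η y * (G y v) i := h1.continuous.measurable.mul (hGv v i)
    rw [hd η h1 h2 h3 v i, ← himg,
      hφ.integral_image hΩ hN hDm hD hUm hUΩ hm.aestronglyMeasurable]
    congr 1
    refine integral_congr_ae ?_
    filter_upwards [hae, ae_restrict_mem hUm] with x hx hxU
    rw [hGφ x hxU.1, ← hx]
    simp only [smul_eq_mul, smul_apply, PiLp.smul_apply]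
    ring
  have hGc : ∀ (i : Fin n), IntegrableOn (fun y => (EuclideanSpace.proj i : Euc n →L[ℝ] ℝ).comp
      (G y)) B := fun i =>
    (ContinuousLinearMap.compL ℝ (Euc n) (Euc n) ℝ (EuclideanSpace.proj i)).integrable_comp hGi
  have hd0 : d ≠ 0 := by
    rintro rfl
    have h0 : ∀ v i, ∀ᵐ y, y ∈ B → (G y v) i = 0 := by
      intro v i
      refine Metric.isOpen_ball.ae_eq_zero_of_integral_contDiff_smul_eq_zero ?_
        fun η h1 h2 h3 => ?_
      · have := (ContinuousLinearMap.apply ℝ ℝ v).integrable_comp (hGc i)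
        exact IntegrableOn.locallyIntegrableOn this
      · rw [← setIntegral_smul_eq_of_tsupport_subset h3]
        have := hd' η h1 h2 h3 v i
        rw [zero_mul, eq_comm, neg_eq_zero] at this
        exact this
    have h1 : ∀ᵐ y, ∀ (j i : Fin n), y ∈ B → (G y (EuclideanSpace.single j 1)) i = 0 :=
      ae_all_iff.2 fun j => ae_all_iff.2 fun i => h0 _ i
    have h2 := (ae_restrict_iff' hΩ'.measurableSet).1
      (hφ.ae_jacobian_invFunOn_ne_zero hΩ hN hDm hD hΩ')
    have h3 : ∀ᵐ y, y ∉ B := by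
      filter_upwards [h1, h2] with y hy1 hy2 hyB
      refine hy2 (hBΩ' hyB) (jacobian_eq_zero_of_adjQuotient_eq_zero hn ?_)
      have : G y = 0 := by
        refine ContinuousLinearMap.coe_injective
          ((EuclideanSpace.basisFun (Fin n) ℝ).toBasis.ext fun j => ?_)
        ext i
        simpa using hy1 j i hyB
      rwa [hG, indicator_of_mem (hBΩ' hyB)] at this
    exact (Metric.measure_ball_pos volume y₀ hr).ne' (measure_eq_zero_iff_ae_notMem.2 h3)
  have hcont : ContinuousOn (Function.invFunOn φ Ω) B := hφ.2.2.mono hBΩ'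
  refine ⟨fun y => clmOfComponents fun i =>
    d⁻¹ • (EuclideanSpace.proj i : Euc n →L[ℝ] ℝ).comp (G y),
    WeakDeriv.of_components fun i => weakDeriv_iff.2 ⟨?_, ?_, fun η h1 h2 h3 v => ?_⟩⟩
  · exact ((EuclideanSpace.proj i : Euc n →L[ℝ] ℝ).continuous.comp_continuousOn
      hcont).locallyIntegrableOn hBm
  · exact IntegrableOn.locallyIntegrableOn (Integrable.smul d⁻¹ (hGc i))
  · rw [← setIntegral_smul_eq_of_tsupport_subset h3]
    have h4 := hd' η h1 h2 h3 v i
    have h5 : ∫ x in B, η x • (d⁻¹ • (EuclideanSpace.proj i : Euc n →L[ℝ] ℝ).comp (G x)) v =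
        d⁻¹ * ∫ y in B, η y * (G y v) i := by
      rw [← integral_const_mul]
      refine integral_congr_ae (ae_of_all _ fun x => ?_)
      simp only [smul_eq_mul, smul_apply, ContinuousLinearMap.comp_apply, EuclideanSpace.coe_proj]
      ring
    rw [h5, ← mul_neg, ← h4, inv_mul_cancel_left₀ hd0]
    simp only [smul_eq_mul, mul_comm]

end InverseDerivative

section InverseDerivative

variable {Ω Ω' : Set (Euc n)} {φ : Euc n → Euc n} {D D' : Euc n → Euc n →L[ℝ] Euc n}

lemma minStretch_pos_of_det_ne_zero (hn : 0 < n) {T : Euc n →L[ℝ] Euc n}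
    (hT : LinearMap.det (T : Euc n →ₗ[ℝ] Euc n) ≠ 0) : 0 < minStretch T := by
  refine (minStretch_nonneg T).lt_of_ne fun h => hT ?_
  have := abs_det_le_minStretch_mul hn T
  rw [← h, zero_mul] at this
  exact abs_nonpos_iff.1 this

lemma norm_le_inv_minStretch (hn : 0 < n) {T S : Euc n →L[ℝ] Euc n}
    (hT : LinearMap.det (T : Euc n →ₗ[ℝ] Euc n) ≠ 0)
    (h : T.comp S = ContinuousLinearMap.id ℝ (Euc n)) : ‖S‖ ≤ (minStretch T)⁻¹ := by
  have hl := minStretch_pos_of_det_ne_zero hn hT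
  refine S.opNorm_le_bound (inv_nonneg.2 hl.le) fun v => ?_
  rw [inv_mul_eq_div, le_div_iff₀ hl, mul_comm]
  have h1 : T (S v) = v := by
    rw [← ContinuousLinearMap.comp_apply, h, ContinuousLinearMap.id_apply]
  exact (minStretch_mul_norm_le T (S v)).trans_eq (by rw [h1])

lemma IsHomeoOn.ae_comp_eq_id (hφ : IsHomeoOn φ Ω Ω') (hΩ : IsOpen Ω) (hΩ' : IsOpen Ω')
    (hN : LuzinN φ Ω) (hDm : StronglyMeasurable D) (hD : WeakDeriv φ D Ω)
    (hDm' : StronglyMeasurable D') (hD' : WeakDeriv (Function.invFunOn φ Ω) D' Ω') :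
    ∀ᵐ y ∂volume.restrict Ω', (D (Function.invFunOn φ Ω y)).comp (D' y) =
      ContinuousLinearMap.id ℝ (Euc n) := by
  set ψ := Function.invFunOn φ Ω
  obtain ⟨A, hAm, hAΩ, hA0, hAd⟩ := hD'.exists_hasFDerivWithinAt hΩ' hφ.2.2 hDm'
  obtain ⟨B, hBm, hBΩ, hB0, hBd⟩ := hD.exists_hasFDerivWithinAt hΩ hφ.2.1 hDm
  have hB0' : volume (φ '' (Ω \ ⋃ k, B k)) = 0 := hN _ sdiff_subset hB0
  have hkl : ∀ k l, ∀ᵐ y, y ∈ A k ∩ φ '' B l →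
      (D (ψ y)).comp (D' y) = ContinuousLinearMap.id ℝ (Euc n) := by
    intro k l
    have hm : MeasurableSet (A k ∩ φ '' B l) :=
      (hAm k).inter (hφ.measurableSet_image (hBm l) (hBΩ l))
    have hmaps : MapsTo ψ (A k ∩ φ '' B l) (B l) := by
      rintro y ⟨-, x, hx, rfl⟩
      rwa [show ψ (φ x) = x from hφ.invFunOn_apply (hBΩ l hx)]
    have hder : ∀ y ∈ A k ∩ φ '' B l,
        HasFDerivWithinAt id ((D (ψ y)).comp (D' y)) (A k ∩ φ '' B l) y := by
      intro y hy
      refine ((hBd l _ (hmaps hy)).comp y ((hAd k y hy.1).mono inter_subset_left) hmaps).congr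
        (fun z hz => ?_) ?_
      · exact (hφ.apply_invFunOn (hAΩ k hz.1)).symm
      · exact (hφ.apply_invFunOn (hAΩ k hy.1)).symm
    have happ : ApproximatesLinearOn (id : Euc n → Euc n) (ContinuousLinearMap.id ℝ (Euc n))
        (A k ∩ φ '' B l) 0 := fun x _ y _ => by simp
    filter_upwards [(ae_restrict_iff' hm).1 (happ.norm_fderiv_sub_le volume hm _ hder)] with y hy hyA
    exact sub_eq_zero.1 (norm_le_zero_iff.1 (hy hyA))
  rw [ae_restrict_iff' hΩ'.measurableSet]
  filter_upwards [ae_all_iff.2 fun k => ae_all_iff.2 fun l => hkl k l,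
    measure_eq_zero_iff_ae_notMem.1 hA0, measure_eq_zero_iff_ae_notMem.1 hB0'] with y hy hyA hyB hyΩ
  have h1 : y ∈ ⋃ k, A k := by
    by_contra h
    exact hyA ⟨hyΩ, h⟩
  have h2 : ψ y ∈ ⋃ k, B k := by
    by_contra h
    exact hyB ⟨ψ y, ⟨hφ.invFunOn_mem hyΩ, h⟩, hφ.apply_invFunOn hyΩ⟩
  obtain ⟨k, hk⟩ := mem_iUnion.1 h1
  obtain ⟨l, hl⟩ := mem_iUnion.1 h2
  exact hy k l ⟨hk, ψ y, hl, hφ.apply_invFunOn hyΩ⟩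

lemma IsHomeoOn.exists_weakDeriv_invFunOn (hn : 2 ≤ n) (hφ : IsHomeoOn φ Ω Ω')
    (hΩ : IsOpen Ω) (hΩ' : IsOpen Ω') (hN : LuzinN φ Ω) (hDm : StronglyMeasurable D)
    (hD : WeakDeriv φ D Ω) (hfd : FiniteDistortionOn D Ω)
    (hDq : ∀ K ⊆ Ω, IsCompact K → ∫⁻ x in K, ‖D x‖ₑ ^ (n - 1) ≠ ∞) :
    ∃ D', StronglyMeasurable D' ∧ (∀ y ∉ Ω', D' y = 0) ∧
      WeakDeriv (Function.invFunOn φ Ω) D' Ω' ∧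
      ∀ᵐ y ∂volume.restrict Ω', ‖D' y‖ ≤ (minStretch (D (Function.invFunOn φ Ω y)))⁻¹ := by
  obtain ⟨D', h1, h2, h3⟩ := WeakDeriv.exists_of_locally (u := Function.invFunOn φ Ω) hΩ'
    fun y hy => by
      obtain ⟨R, hR, hRb⟩ := Metric.nhds_basis_closedBall.mem_iff.1 (hΩ'.mem_nhds hy)
      have hB : Metric.closedBall y (2 * (R / 2)) ⊆ Ω' := by rwa [mul_div_cancel₀ _ two_ne_zero]
      exact ⟨Metric.ball y (R / 2), Metric.isOpen_ball, Metric.mem_ball_self (half_pos hR),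
        (Metric.ball_subset_ball (by linarith)).trans (Metric.ball_subset_closedBall.trans hB),
        hφ.exists_weakDeriv_invFunOn_ball hn hΩ hΩ' hN hDm hD hfd hDq (half_pos hR) hB⟩
  refine ⟨D', h1, h2, h3, ?_⟩
  filter_upwards [hφ.ae_comp_eq_id hΩ hΩ' hN hDm hD h1 h3,
    hφ.ae_jacobian_invFunOn_ne_zero hΩ hN hDm hD hΩ'] with y hy hJ
  exact norm_le_inv_minStretch (by omega) hJ hy

lemma IsHomeoOn.lintegral_mul_enorm_pow_le (hn : 2 ≤ n) (hφ : IsHomeoOn φ Ω Ω')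
    (hΩ : IsOpen Ω) (hΩ' : IsOpen Ω') (hN : LuzinN φ Ω) (hDm : StronglyMeasurable D)
    (hD : WeakDeriv φ D Ω) (hD' : ∀ᵐ y ∂volume.restrict Ω',
      ‖D' y‖ ≤ (minStretch (D (Function.invFunOn φ Ω y)))⁻¹) (ρ : Euc n → ℝ≥0∞) :
    ∫⁻ y in Ω', (ρ (Function.invFunOn φ Ω y) * ‖D' y‖ₑ) ^ n ≤
      ∫⁻ x in Ω, innerDil D x * ρ x ^ n := by
  rw [← hφ.1.image_eq, hφ.lintegral_image hΩ hN hDm hD hΩ.measurableSet subset_rfl]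
  rw [ae_restrict_iff' hΩ'.measurableSet, ae_iff] at hD'
  refine lintegral_mono_ae ?_
  filter_upwards [hφ.ae_notMem_of_null hΩ hN hDm hD hD', ae_restrict_mem hΩ.measurableSet]
    with x hx hxΩ
  by_cases hJ : jacobian D x = 0
  · simp [hJ]
  have h1 := not_not.1 (hx hJ) (hφ.1.mapsTo hxΩ)
  rw [hφ.invFunOn_apply hxΩ] at h1 ⊢
  have hl : 0 < minStretch (D x) := minStretch_pos_of_det_ne_zero (by omega) hJ
  rw [innerDil, if_neg hJ, mul_pow, div_eq_mul_inv, ENNReal.ofReal_mul (abs_nonneg _), mul_assoc]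
  refine mul_le_mul_right ?_ _
  rw [mul_comm]
  refine mul_le_mul_left ?_ _
  rw [← ofReal_norm, ← ENNReal.ofReal_pow (norm_nonneg _), ← inv_pow]
  exact ENNReal.ofReal_le_ofReal (pow_le_pow_left₀ (norm_nonneg _) h1 n)

end InverseDerivative

/-- `c : [0, L] → ℝⁿ` is the natural parametrization of the curve `γ`, obtained from `γ` through
the arclength function `σ`, which is onto `[0, L]`. -/
structure Curve.IsNaturalParam (γ : Curve n) (L : ℝ) (c : ℝ → Euc n) (σ : ℝ → ℝ) : Prop where
  nonneg : 0 ≤ L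
  monotoneOn : MonotoneOn σ (Icc γ.a γ.b)
  left : σ γ.a = 0
  right : σ γ.b = L
  surjOn : SurjOn σ (Icc γ.a γ.b) (Icc 0 L)
  eq : ∀ t ∈ Icc γ.a γ.b, γ.toFun t = c (σ t)
  unitSpeed : HasUnitSpeedOn c (Icc 0 L)
  eVariationOn_eq : ∀ s ∈ Icc γ.a γ.b, ∀ t ∈ Icc γ.a γ.b, s ≤ t →
    eVariationOn γ.toFun (Icc s t) = ENNReal.ofReal (σ t - σ s)

lemma variationOnFromTo.continuousOn {f : ℝ → Euc n} {s : Set ℝ} {a : ℝ}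
    (hf : LocallyBoundedVariationOn f s) (ha : a ∈ s) (hc : ContinuousOn f s) :
    ContinuousOn (variationOnFromTo f s a) s := by
  intro b hb
  have hl : ContinuousWithinAt (variationOnFromTo f s a) (s ∩ Iio b) b := by
    have := variationOnFromTo.tendsto_left ha hb hf ((hc b hb).mono inter_subset_left)
    rwa [dist_self, sub_zero] at this
  have hr : ContinuousWithinAt (variationOnFromTo f s a) (s ∩ Ioi b) b := by
    have := variationOnFromTo.tendsto_right ha hb hf ((hc b hb).mono inter_subset_left)
    rwa [dist_self, add_zero] at this
  have hm : ContinuousWithinAt (variationOnFromTo f s a) {b} b := continuousWithinAt_singleton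
  refine ((hl.union hm).union hr).mono fun x hx => ?_
  rcases lt_trichotomy x b with h | h | h
  · exact Or.inl (Or.inl ⟨hx, h⟩)
  · exact Or.inl (Or.inr h)
  · exact Or.inr ⟨hx, h⟩

lemma Curve.exists_isNaturalParam {γ : Curve n} (hp : γ.IsPath) (hr : γ.Rectifiable) :
    ∃ L c σ, γ.IsNaturalParam L c σ := by
  set f := γ.toFun
  set s := Icc γ.a γ.b
  have hf : LocallyBoundedVariationOn f s := BoundedVariationOn.locallyBoundedVariationOn hr.ne
  have ha : γ.a ∈ s := left_mem_Icc.2 γ.hab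
  have hb : γ.b ∈ s := right_mem_Icc.2 γ.hab
  set σ := variationOnFromTo f s γ.a
  have hσ : MonotoneOn σ s := variationOnFromTo.monotoneOn hf ha
  have h0 : σ γ.a = 0 := variationOnFromTo.self f s γ.a
  have hsurj : SurjOn σ s (Icc 0 (σ γ.b)) := by
    rw [← h0]
    exact intermediate_value_Icc γ.hab (variationOnFromTo.continuousOn hf ha hp)
  have himg : σ '' s = Icc 0 (σ γ.b) := by
    refine Subset.antisymm ?_ hsurj
    rintro _ ⟨t, ht, rfl⟩
    exact ⟨h0 ▸ hσ ha ht ht.1, hσ ht hb ht.2⟩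
  refine ⟨σ γ.b, naturalParameterization f s γ.a, σ,
    variationOnFromTo.nonneg_of_le f s γ.hab, hσ, h0, rfl, hsurj, fun t ht =>
    (edist_eq_zero.1 (edist_naturalParameterization_eq_zero hf ha ht)).symm,
    himg ▸ has_unit_speed_naturalParameterization f hf ha, fun t₁ h₁ t₂ h₂ h => ?_⟩
  rw [variationOnFromTo.sub_right hf ha h₂ h₁, variationOnFromTo.eq_of_le f s h,
    ENNReal.ofReal_toReal (hf t₁ t₂ h₁ h₂), inter_eq_right.2 (Icc_subset_Icc h₁.1 h₂.2)]

lemma HasUnitSpeedOn.lipschitzOnWith {c : ℝ → Euc n} {s : Set ℝ} (h : HasUnitSpeedOn c s) :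
    LipschitzOnWith 1 c s := by
  have key : ∀ x ∈ s, ∀ y ∈ s, x ≤ y → edist (c x) (c y) ≤ edist x y := by
    intro x hx y hy hxy
    refine (eVariationOn.edist_le c (s := s ∩ Icc x y) ⟨hx, le_rfl, hxy⟩ ⟨hy, hxy, le_rfl⟩).trans ?_
    rw [h hx hy, NNReal.coe_one, one_mul, edist_comm, edist_dist, Real.dist_eq,
      abs_of_nonneg (sub_nonneg.2 hxy)]
  intro x hx y hy
  rw [ENNReal.coe_one, one_mul]
  rcases le_total x y with hxy | hxy
  · exact key x hx y hy hxy
  · rw [edist_comm, edist_comm x]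
    exact key y hy x hx hxy

lemma Curve.IsNaturalParam.mapsTo {γ : Curve n} {L : ℝ} {c : ℝ → Euc n} {σ : ℝ → ℝ}
    (h : γ.IsNaturalParam L c σ) : MapsTo σ (Icc γ.a γ.b) (Icc 0 L) := fun _ ht =>
  ⟨h.left ▸ h.monotoneOn (left_mem_Icc.2 γ.hab) ht ht.1,
    h.right ▸ h.monotoneOn ht (right_mem_Icc.2 γ.hab) ht.2⟩

lemma HasUnitSpeedOn.eVariationOn_Icc {c : ℝ → Euc n} {a b s t : ℝ}
    (h : HasUnitSpeedOn c (Icc a b)) (hs : s ∈ Icc a b) (ht : t ∈ Icc a b) :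
    eVariationOn c (Icc s t) = ENNReal.ofReal (t - s) := by
  rw [← inter_eq_right.2 (Icc_subset_Icc hs.1 ht.2), h hs ht, NNReal.coe_one, one_mul]

lemma Curve.IsNaturalParam.isArclengthParam {γ : Curve n} {L : ℝ} {c : ℝ → Euc n} {σ : ℝ → ℝ}
    (h : γ.IsNaturalParam L c σ) : γ.IsArclengthParam L c := by
  refine ⟨h.nonneg, fun t ht => ?_, σ, h.monotoneOn, h.left, h.right, h.mapsTo, h.eq⟩
  rw [h.unitSpeed.eVariationOn_Icc (left_mem_Icc.2 h.nonneg) ht, sub_zero]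

lemma Curve.IsArclengthParam.hasUnitSpeedOn {γ : Curve n} {L : ℝ} {c : ℝ → Euc n}
    (h : γ.IsArclengthParam L c) : HasUnitSpeedOn c (Icc 0 L) := by
  refine hasConstantSpeedOnWith_iff_ordered.2 fun x hx y hy hxy => ?_
  have hadd := eVariationOn.Icc_add_Icc c (s := univ) hx.1 hxy (mem_univ x)
  simp only [univ_inter] at hadd
  rw [h.2.1 x hx, h.2.1 y hy] at hadd
  rw [inter_eq_right.2 (Icc_subset_Icc hx.1 hy.2), NNReal.coe_one, one_mul,
    ENNReal.ofReal_sub _ hx.1, ← hadd, ENNReal.add_sub_cancel_left ENNReal.ofReal_ne_top]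

lemma Real.measure_le_of_Icc {μ ν : Measure ℝ} [IsFiniteMeasure μ] [IsFiniteMeasure ν]
    (h : ∀ p q, μ (Icc p q) ≤ ν (Icc p q)) : μ ≤ ν := by
  refine Measure.le_intro fun s _ _ => ?_
  refine (Besicovitch.vitaliFamily μ).measure_le_of_frequently_le ν
    Measure.AbsolutelyContinuous.rfl s fun x _ => ?_
  refine (Besicovitch.tendsto_filterAt μ x).frequently (Eventually.frequently ?_)
  refine Eventually.of_forall fun r => ?_
  rw [Real.closedBall_eq_Icc]
  exact h _ _

lemma lintegral_comp_le_of_monotoneOn {κ : ℝ → ℝ} {l L : ℝ} {G F : ℝ → ℝ≥0∞}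
    (hκ : MonotoneOn κ (Icc 0 l)) (hκL : MapsTo κ (Icc 0 l) (Icc 0 L))
    (hG : AEMeasurable G (volume.restrict (Icc 0 L))) (hG' : (∫⁻ s in Icc 0 L, G s) ≠ ∞)
    (h : ∀ w₁ ∈ Icc 0 l, ∀ w₂ ∈ Icc 0 l, w₁ ≤ w₂ →
      ENNReal.ofReal (w₂ - w₁) ≤ ∫⁻ s in Icc (κ w₁) (κ w₂), G s)
    (hF : Measurable F) :
    ∫⁻ w in Icc 0 l, F (κ w) ≤ ∫⁻ s in Icc 0 L, F s * G s := by
  have hκm : AEMeasurable κ (volume.restrict (Icc 0 l)) :=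
    aemeasurable_restrict_of_monotoneOn measurableSet_Icc hκ
  set μ := (volume.restrict (Icc 0 l)).map κ
  set ν := (volume.restrict (Icc 0 L)).withDensity G
  have hfin : IsFiniteMeasure ν := isFiniteMeasure_withDensity hG'
  have hle : μ ≤ ν := by
    refine Real.measure_le_of_Icc fun p q => ?_
    rw [Measure.map_apply_of_aemeasurable hκm measurableSet_Icc,
      Measure.restrict_apply' measurableSet_Icc, withDensity_apply _ measurableSet_Icc,
      Measure.restrict_restrict measurableSet_Icc]
    refine (Real.volume_le_diam _).trans (Metric.ediam_le fun w₁ h₁ w₂ h₂ => ?_)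
    have key : ∀ w₁ ∈ κ ⁻¹' Icc p q ∩ Icc 0 l, ∀ w₂ ∈ κ ⁻¹' Icc p q ∩ Icc 0 l, w₁ ≤ w₂ →
        edist w₁ w₂ ≤ ∫⁻ s in Icc p q ∩ Icc 0 L, G s := by
      intro w₁ h₁ w₂ h₂ h₁₂
      rw [edist_comm, edist_dist, Real.dist_eq, abs_of_nonneg (sub_nonneg.2 h₁₂)]
      exact (h w₁ h₁.2 w₂ h₂.2 h₁₂).trans (lintegral_mono_set (subset_inter
        (Icc_subset_Icc h₁.1.1 h₂.1.2) (Icc_subset_Icc (hκL h₁.2).1 (hκL h₂.2).2)))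
    rcases le_total w₁ w₂ with h' | h'
    · exact key w₁ h₁ w₂ h₂ h'
    · rw [edist_comm]
      exact key w₂ h₂ w₁ h₁ h'
  calc ∫⁻ w in Icc 0 l, F (κ w) = ∫⁻ s, F s ∂μ := (lintegral_map' hF.aemeasurable hκm).symm
    _ ≤ ∫⁻ s, F s ∂ν := lintegral_mono' hle le_rfl
    _ = ∫⁻ s in Icc 0 L, F s * G s := by
      rw [lintegral_withDensity_eq_lintegral_mul₀ hG hF.aemeasurable]
      exact lintegral_congr fun s => mul_comm _ _

/-- The natural parametrization minimizes the integrals along arclength parametrizations. -/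
lemma Curve.IsNaturalParam.lintegral_le {γ : Curve n} {L l : ℝ} {c c' : ℝ → Euc n} {σ : ℝ → ℝ}
    (h : γ.IsNaturalParam L c σ) (h' : γ.IsArclengthParam l c') {f : Euc n → ℝ≥0∞}
    (hf : Measurable f) : ∫⁻ s in Icc 0 L, f (c s) ≤ ∫⁻ s in Icc 0 l, f (c' s) := by
  have hu := h'.hasUnitSpeedOn
  obtain ⟨hl, -, σ', hσ', -, -, hmaps, heq⟩ := h'
  have hsurj : ∀ u ∈ Icc 0 L, ∃ t ∈ Icc γ.a γ.b, σ t = u := h.surjOn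
  choose! t htmem ht using hsurj
  have hmono : ∀ u₁ ∈ Icc 0 L, ∀ u₂ ∈ Icc 0 L, u₁ ≤ u₂ → u₁ = u₂ ∨ t u₁ ≤ t u₂ := by
    intro u₁ h₁ u₂ h₂ h₁₂
    rcases le_total (t u₁) (t u₂) with h | h'
    · exact Or.inr h
    · left
      have := h.monotoneOn (htmem _ h₂) (htmem _ h₁) h'
      rw [ht _ h₁, ht _ h₂] at this
      exact le_antisymm h₁₂ this
  have hc'm : ContinuousOn c' (Icc 0 l) := hu.lipschitzOnWith.continuousOn
  have hmeas : Measurable fun s => f (c' (projIcc 0 l hl s)) :=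
    hf.comp ((hc'm.comp_continuous (continuous_subtype_val.comp continuous_projIcc)
      fun s => (projIcc 0 l hl s).2).measurable)
  have hmapsκ : MapsTo (fun u => σ' (t u)) (Icc 0 L) (Icc 0 l) := fun u hu => hmaps _ (htmem _ hu)
  have key := lintegral_comp_le_of_monotoneOn (κ := fun u => σ' (t u)) (l := L) (L := l)
    (G := fun _ => 1) (F := fun s => f (c' (projIcc 0 l hl s))) ?_ hmapsκ aemeasurable_const
    (by simp) ?_ hmeas
  · refine le_of_eq_of_le (setLIntegral_congr_fun measurableSet_Icc fun u hu => ?_)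
      (key.trans_eq (setLIntegral_congr_fun measurableSet_Icc fun s hs => ?_))
    · rw [projIcc_of_mem hl (hmapsκ hu), ← heq _ (htmem _ hu), h.eq _ (htmem _ hu), ht _ hu]
    · rw [projIcc_of_mem hl hs, mul_one]
  · intro u₁ h₁ u₂ h₂ h₁₂
    rcases hmono u₁ h₁ u₂ h₂ h₁₂ with rfl | h
    · exact le_rfl
    · exact hσ' (htmem _ h₁) (htmem _ h₂) h
  · intro u₁ h₁ u₂ h₂ h₁₂
    rcases hmono u₁ h₁ u₂ h₂ h₁₂ with rfl | h₁₂'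
    · simp
    · rw [lintegral_one, Measure.restrict_apply_univ, Real.volume_Icc]
      have hsub : Icc (t u₁) (t u₂) ⊆ Icc γ.a γ.b := Icc_subset_Icc (htmem _ h₁).1 (htmem _ h₂).2
      have e := h.eVariationOn_eq _ (htmem _ h₁) _ (htmem _ h₂) h₁₂'
      rw [ht _ h₁, ht _ h₂] at e
      rw [← e, eVariationOn.eq_of_eqOn (f' := c' ∘ σ') fun s hs => heq s (hsub hs),
        ← hu.eVariationOn_Icc (hmaps _ (htmem _ h₁)) (hmaps _ (htmem _ h₂))]
      refine eVariationOn.comp_le_of_monotoneOn _ _ (hσ'.mono hsub) fun s hs => ?_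
      exact ⟨hσ' (htmem _ h₁) (hsub hs) hs.1, hσ' (hsub hs) (htmem _ h₂) hs.2⟩

/-- Smooth maps `v k` converging to `u` on `U`, with derivatives converging to `D` locally
uniformly with respect to the weight `h`. -/
structure IsWeightedApprox (u : Euc n → Euc n) (D : Euc n → Euc n →L[ℝ] Euc n) (U : Set (Euc n))
    (v : ℕ → Euc n → Euc n) (h : Euc n → ℝ≥0∞) : Prop where
  contDiff : ∀ k, ContDiff ℝ (⊤ : ℕ∞) (v k)
  measurable : Measurable h
  tendsto : ∀ x ∈ U, Tendsto (fun k => v k x) atTop (nhds (u x))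
  enorm_sub_le : ∀ K ⊆ U, IsCompact K →
    ∀ᶠ k in atTop, ∀ x ∈ K, ‖fderiv ℝ (v k) x - D x‖ₑ ≤ 2⁻¹ ^ k * h x

lemma IsOpen.exists_compact_exhaustion_superset {U : Set (Euc n)} (hU : IsOpen U) :
    ∃ K : ℕ → Set (Euc n), (∀ k, IsCompact (K k)) ∧ (∀ k, K k ⊆ U) ∧
      ∀ L ⊆ U, IsCompact L → ∀ᶠ k in atTop, L ⊆ K k := by
  have : LocallyCompactSpace U := hU.locallyCompactSpace
  let E := CompactExhaustion.choice U
  refine ⟨fun k => Subtype.val '' E k, fun k => (E.isCompact k).image continuous_subtype_val,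
    fun k => Subtype.coe_image_subset U _, fun L hL hLc => ?_⟩
  have hL' : IsCompact (Subtype.val ⁻¹' L : Set U) := by
    rw [Subtype.isCompact_iff, Subtype.image_preimage_coe, inter_eq_right.2 hL]
    exact hLc
  obtain ⟨N, hN⟩ := E.exists_superset_of_isCompact hL'
  filter_upwards [eventually_ge_atTop N] with k hk x hx
  exact ⟨⟨x, hL hx⟩, E.subset hk (hN hx), rfl⟩

lemma WeakDeriv.exists_isWeightedApprox {u : Euc n → Euc n}
    {D : Euc n → Euc n →L[ℝ] Euc n} {U : Set (Euc n)} (hn : 1 ≤ n) (hU : IsOpen U)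
    (h : WeakDeriv u D U) (hu : ContinuousOn u U) (hDm : StronglyMeasurable D)
    (hD : (∫⁻ x in U, ‖D x‖ₑ ^ n) ≠ ∞) :
    ∃ v w, IsWeightedApprox u D U v w ∧ (∫⁻ x, w x ^ n) ≠ ∞ := by
  have hDp : ∀ K ⊆ U, IsCompact K → MemLp D (ENNReal.ofReal (n : ℝ)) (volume.restrict K) := by
    intro K hK _
    refine ⟨hDm.aestronglyMeasurable, ?_⟩
    rw [ENNReal.ofReal_natCast, eLpNorm_lt_top_iff_lintegral_rpow_enorm_lt_top
      (Nat.cast_ne_zero.2 (by omega)) (ENNReal.natCast_ne_top _), ENNReal.toReal_natCast]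
    simp only [ENNReal.rpow_natCast]
    exact (lintegral_mono_set hK).trans_lt hD.lt_top
  obtain ⟨K, hKc, hKU, hKex⟩ := hU.exists_compact_exhaustion_superset
  have hstep : ∀ k, ∃ v : Euc n → Euc n, ContDiff ℝ (⊤ : ℕ∞) v ∧
      (∀ x ∈ K k, dist (u x) (v x) < 1 / ((k : ℝ) + 1)) ∧
      ∫⁻ x in K k, ‖fderiv ℝ v x - D x‖ₑ ^ n ≤ 2⁻¹ ^ (k * n) * 2⁻¹ ^ k := by
    intro k
    obtain ⟨v, hv, hvu, hvD⟩ := h.exists_smooth_approx hU hu (hKc k) (hKU k)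
      (by exact_mod_cast hn) hDp
    simp only [ENNReal.rpow_natCast] at hvD
    have hpos : (0 : ℝ≥0∞) < 2⁻¹ ^ (k * n) * 2⁻¹ ^ k := by
      rw [← pow_add]
      exact ENNReal.pow_pos (ENNReal.inv_pos.2 (by simp)) _
    obtain ⟨j, hj, hj'⟩ := ((Metric.tendstoUniformlyOn_iff.1 hvu _ (Nat.one_div_pos_of_nat (n := k))).and
      (ENNReal.tendsto_nhds_zero.1 hvD _ hpos)).exists
    exact ⟨v j, hv j, hj, hj'⟩
  choose v hv hvu hvD using hstep
  set f : ℕ → Euc n → ℝ≥0∞ := fun k => (K k).indicator fun x => ‖fderiv ℝ (v k) x - D x‖ₑ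
  have hfm : ∀ k, Measurable (f k) := fun k =>
    ((((hv k).continuous_fderiv (by simp)).measurable.sub hDm.measurable).enorm).indicator
      (hKc k).measurableSet
  have hfmem : ∀ k, ∀ x ∈ K k, f k x = ‖fderiv ℝ (v k) x - D x‖ₑ := fun k x hx =>
    indicator_of_mem hx _
  have hwm : ∀ k, Measurable fun x => 2 ^ k * f k x := fun k => (hfm k).const_mul _
  refine ⟨v, fun x => ⨆ k, 2 ^ k * f k x, ⟨hv, .iSup hwm, fun x hx => ?_, ?_⟩, ?_⟩
  · refine tendsto_iff_dist_tendsto_zero.2 ?_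
    refine squeeze_zero' (Eventually.of_forall fun _ => dist_nonneg) ?_
      tendsto_one_div_add_atTop_nhds_zero_nat
    filter_upwards [hKex {x} (singleton_subset_iff.2 hx) isCompact_singleton] with k hk
    rw [dist_comm]
    exact (hvu k x (hk rfl)).le
  · intro L hL hLc
    filter_upwards [hKex L hL hLc] with k hk x hx
    rw [← hfmem k x (hk hx)]
    calc f k x = 2⁻¹ ^ k * (2 ^ k * f k x) := by
          rw [← mul_assoc, ← mul_pow, ENNReal.inv_mul_cancel (by simp) (by simp), one_pow, one_mul]
      _ ≤ _ := mul_le_mul_right (le_iSup (fun k => 2 ^ k * f k x) k) _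
  · have hpt : ∀ x, (⨆ k, 2 ^ k * f k x) ^ n ≤ ∑' k, (2 ^ k * f k x) ^ n := fun x => by
      rw [ENNReal.iSup_pow_of_ne_zero (by omega)]
      exact iSup_le fun k => ENNReal.le_tsum k
    refine ne_top_of_le_ne_top ?_ (lintegral_mono hpt)
    rw [lintegral_tsum fun k => ((hwm k).pow_const n).aemeasurable]
    refine ne_top_of_le_ne_top (b := ∑' k, 2⁻¹ ^ k) (by rw [ENNReal.tsum_geometric]; norm_num)
      (ENNReal.tsum_le_tsum fun k => ?_)
    calc ∫⁻ x, (2 ^ k * f k x) ^ n = 2 ^ (k * n) * ∫⁻ x, f k x ^ n := by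
          simp only [mul_pow, ← pow_mul]
          exact lintegral_const_mul _ ((hfm k).pow_const n)
      _ = 2 ^ (k * n) * ∫⁻ x in K k, ‖fderiv ℝ (v k) x - D x‖ₑ ^ n := by
          congr 1
          rw [← lintegral_indicator (hKc k).measurableSet]
          refine lintegral_congr fun x => ?_
          by_cases hx : x ∈ K k
          · rw [hfmem k x hx, indicator_of_mem hx]
          · rw [indicator_of_notMem hx, show f k x = 0 from indicator_of_notMem hx _,
              zero_pow (by omega)]
      _ ≤ 2 ^ (k * n) * (2⁻¹ ^ (k * n) * 2⁻¹ ^ k) := mul_le_mul_right (hvD k) _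
      _ = 2⁻¹ ^ k := by
          rw [← mul_assoc, ← mul_pow, ENNReal.mul_inv_cancel (by simp) (by simp), one_pow, one_mul]

lemma enorm_le_enorm_add_enorm_sub (a b : F) :
    ‖a‖ₑ ≤ ‖b‖ₑ + ‖a - b‖ₑ ∧ ‖b‖ₑ ≤ ‖a‖ₑ + ‖a - b‖ₑ := by
  refine ⟨?_, ?_⟩
  · simpa only [add_sub_cancel] using enorm_add_le b (a - b)
  · rw [enorm_sub_rev]
    simpa only [add_sub_cancel] using enorm_add_le a (b - a)

lemma LipschitzWith.enorm_comp_sub_comp_le {v : Euc n → Euc n} (hv : ContDiff ℝ (⊤ : ℕ∞) v)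
    {c : ℝ → Euc n} (hc : LipschitzWith 1 c) {p q : ℝ} (hpq : p ≤ q) :
    ‖v (c q) - v (c p)‖ₑ ≤ ∫⁻ s in Icc p q, ‖fderiv ℝ v (c s)‖ₑ := by
  have hDc : Continuous fun s => ‖fderiv ℝ v (c s)‖ :=
    ((hv.continuous_fderiv (by simp)).comp hc.continuous).norm
  have hfc : Continuous fun s => ‖v (c s) - v (c p)‖ :=
    ((hv.continuous.comp hc.continuous).sub continuous_const).norm
  have hB : ∀ x, HasDerivAt (fun s => ∫ t in p..s, ‖fderiv ℝ v (c t)‖) ‖fderiv ℝ v (c x)‖ x :=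
    fun x => intervalIntegral.integral_hasDerivAt_right (hDc.intervalIntegrable _ _)
      (hDc.stronglyMeasurableAtFilter _ _) hDc.continuousAt
  have key := image_le_of_liminf_slope_right_le_deriv_boundary (a := p) (b := q) hfc.continuousOn
    (B := fun s => ∫ t in p..s, ‖fderiv ℝ v (c t)‖) (B' := fun s => ‖fderiv ℝ v (c s)‖) (by simp)
    (fun x _ => (hB x).continuousAt.continuousWithinAt) (fun x _ => (hB x).hasDerivWithinAt)
    (fun x _ r hr => ?_) (right_mem_Icc.2 hpq)
  · rw [intervalIntegral.integral_of_le hpq, ← integral_Icc_eq_integral_Ioc] at key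
    rw [← ofReal_norm]
    refine (ENNReal.ofReal_le_ofReal key).trans_eq ?_
    rw [ofReal_integral_eq_lintegral_ofReal hDc.continuousOn.integrableOn_Icc
      (Eventually.of_forall fun _ => norm_nonneg _)]
    simp only [ofReal_norm]
  · refine Eventually.frequently ?_
    obtain ⟨r', hr', hr'r⟩ := exists_between hr
    have hd : HasFDerivAt v (fderiv ℝ v (c x)) (c x) :=
      ((hv.differentiable (by simp)) (c x)).hasFDerivAt
    have hlo := (hasFDerivAt_iff_isLittleO.1 hd).def (sub_pos.2 hr')
    have hlo' := hc.continuous.continuousAt.eventually hlo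
    filter_upwards [nhdsWithin_le_nhds hlo', self_mem_nhdsWithin] with z hz hxz
    have hxz' : 0 < z - x := sub_pos.2 hxz
    have hcz : ‖c z - c x‖ ≤ z - x := by
      have := hc.dist_le_mul z x
      rwa [NNReal.coe_one, one_mul, dist_eq_norm, Real.dist_eq, abs_of_pos hxz'] at this
    refine lt_of_le_of_lt ?_ hr'r
    rw [slope_def_field, div_le_iff₀ hxz']
    have h1 : ‖v (c z) - v (c p)‖ - ‖v (c x) - v (c p)‖ ≤ ‖v (c z) - v (c x)‖ := by
      refine (norm_sub_norm_le _ _).trans_eq ?_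
      rw [sub_sub_sub_cancel_right]
    have h2 : ‖v (c z) - v (c x)‖ ≤ r' * ‖c z - c x‖ := by
      have h3 := norm_le_norm_sub_add (v (c z) - v (c x)) (fderiv ℝ v (c x) (c z - c x))
      have h4 := (fderiv ℝ v (c x)).le_opNorm (c z - c x)
      linarith
    have h5 : 0 ≤ r' := (norm_nonneg _).trans hr'.le
    exact h1.trans (h2.trans (mul_le_mul_of_nonneg_left hcz h5))

lemma IsWeightedApprox.eventually_lintegral_le {u : Euc n → Euc n}
    {D : Euc n → Euc n →L[ℝ] Euc n} {U : Set (Euc n)} {v : ℕ → Euc n → Euc n} {w : Euc n → ℝ≥0∞}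
    (h : IsWeightedApprox u D U v w) {c : ℝ → Euc n} (hc : Continuous c) {p q : ℝ}
    (hcU : MapsTo c (Icc p q) U) :
    ∀ᶠ k in atTop,
      (∫⁻ s in Icc p q, ‖fderiv ℝ (v k) (c s)‖ₑ ≤
        (∫⁻ s in Icc p q, ‖D (c s)‖ₑ) + 2⁻¹ ^ k * ∫⁻ s in Icc p q, w (c s)) ∧
      (∫⁻ s in Icc p q, ‖D (c s)‖ₑ ≤
        (∫⁻ s in Icc p q, ‖fderiv ℝ (v k) (c s)‖ₑ) + 2⁻¹ ^ k * ∫⁻ s in Icc p q, w (c s)) := by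
  filter_upwards [h.enorm_sub_le _ hcU.image_subset (isCompact_Icc.image hc)] with k hk
  have hwm : Measurable fun s => 2⁻¹ ^ k * w (c s) :=
    (h.measurable.comp hc.measurable).const_mul _
  have hwc : Measurable fun s => w (c s) := h.measurable.comp hc.measurable
  rw [← lintegral_const_mul _ hwc, ← lintegral_add_right _ hwm, ← lintegral_add_right _ hwm]
  refine ⟨setLIntegral_mono' measurableSet_Icc fun s hs => ?_,
    setLIntegral_mono' measurableSet_Icc fun s hs => ?_⟩
  · exact (enorm_le_enorm_add_enorm_sub (fderiv ℝ (v k) (c s)) (D (c s))).1.trans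
      (add_le_add_right (hk _ (mem_image_of_mem c hs)) _)
  · exact (enorm_le_enorm_add_enorm_sub (fderiv ℝ (v k) (c s)) (D (c s))).2.trans
      (add_le_add_right (hk _ (mem_image_of_mem c hs)) _)

lemma IsWeightedApprox.lintegral_comp_ne_top {u : Euc n → Euc n}
    {D : Euc n → Euc n →L[ℝ] Euc n} {U : Set (Euc n)} {v : ℕ → Euc n → Euc n} {w : Euc n → ℝ≥0∞}
    (h : IsWeightedApprox u D U v w) {c : ℝ → Euc n} (hc : Continuous c) {p q : ℝ}
    (hcU : MapsTo c (Icc p q) U) (hw : (∫⁻ s in Icc p q, w (c s)) ≠ ∞) :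
    (∫⁻ s in Icc p q, ‖D (c s)‖ₑ) ≠ ∞ := by
  obtain ⟨k, -, hk⟩ := (h.eventually_lintegral_le hc hcU).exists
  have hDc : Continuous fun s => fderiv ℝ (v k) (c s) :=
    ((h.contDiff k).continuous_fderiv (by simp)).comp hc
  have hfin : (∫⁻ s in Icc p q, ‖fderiv ℝ (v k) (c s)‖ₑ) < ∞ :=
    hDc.continuousOn.integrableOn_Icc.hasFiniteIntegral
  exact ne_top_of_le_ne_top (ENNReal.add_ne_top.2 ⟨hfin.ne, ENNReal.mul_ne_top (by simp) hw⟩) hk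

/-- The fundamental estimate for a Sobolev map along a curve which is not exceptional. -/
lemma IsWeightedApprox.enorm_comp_sub_comp_le {u : Euc n → Euc n}
    {D : Euc n → Euc n →L[ℝ] Euc n} {U : Set (Euc n)} {v : ℕ → Euc n → Euc n} {w : Euc n → ℝ≥0∞}
    (h : IsWeightedApprox u D U v w) {c : ℝ → Euc n} (hc : LipschitzWith 1 c) {p q : ℝ}
    (hpq : p ≤ q) (hcU : MapsTo c (Icc p q) U) (hw : (∫⁻ s in Icc p q, w (c s)) ≠ ∞) :
    ‖u (c q) - u (c p)‖ₑ ≤ ∫⁻ s in Icc p q, ‖D (c s)‖ₑ := by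
  have hl : Tendsto (fun k => ‖v k (c q) - v k (c p)‖ₑ) atTop (nhds ‖u (c q) - u (c p)‖ₑ) :=
    ((h.tendsto _ (hcU (right_mem_Icc.2 hpq))).sub (h.tendsto _ (hcU (left_mem_Icc.2 hpq)))).enorm
  have hr : Tendsto (fun k : ℕ => (∫⁻ s in Icc p q, ‖D (c s)‖ₑ) +
      2⁻¹ ^ k * ∫⁻ s in Icc p q, w (c s)) atTop (nhds ((∫⁻ s in Icc p q, ‖D (c s)‖ₑ) + 0)) := by
    refine tendsto_const_nhds.add ?_
    have := ENNReal.Tendsto.mul_const (b := ∫⁻ s in Icc p q, w (c s))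
      (ENNReal.tendsto_pow_atTop_nhds_zero_of_lt_one (r := 2⁻¹) (by norm_num)) (Or.inr hw)
    rwa [zero_mul] at this
  rw [add_zero] at hr
  refine le_of_tendsto_of_tendsto hl hr ?_
  filter_upwards [h.eventually_lintegral_le hc.continuous hcU] with k hk
  exact (hc.enorm_comp_sub_comp_le (h.contDiff k) hpq).trans hk.1

lemma eVariationOn_Icc_le_lintegral {f : ℝ → Euc n} {G : ℝ → ℝ≥0∞} {a b : ℝ}
    (h : ∀ p ∈ Icc a b, ∀ q ∈ Icc a b, p ≤ q → edist (f q) (f p) ≤ ∫⁻ s in Icc p q, G s) :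
    eVariationOn f (Icc a b) ≤ ∫⁻ s in Icc a b, G s := by
  refine iSup_le fun ⟨N, u, hu, hmem⟩ => ?_
  calc ∑ i ∈ Finset.range N, edist (f (u (i + 1))) (f (u i))
      ≤ ∑ i ∈ Finset.range N, ∫⁻ s in Ioc (u i) (u (i + 1)), G s :=
        Finset.sum_le_sum fun i _ => (h _ (hmem i) _ (hmem (i + 1)) (hu i.le_succ)).trans_eq
          (setLIntegral_congr Ioc_ae_eq_Icc).symm
    _ = ∫⁻ s in ⋃ i ∈ Finset.range N, Ioc (u i) (u (i + 1)), G s :=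
        (lintegral_biUnion_finset (fun i _ j _ hij => hu.pairwise_disjoint_on_Ioc_succ hij)
          (fun _ _ => measurableSet_Ioc) _).symm
    _ ≤ ∫⁻ s in Icc a b, G s := lintegral_mono_set (iUnion₂_subset fun i _ s hs =>
        ⟨(hmem i).1.trans hs.1.le, hs.2.trans (hmem (i + 1)).2⟩)

lemma Curve.IsNaturalParam.lintegral_map_le {u : Euc n → Euc n} {D : Euc n → Euc n →L[ℝ] Euc n}
    {U : Set (Euc n)} {v : ℕ → Euc n → Euc n} {w : Euc n → ℝ≥0∞}
    (h : IsWeightedApprox u D U v w) (hDm : StronglyMeasurable D) {γ : Curve n} {L l : ℝ}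
    {c d : ℝ → Euc n} {σ τ : ℝ → ℝ} (hγ : γ.IsNaturalParam L c σ) (hγU : γ.In U)
    (hγu : (γ.map u).IsNaturalParam l d τ) (hw : (∫⁻ s in Icc 0 L, w (c s)) ≠ ∞)
    {ρ ρ' : Euc n → ℝ≥0∞} (hρ' : Measurable ρ') (hρ : ∀ y ∈ U, ρ' y = ρ (u y)) :
    ∫⁻ s in Icc 0 l, ρ (d s) ≤ ∫⁻ s in Icc 0 L, ρ' (c s) * ‖D (c s)‖ₑ := by
  have hL := hγ.nonneg
  set c₀ : ℝ → Euc n := fun s => c (projIcc 0 L hL s)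
  have hc₀c : ∀ s ∈ Icc 0 L, c₀ s = c s := fun s hs => by
    simp only [c₀, projIcc_of_mem hL hs]
  have hc₀ : LipschitzWith 1 c₀ := by
    have h1 := hγ.unitSpeed.lipschitzOnWith.to_restrict.comp (LipschitzWith.projIcc hL)
    rwa [one_mul] at h1
  have hc₀U : ∀ s, c₀ s ∈ U := fun s => by
    obtain ⟨t, ht, hts⟩ := hγ.surjOn (projIcc 0 L hL s).2
    have := hγU t ht
    rwa [hγ.eq t ht, hts] at this
  have hw₀ : (∫⁻ s in Icc 0 L, w (c₀ s)) ≠ ∞ := by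
    rwa [setLIntegral_congr_fun (g := fun s => w (c s)) measurableSet_Icc
      fun s hs => congrArg w (hc₀c s hs)]
  have hsurj : ∀ x ∈ Icc 0 l, ∃ t ∈ Icc γ.a γ.b, τ t = x := hγu.surjOn
  choose! t htmem ht using hsurj
  have hmono : ∀ x ∈ Icc 0 l, ∀ y ∈ Icc 0 l, x ≤ y → x = y ∨ t x ≤ t y := by
    intro x hx y hy hxy
    rcases le_total (t x) (t y) with h | h'
    · exact Or.inr h
    · left
      have := hγu.monotoneOn (htmem _ hy) (htmem _ hx) h'
      rw [ht _ hx, ht _ hy] at this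
      exact le_antisymm hxy this
  have hmaps : MapsTo (fun x => σ (t x)) (Icc 0 l) (Icc 0 L) := fun x hx => hγ.mapsTo (htmem _ hx)
  have hDc : Measurable fun s => ‖D (c₀ s)‖ₑ :=
    (hDm.measurable.comp hc₀.continuous.measurable).enorm
  have hρc : Measurable fun s => ρ' (c₀ s) := hρ'.comp hc₀.continuous.measurable
  have key := lintegral_comp_le_of_monotoneOn (κ := fun x => σ (t x)) (l := l) (L := L)
    (G := fun s => ‖D (c₀ s)‖ₑ) (F := fun s => ρ' (c₀ s)) ?_ hmaps hDc.aemeasurable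
    (h.lintegral_comp_ne_top hc₀.continuous (fun s _ => hc₀U s) hw₀) ?_ hρc
  · refine le_of_eq_of_le (setLIntegral_congr_fun measurableSet_Icc fun x hx => ?_)
      (key.trans_eq (setLIntegral_congr_fun measurableSet_Icc fun s hs => ?_))
    · have h1 : d x = u (γ.toFun (t x)) := by
        rw [← ht _ hx, ← hγu.eq _ (htmem _ hx), ht _ hx]
        rfl
      have h2 : c₀ (σ (t x)) = γ.toFun (t x) := by
        rw [hc₀c _ (hmaps hx), hγ.eq _ (htmem _ hx)]
      show ρ (d x) = ρ' (c₀ (σ (t x)))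
      rw [h1, h2, hρ _ (hγU _ (htmem _ hx))]
    · simp only [hc₀c s hs]
  · intro x hx y hy hxy
    rcases hmono x hx y hy hxy with rfl | h'
    · exact le_rfl
    · exact hγ.monotoneOn (htmem _ hx) (htmem _ hy) h'
  · intro x hx y hy hxy
    rcases hmono x hx y hy hxy with rfl | h'
    · simp
    · have hsub : Icc (t x) (t y) ⊆ Icc γ.a γ.b := Icc_subset_Icc (htmem _ hx).1 (htmem _ hy).2
      have e : eVariationOn (u ∘ γ.toFun) (Icc (t x) (t y)) = ENNReal.ofReal (τ (t y) - τ (t x)) :=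
        hγu.eVariationOn_eq _ (htmem _ hx) _ (htmem _ hy) h'
      rw [ht _ hx, ht _ hy] at e
      rw [← e, eVariationOn.eq_of_eqOn (f' := (u ∘ c₀) ∘ σ) fun s hs => ?_]
      · refine (eVariationOn.comp_le_of_monotoneOn (s := Icc (σ (t x)) (σ (t y))) _ _
          (hγ.monotoneOn.mono hsub) fun s hs => ?_).trans
          (eVariationOn_Icc_le_lintegral fun p hp q hq hpq => ?_)
        · exact ⟨hγ.monotoneOn (htmem _ hx) (hsub hs) hs.1,
            hγ.monotoneOn (hsub hs) (htmem _ hy) hs.2⟩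
        · rw [edist_eq_enorm_sub]
          exact h.enorm_comp_sub_comp_le hc₀ hpq (fun s _ => hc₀U s)
            (ne_top_of_le_ne_top hw₀ (lintegral_mono_set (Icc_subset_Icc
              ((hmaps hx).1.trans hp.1) (hq.2.trans (hmaps hy).2))))
      · simp only [Function.comp_apply]
        rw [hc₀c _ (hγ.mapsTo (hsub hs)), hγ.eq _ (hsub hs)]

lemma le_lintegral_pow_of_forall_le (hn : 1 ≤ n) {R w : Euc n → ℝ≥0∞} (hR : Measurable R)
    (hw : Measurable w) (hwn : (∫⁻ x, w x ^ n) ≠ ∞) {M : ℝ≥0∞}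
    (h : ∀ k : ℕ, M ≤ ∫⁻ x, (R x + 2⁻¹ ^ k * w x) ^ n) : M ≤ ∫⁻ x, R x ^ n := by
  by_cases hRn : (∫⁻ x, R x ^ n) = ∞
  · rw [hRn]
    exact le_top
  refine ge_of_tendsto' (x := (atTop : Filter ℕ)) ?_ h
  refine tendsto_lintegral_of_dominated_convergence (fun x => 2 ^ n * (R x ^ n + w x ^ n))
    (fun k => (hR.add (hw.const_mul _)).pow_const n) (fun k => Eventually.of_forall fun x => ?_)
    ?_ ?_
  · refine le_trans (pow_le_pow_left' (add_le_add_right ?_ _) n) (add_pow_le_two_pow_mul _ _ _)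
    exact mul_le_of_le_one_left' (pow_le_one' (by norm_num) k)
  · rw [lintegral_const_mul' _ _ (ENNReal.pow_ne_top (by simp)),
      lintegral_add_left (hR.pow_const n)]
    exact ENNReal.mul_ne_top (by simp) (ENNReal.add_ne_top.2 ⟨hRn, hwn⟩)
  · filter_upwards [ae_lt_top (hw.pow_const n) hwn] with x hx
    have hx' : w x ≠ ∞ := fun h => by
      rw [h, ENNReal.top_pow (by omega)] at hx
      exact hx.ne rfl
    have h0 : Tendsto (fun k : ℕ => R x + 2⁻¹ ^ k * w x) atTop (nhds (R x)) := by
      have := ENNReal.Tendsto.mul_const (b := w x)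
        (ENNReal.tendsto_pow_atTop_nhds_zero_of_lt_one (r := 2⁻¹) (by norm_num)) (Or.inr hx')
      have := this.const_add (R x)
      rwa [zero_mul, add_zero] at this
    exact ENNReal.Tendsto.pow h0

lemma Curve.IsArclengthParam.congr {γ γ' : Curve n} {L : ℝ} {c : ℝ → Euc n}
    (h : γ.IsArclengthParam L c) (ha : γ.a = γ'.a) (hb : γ.b = γ'.b)
    (heq : ∀ t ∈ Icc γ.a γ.b, γ.toFun t = γ'.toFun t) : γ'.IsArclengthParam L c := by
  obtain ⟨h1, h2, σ, h3, h4, h5, h6, h7⟩ := h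
  refine ⟨h1, h2, σ, ?_⟩
  rw [← ha, ← hb]
  exact ⟨h3, h4, h5, h6, fun t ht => (heq t ht).symm.trans (h7 t ht)⟩

lemma Curve.map_isPath {γ : Curve n} {φ : Euc n → Euc n} {Ω : Set (Euc n)} (h : γ.IsPath)
    (hΩ : γ.In Ω) (hφ : ContinuousOn φ Ω) : (γ.map φ).IsPath := hφ.comp h hΩ

lemma IsHomeoOn.isAdmissible_image {φ : Euc n → Euc n} {Ω Ω' : Set (Euc n)}
    (hφ : IsHomeoOn φ Ω Ω') (hΩ' : IsOpen Ω') {D' : Euc n → Euc n →L[ℝ] Euc n}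
    (hDm : StronglyMeasurable D') {v : ℕ → Euc n → Euc n} {w : Euc n → ℝ≥0∞}
    (h : IsWeightedApprox (Function.invFunOn φ Ω) D' Ω' v w) {Γ : Set (Curve n)}
    (hΓ : ∀ γ ∈ Γ, γ.In Ω ∧ γ.IsPath ∧ γ.Rectifiable) {ρ : Euc n → ℝ≥0∞}
    (hρ : IsAdmissible Γ ρ) {ε : ℝ≥0∞} (hε : ε ≠ 0) (hε' : ε ≠ ∞) :
    IsAdmissible ((fun γ => γ.map φ) '' Γ) fun y =>
      (Ω'.indicator fun y => ρ (Function.invFunOn φ Ω y)) y * ‖D' y‖ₑ + ε * w y := by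
  have hm : Measurable (Ω'.indicator fun y => ρ (Function.invFunOn φ Ω y)) :=
    hφ.measurable_indicator_comp_invFunOn hΩ' hρ.1
  have hm' : Measurable fun y =>
      (Ω'.indicator fun y => ρ (Function.invFunOn φ Ω y)) y * ‖D' y‖ₑ + ε * w y :=
    (hm.mul hDm.measurable.enorm).add (h.measurable.const_mul ε)
  refine ⟨hm', ?_⟩
  rintro _ ⟨γ, hγ, rfl⟩ hr
  obtain ⟨hγΩ, hγp, hγr⟩ := hΓ γ hγ
  have hmem : (γ.map φ).In Ω' := fun t ht => hφ.1.mapsTo (hγΩ t ht)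
  have hpath := Curve.map_isPath hγp hγΩ hφ.2.1
  have heq : ∀ t ∈ Icc γ.a γ.b, ((γ.map φ).map (Function.invFunOn φ Ω)).toFun t = γ.toFun t :=
    fun t ht => hφ.invFunOn_apply (hγΩ t ht)
  obtain ⟨L, c, σ, hc⟩ := Curve.exists_isNaturalParam hpath hr
  obtain ⟨l, d, τ, hd⟩ := Curve.exists_isNaturalParam
    (Curve.map_isPath hpath hmem hφ.2.2)
    ((eVariationOn.eq_of_eqOn (s := Icc γ.a γ.b) heq).trans_lt hγr)
  refine le_iInf fun l' => le_iInf fun c' => le_iInf fun hc' => ?_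
  refine le_trans ?_ (hc.lintegral_le hc' hm')
  by_cases hw : (∫⁻ s in Icc 0 L, w (c s)) = ∞
  · calc (1 : ℝ≥0∞) ≤ ε * ∫⁻ s in Icc 0 L, w (c s) := by
          rw [hw, ENNReal.mul_top hε]
          exact le_top
      _ = ∫⁻ s in Icc 0 L, ε * w (c s) := (lintegral_const_mul' _ _ hε').symm
      _ ≤ _ := lintegral_mono fun s => le_add_self
  · calc (1 : ℝ≥0∞) ≤ γ.lineIntegral ρ := hρ.2 γ hγ hγr
      _ ≤ ∫⁻ s in Icc 0 l, ρ (d s) :=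
        iInf_le_of_le l (iInf_le_of_le d (iInf_le _ (Curve.IsArclengthParam.congr (γ' := γ) hd.isArclengthParam rfl rfl heq)))
      _ ≤ ∫⁻ s in Icc 0 L, (Ω'.indicator fun y => ρ (Function.invFunOn φ Ω y)) (c s) *
          ‖D' (c s)‖ₑ := hc.lintegral_map_le h hDm hmem hd hw hm
            fun y hy => indicator_of_mem hy _
      _ ≤ _ := lintegral_mono fun s => le_self_add

lemma IsHomeoOn.modulus_image_le (hn : 1 ≤ n) {φ : Euc n → Euc n} {Ω Ω' : Set (Euc n)}
    (hφ : IsHomeoOn φ Ω Ω') (hΩ' : IsOpen Ω') {D' : Euc n → Euc n →L[ℝ] Euc n}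
    (hDm : StronglyMeasurable D') (hD' : WeakDeriv (Function.invFunOn φ Ω) D' Ω')
    (hD'n : (∫⁻ y in Ω', ‖D' y‖ₑ ^ n) ≠ ∞) {Γ : Set (Curve n)}
    (hΓ : ∀ γ ∈ Γ, γ.In Ω ∧ γ.IsPath ∧ γ.Rectifiable) {ρ : Euc n → ℝ≥0∞}
    (hρ : IsAdmissible Γ ρ) :
    modulus ((fun γ => γ.map φ) '' Γ) ≤
      ∫⁻ y in Ω', (ρ (Function.invFunOn φ Ω y) * ‖D' y‖ₑ) ^ n := by
  obtain ⟨v, w, h, hw⟩ := hD'.exists_isWeightedApprox hn hΩ' hφ.2.2 hDm hD'n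
  have hm : Measurable (Ω'.indicator fun y => ρ (Function.invFunOn φ Ω y)) :=
    hφ.measurable_indicator_comp_invFunOn hΩ' hρ.1
  have hR : Measurable fun y =>
      (Ω'.indicator fun y => ρ (Function.invFunOn φ Ω y)) y * ‖D' y‖ₑ :=
    hm.mul hDm.measurable.enorm
  refine (le_lintegral_pow_of_forall_le hn hR h.measurable hw fun k => ?_).trans_eq ?_
  · refine (iInf₂_le _ (hφ.isAdmissible_image hΩ' hDm h hΓ hρ (ε := 2⁻¹ ^ k)
      (by simp) (by simp))).trans_eq ?_
    simp only [ENNReal.rpow_natCast]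
  · rw [← lintegral_indicator hΩ'.measurableSet]
    refine lintegral_congr fun y => ?_
    by_cases hy : y ∈ Ω'
    · simp only [indicator_of_mem hy]
    · rw [indicator_of_notMem hy, indicator_of_notMem hy, zero_mul, zero_pow (by omega)]

end

theorem statement_5 (n : ℕ) (hn : 3 ≤ n) (Ω Ω' : Set (Euc n))
    (hΩ : IsDomainIn Ω) (hΩ' : IsDomainIn Ω')
    (φ : Euc n → Euc n) (hφ : IsHomeoOn φ Ω Ω') (hN : LuzinN φ Ω)
    (hcomp : IsCompOpBdd Ω Ω' φ (n : ℝ≥0∞) ((n : ℝ≥0∞) - 1)) :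
    ∃ D : Euc n → Euc n →L[ℝ] Euc n, HasWeakDerivOn φ D Ω ∧
      (∫⁻ x in Ω, innerDil D x) ≠ ∞ ∧
      IsQHomeo φ Ω Ω' (innerDil D) := by
  have hn2 : 2 ≤ n := by omega
  obtain ⟨C, hC', hC⟩ := hcomp.exists_compTestBound hn2
  obtain ⟨D, hDm, -, hD, hDq⟩ := hC.exists_weakDeriv hC' hn2 hΩ.1 hΩ'.1 hφ
  obtain ⟨C₁, hC₁', hC₁⟩ := hC.lintegral_mul_pow_le hC' hn2 hΩ.1 hφ hD hDq
  have hW : SmoothWeightBound φ Ω Ω' D C₁ := hC₁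
  have hfd := hW.finiteDistortionOn hC₁' hn2 hφ hΩ.1 hΩ'.1 hN hDm hD
  have hK : (∫⁻ x in Ω, innerDil D x) ≠ ∞ := ne_top_of_le_ne_top hC₁'
    (hW.lintegral_innerDil_le hC₁' hn2 hφ hΩ.1 hΩ'.1 hN hDm hD)
  obtain ⟨D', hDm', -, hD', hle⟩ :=
    hφ.exists_weakDeriv_invFunOn hn2 hΩ.1 hΩ'.1 hN hDm hD hfd hDq
  have hitg := hφ.lintegral_mul_enorm_pow_le hn2 hΩ.1 hΩ'.1 hN hDm hD hle
  have hDn : (∫⁻ y in Ω', ‖D' y‖ₑ ^ n) ≠ ∞ :=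
    ne_top_of_le_ne_top hK (by simpa using hitg fun _ => 1)
  refine ⟨D, hD, hK, hφ, measurable_innerDil (by omega) hDm, fun Γ hΓ ρ hρ => ?_⟩
  simp only [ENNReal.rpow_natCast]
  exact (hφ.modulus_image_le (by omega) hΩ'.1 hDm' hD' hDn hΓ hρ).trans (hitg ρ)
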